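/- There exist constants 0 < c ≤ C < ∞ such that for all integers 0 ≤ ρ ≤ ν, c·(2^{ρ}/2^{ν})² ≤ P(J_3(ρ,ν)) ≤ C·(2^{ρ}/2^{ν})². -/

import Mathlib

/-!
Critical site percolation on the triangular lattice realized on `ℤ²`.
A configuration assigns to each site `true` (open) or `false` (closed),
and `P` is the product Bernoulli(1/2) measure, axiomatized by
`IsBernoulliHalf` below (finite cylinder events have product probability).
-/

open MeasureTheory
open scoped ENNReal

/-- Sites of the lattice: vertices of `ℤ²`. -/
abbrev Site : Type := ℤ × ℤ

/-- A percolation configuration: `true` = open, `false` = closed. -/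
abbrev Config : Type := Site → Bool

/-- Adjacency for the triangular lattice realized on `ℤ²`:
the neighbors of `(x,y)` are `(x±1,y)`, `(x,y±1)`, `(x+1,y-1)`, `(x-1,y+1)`. -/
def Adj (a b : Site) : Prop :=
  (b.1 - a.1, b.2 - a.2) ∈
    ({(1, 0), (-1, 0), (0, 1), (0, -1), (1, -1), (-1, 1)} : Set (ℤ × ℤ))

/-- A (nonempty, self-avoiding) lattice path: a list of distinct sites in which
consecutive sites are neighbors. -/
def IsPath (p : List Site) : Prop := p ≠ [] ∧ p.Nodup ∧ p.Chain' Adj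

/-- A path all of whose vertices lie in the set `S`. -/
def PathIn (S : Set Site) (p : List Site) : Prop := IsPath p ∧ ∀ v ∈ p, v ∈ S

/-- All sites of `p` are open in `ω`. -/
def IsOpenOn (ω : Config) (p : List Site) : Prop := ∀ v ∈ p, ω v = true

/-- All sites of `p` are closed in `ω`. -/
def IsClosedOn (ω : Config) (p : List Site) : Prop := ∀ v ∈ p, ω v = false

/-- The first vertex of `p` lies in `A`. -/
def FirstIn (A : Set Site) (p : List Site) : Prop := ∃ a ∈ A, p.head? = some a

/-- The last vertex of `p` lies in `A`. -/
def LastIn (A : Set Site) (p : List Site) : Prop := ∃ a ∈ A, p.getLast? = some a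

/-- `μ` is the product Bernoulli(1/2) measure on configurations: a probability
measure for which every finite cylinder event has the product probability. -/
def IsBernoulliHalf (μ : Measure Config) : Prop :=
  IsProbabilityMeasure μ ∧
    ∀ (S : Finset Site) (f : Site → Bool),
      μ {ω | ∀ v ∈ S, ω v = f v} = (1 / 2 : ℝ≥0∞) ^ S.card

/-- The lattice rectangle `[x₀,x₁] × [y₀,y₁]`. -/
def rect (x₀ x₁ y₀ y₁ : ℤ) : Set Site :=
  {v | x₀ ≤ v.1 ∧ v.1 ≤ x₁ ∧ y₀ ≤ v.2 ∧ v.2 ≤ y₁}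

/-- The left side of a rectangle. -/
def rectLeft (x₀ x₁ y₀ y₁ : ℤ) : Set Site := {v ∈ rect x₀ x₁ y₀ y₁ | v.1 = x₀}

/-- The right side of a rectangle. -/
def rectRight (x₀ x₁ y₀ y₁ : ℤ) : Set Site := {v ∈ rect x₀ x₁ y₀ y₁ | v.1 = x₁}

/-- The top side of a rectangle. -/
def rectTop (x₀ x₁ y₀ y₁ : ℤ) : Set Site := {v ∈ rect x₀ x₁ y₀ y₁ | v.2 = y₁}

/-- The bottom side of a rectangle. -/
def rectBot (x₀ x₁ y₀ y₁ : ℤ) : Set Site := {v ∈ rect x₀ x₁ y₀ y₁ | v.2 = y₀}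

/-- A horizontal open crossing of the rectangle `[x₀,x₁] × [y₀,y₁]`:
an open path in the rectangle from its left side to its right side. -/
def HorizCrossing (x₀ x₁ y₀ y₁ : ℤ) (ω : Config) (p : List Site) : Prop :=
  PathIn (rect x₀ x₁ y₀ y₁) p ∧ IsOpenOn ω p ∧
    FirstIn (rectLeft x₀ x₁ y₀ y₁) p ∧ LastIn (rectRight x₀ x₁ y₀ y₁) p

/-- The box with bottom edge centered at `(a,b)` and radius `r`:
`[a-r, a+r] × [b, b+2r]`. -/
def hBox (a b r : ℤ) : Set Site :=
  {v | a - r ≤ v.1 ∧ v.1 ≤ a + r ∧ b ≤ v.2 ∧ v.2 ≤ b + 2 * r}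

/-- `∂₊`: the union of the top and side edges of the box `hBox a b r`. -/
def hBoxPlus (a b r : ℤ) : Set Site :=
  {v ∈ hBox a b r | v.1 = a - r ∨ v.1 = a + r ∨ v.2 = b + 2 * r}

/-- Counterclockwise coordinate (as viewed from inside the box) along
`∂₊ (hBox a b r)`, starting at the bottom-right corner, going up the right
edge, leftward along the top edge, and down the left edge. -/
def ccw (a b r : ℤ) (v : Site) : ℤ :=
  if v.1 = a + r then v.2 - b
  else if v.2 = b + 2 * r then 2 * r + (a + r - v.1)
  else 4 * r + (b + 2 * r - v.2)

/-- An arm of the horseshoe `hBox a b r₂ \ hBox a b r₁`: a path starting on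
`∂₊B₁`, ending on `∂₊B₂`, and otherwise remaining in the horseshoe. -/
def HorseArm (a b r₁ r₂ : ℤ) (p : List Site) : Prop :=
  IsPath p ∧ FirstIn (hBoxPlus a b r₁) p ∧ LastIn (hBoxPlus a b r₂) p ∧
    ∀ v ∈ p.tail, v ∈ hBox a b r₂ \ hBox a b r₁

/-- `J₃(ρ,ν)` (for the horseshoe pair with bottom center `(a,b)` and radii
`r₁ ≤ r₂`): there exist three pairwise disjoint arms crossing the horseshoe,
open, closed, open in counterclockwise order as viewed from the inner box. -/
def J3 (a b r₁ r₂ : ℤ) (ω : Config) : Prop :=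
  ∃ p₁ q p₂ : List Site,
    HorseArm a b r₁ r₂ p₁ ∧ IsOpenOn ω p₁ ∧
    HorseArm a b r₁ r₂ q ∧ IsClosedOn ω q ∧
    HorseArm a b r₁ r₂ p₂ ∧ IsOpenOn ω p₂ ∧
    List.Disjoint p₁ q ∧ List.Disjoint p₁ p₂ ∧ List.Disjoint q p₂ ∧
    (∀ u w, p₁.head? = some u → q.head? = some w → ccw a b r₁ u < ccw a b r₁ w) ∧
    (∀ u w, p₁.getLast? = some u → q.getLast? = some w → ccw a b r₂ u < ccw a b r₂ w) ∧
    (∀ u w, q.head? = some u → p₂.head? = some w → ccw a b r₁ u < ccw a b r₁ w) ∧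
    (∀ u w, q.getLast? = some u → p₂.getLast? = some w → ccw a b r₂ u < ccw a b r₂ w)

/-! ### Adjacency and connectivity -/

theorem adj_iff {a b : Site} : Adj a b ↔
    (b.1 = a.1 + 1 ∧ b.2 = a.2) ∨ (b.1 = a.1 - 1 ∧ b.2 = a.2) ∨
    (b.1 = a.1 ∧ b.2 = a.2 + 1) ∨ (b.1 = a.1 ∧ b.2 = a.2 - 1) ∨
    (b.1 = a.1 + 1 ∧ b.2 = a.2 - 1) ∨ (b.1 = a.1 - 1 ∧ b.2 = a.2 + 1) := by
  unfold Adj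
  simp only [Set.mem_insert_iff, Set.mem_singleton_iff, Prod.mk.injEq]
  omega

theorem Adj.symm {a b : Site} (h : Adj a b) : Adj b a := by
  rw [adj_iff] at *; omega

/-- `u` and `v` are joined by a lattice walk inside `S`. -/
def Conn (S : Set Site) (u v : Site) : Prop :=
  u ∈ S ∧ Relation.ReflTransGen (fun a b => Adj a b ∧ b ∈ S) u v

namespace Conn

variable {S T : Set Site} {u v w : Site}

theorem refl (h : u ∈ S) : Conn S u u := ⟨h, .refl⟩

theorem left_mem (h : Conn S u v) : u ∈ S := h.1

theorem right_mem (h : Conn S u v) : v ∈ S := by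
  rcases h.2.cases_tail with rfl | ⟨c, -, hc⟩
  · exact h.1
  · exact hc.2

theorem mono (hST : S ⊆ T) (h : Conn S u v) : Conn T u v :=
  ⟨hST h.1, Relation.ReflTransGen.mono (fun _ _ hab => ⟨hab.1, hST hab.2⟩) _ _ h.2⟩

theorem trans (h : Conn S u v) (h' : Conn S v w) : Conn S u w := ⟨h.1, h.2.trans h'.2⟩

theorem tail (h : Conn S u v) (ha : Adj v w) (hw : w ∈ S) : Conn S u w :=
  ⟨h.1, h.2.tail ⟨ha, hw⟩⟩

theorem of_adj (hu : u ∈ S) (ha : Adj u v) (hv : v ∈ S) : Conn S u v := (refl hu).tail ha hv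

/-- Induction on the last step of the walk. -/
theorem induction' (h : Conn S u v) (P : Site → Prop) (h0 : P u)
    (hs : ∀ a b, Conn S u a → P a → Adj a b → b ∈ S → P b) : P v := by
  obtain ⟨hu, h⟩ := h
  induction h with
  | refl => exact h0
  | tail h1 h2 ih => exact hs _ _ ⟨hu, h1⟩ ih h2.1 h2.2

theorem symm (h : Conn S u v) : Conn S v u := by
  refine h.induction' (fun w => Conn S w u) (refl h.1) fun a b hua hau hab hb => ?_
  exact (of_adj hb hab.symm hua.right_mem).trans hau

/-- First exit of a walk from a set. -/
theorem first_exit (h : Conn S u v) {M : Set Site} (hu : u ∈ M) (hv : v ∉ M) :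
    ∃ a b, Conn (S ∩ M) u a ∧ Adj a b ∧ b ∈ S ∧ b ∉ M := by
  by_contra hcon
  push Not at hcon
  have : Conn (S ∩ M) u v := by
    refine h.induction' (Conn (S ∩ M) u) (refl ⟨h.1, hu⟩) fun a b _ hau hab hb => ?_
    exact hau.tail hab ⟨hb, hcon a b hau hab hb⟩
  exact hv this.right_mem.2

/-- Last exit of a walk from a set. -/
theorem last_exit (h : Conn S u v) {M : Set Site} (hu : u ∈ M) (hv : v ∉ M) :
    ∃ a b, a ∈ S ∧ a ∈ M ∧ Adj a b ∧ Conn (S \ M) b v := by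
  obtain ⟨a, b, h1, h2, h3, h4⟩ := h.symm.first_exit (M := Mᶜ) hv (by simpa using hu)
  exact ⟨b, a, h3, by simpa using h4, h2.symm, h1.symm⟩

theorem map {f : Site → Site} (hf : ∀ a b, Adj a b → Adj (f a) (f b)) (hS : Set.MapsTo f S T)
    (h : Conn S u v) : Conn T (f u) (f v) :=
  h.induction' (fun w => Conn T (f u) (f w)) (refl (hS h.1)) fun _ _ _ hau hab hb => hau.tail (hf _ _ hab) (hS hb)

/-- The set of sites connected to `u`. -/
theorem within_cluster (h : Conn S u v) : Conn {w | Conn S u w} u v :=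
  h.induction' (Conn {w | Conn S u w} u) (refl (refl h.1)) fun _ _ hc hau hab hb => hau.tail hab (hc.tail hab hb)

theorem vert_up (x y : ℤ) (n : ℕ) (h : ∀ z, y ≤ z → z ≤ y + n → (x, z) ∈ S) :
    Conn S (x, y) (x, y + n) := by
  induction n with
  | zero => simpa using refl (h y le_rfl (by simp))
  | succ n ih =>
    refine (ih fun z h1 h2 => h z h1 (by push_cast; omega)).tail ?_ (h _ (by omega) (by omega))
    rw [adj_iff]; push_cast; simp; omega

theorem horiz_right (x y : ℤ) (n : ℕ) (h : ∀ z, x ≤ z → z ≤ x + n → (z, y) ∈ S) :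
    Conn S (x, y) (x + n, y) := by
  induction n with
  | zero => simpa using refl (h x le_rfl (by simp))
  | succ n ih =>
    refine (ih fun z h1 h2 => h z h1 (by push_cast; omega)).tail ?_ (h _ (by omega) (by omega))
    rw [adj_iff]; push_cast; simp; omega

/-- A vertical segment. -/
theorem vert (x y y' : ℤ) (h : ∀ z, min y y' ≤ z → z ≤ max y y' → (x, z) ∈ S) :
    Conn S (x, y) (x, y') := by
  rcases le_total y y' with hy | hy
  · have := vert_up (S := S) x y (y' - y).toNat fun z h1 h2 => h z (by omega) (by omega)
    rwa [show y + ((y' - y).toNat : ℤ) = y' by omega] at this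
  · have := vert_up (S := S) x y' (y - y').toNat fun z h1 h2 => h z (by omega) (by omega)
    rw [show y' + ((y - y').toNat : ℤ) = y by omega] at this
    exact this.symm

/-- A horizontal segment. -/
theorem horiz (y x x' : ℤ) (h : ∀ z, min x x' ≤ z → z ≤ max x x' → (z, y) ∈ S) :
    Conn S (x, y) (x', y) := by
  rcases le_total x x' with hy | hy
  · have := horiz_right (S := S) x y (x' - x).toNat fun z h1 h2 => h z (by omega) (by omega)
    rwa [show x + ((x' - x).toNat : ℤ) = x' by omega] at this
  · have := horiz_right (S := S) x' y (x - x').toNat fun z h1 h2 => h z (by omega) (by omega)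
    rw [show x' + ((x - x').toNat : ℤ) = x by omega] at this
    exact this.symm

end Conn

/-! ### Sites reached from a set -/

/-- Sites reached from `B`, moving from a site only when it lies in `X`, and staying in `D`. -/
inductive Reach (B D X : Set Site) : Site → Prop
  | base {v} : v ∈ B → Reach B D X v
  | step {u v} : Reach B D X u → u ∈ X → Adj u v → v ∈ D → Reach B D X v

theorem Reach.mono {B D X B' D' X' : Set Site} (hB : B ⊆ B') (hD : D ⊆ D') (hX : X ⊆ X')
    {v : Site} (h : Reach B D X v) : Reach B' D' X' v := by
  induction h with
  | base h => exact .base (hB h)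
  | step _ h1 h2 h3 ih => exact .step ih (hX h1) h2 (hD h3)

/-- The exploration only depends on the explored sites. -/
theorem Reach.congr {B D X X' : Set Site} (h : ∀ v, Reach B D X v → (v ∈ X ↔ v ∈ X')) {v : Site} :
    Reach B D X v ↔ Reach B D X' v := by
  constructor
  · intro hv
    induction hv with
    | base h => exact .base h
    | step h0 h1 h2 h3 ih => exact .step ih ((h _ h0).1 h1) h2 h3
  · intro hv
    induction hv with
    | base h => exact .base h
    | step h0 h1 h2 h3 ih => exact .step ih ((h _ ih).2 h1) h2 h3

theorem Reach.conn {B D X : Set Site} {u v : Site} (hu : Reach B D X u)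
    (h : Conn (X ∩ D) u v) : Reach B D X v := by
  have : Reach B D X v ∧ v ∈ X := h.induction' (fun v => Reach B D X v ∧ v ∈ X) ⟨hu, h.1.1⟩ fun a b _ ha hab hb =>
    ⟨.step ha.1 ha.2 hab hb.2, hb.1⟩
  exact this.1

theorem Reach.mem {B D X : Set Site} {v : Site} (h : Reach B D X v) : v ∈ B ∨ v ∈ D := by
  cases h with
  | base h => exact .inl h
  | step _ _ _ h => exact .inr h

/-- Unfolding a reached site into a walk. -/
theorem Reach.exists_conn {B D X : Set Site} {v : Site} (h : Reach B D X v) :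
    v ∈ B ∨ ∃ s ∈ B, s ∈ X ∧ ∃ u, Conn ({w | Reach B D X w} ∩ X ∩ (B ∪ D)) s u ∧ Adj u v ∧ v ∈ D := by
  induction h with
  | base h => exact .inl h
  | @step u v hu hx ha hv ih =>
    right
    rcases ih with ih | ⟨s, hs, hsX, w, hw, hwu, hu'⟩
    · exact ⟨u, ih, hx, u, .refl ⟨⟨hu, hx⟩, .inl ih⟩, ha, hv⟩
    · exact ⟨s, hs, hsX, u, hw.tail hwu ⟨⟨hu, hx⟩, .inr hu'⟩, ha, hv⟩

/-! ### Planar topology -/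

theorem flux_edge_right {c1 c2 d1 d2 : ℤ} (x y : ℤ)
    (h : (d1 = c1 + 1 ∧ d2 = c2) ∨ (d1 = c1 - 1 ∧ d2 = c2) ∨ (d1 = c1 ∧ d2 = c2 + 1) ∨
      (d1 = c1 ∧ d2 = c2 - 1) ∨ (d1 = c1 + 1 ∧ d2 = c2 - 1) ∨ (d1 = c1 - 1 ∧ d2 = c2 + 1))
    (e1 : ¬ (c1 = x ∧ c2 = y)) (e2 : ¬ (d1 = x ∧ d2 = y))
    (e3 : ¬ (c1 = x + 1 ∧ c2 = y)) (e4 : ¬ (d1 = x + 1 ∧ d2 = y)) :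
    ((if c1 = x ∧ d1 = x + 1 ∧ y < c2 then (1 : ℤ) else 0)
      - (if d1 = x ∧ c1 = x + 1 ∧ y < d2 then 1 else 0))
    - ((if c1 = x + 1 ∧ d1 = x + 1 + 1 ∧ y < c2 then (1 : ℤ) else 0)
      - (if d1 = x + 1 ∧ c1 = x + 1 + 1 ∧ y < d2 then 1 else 0))
    = (if d1 = x + 1 ∧ y < d2 then 1 else 0) - (if c1 = x + 1 ∧ y < c2 then 1 else 0) := by
  rcases h with ⟨rfl, rfl⟩ | ⟨rfl, rfl⟩ | ⟨rfl, rfl⟩ | ⟨rfl, rfl⟩ | ⟨rfl, rfl⟩ | ⟨rfl, rfl⟩ <;> grind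

theorem flux_edge_diag {c1 c2 d1 d2 : ℤ} (x y : ℤ)
    (h : (d1 = c1 + 1 ∧ d2 = c2) ∨ (d1 = c1 - 1 ∧ d2 = c2) ∨ (d1 = c1 ∧ d2 = c2 + 1) ∨
      (d1 = c1 ∧ d2 = c2 - 1) ∨ (d1 = c1 + 1 ∧ d2 = c2 - 1) ∨ (d1 = c1 - 1 ∧ d2 = c2 + 1))
    (e1 : ¬ (c1 = x ∧ c2 = y)) (e2 : ¬ (d1 = x ∧ d2 = y))
    (e3 : ¬ (c1 = x + 1 ∧ c2 = y - 1)) (e4 : ¬ (d1 = x + 1 ∧ d2 = y - 1)) :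
    ((if c1 = x ∧ d1 = x + 1 ∧ y < c2 then (1 : ℤ) else 0)
      - (if d1 = x ∧ c1 = x + 1 ∧ y < d2 then 1 else 0))
    - ((if c1 = x + 1 ∧ d1 = x + 1 + 1 ∧ y - 1 < c2 then (1 : ℤ) else 0)
      - (if d1 = x + 1 ∧ c1 = x + 1 + 1 ∧ y - 1 < d2 then 1 else 0))
    = (if d1 = x + 1 ∧ y - 1 < d2 then 1 else 0)
      - (if c1 = x + 1 ∧ y - 1 < c2 then 1 else 0) := by
  rcases h with ⟨rfl, rfl⟩ | ⟨rfl, rfl⟩ | ⟨rfl, rfl⟩ | ⟨rfl, rfl⟩ | ⟨rfl, rfl⟩ | ⟨rfl, rfl⟩ <;> grind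

/-- The flux of a walk through vertical cuts. -/
theorem Conn.exists_flux {L : Set Site} {a b : Site} (h : Conn L a b) :
    ∃ E : Site → ℤ,
      (∀ x y, (x, y + 1) ∉ L → E (x, y) = E (x, y + 1)) ∧
      (∀ x y, (x, y) ∉ L → (x + 1, y) ∉ L → E (x, y) - E (x + 1, y) =
        (if b.1 = x + 1 ∧ y < b.2 then 1 else 0) - (if a.1 = x + 1 ∧ y < a.2 then 1 else 0)) ∧
      (∀ x y, (x, y) ∉ L → (x + 1, y - 1) ∉ L → E (x, y) - E (x + 1, y - 1) =
        (if b.1 = x + 1 ∧ y - 1 < b.2 then 1 else 0)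
          - (if a.1 = x + 1 ∧ y - 1 < a.2 then 1 else 0)) ∧
      (∀ x y, (∀ p ∈ L, p.1 = x → p.2 ≤ y) → E (x, y) = 0) ∧
      (∀ x y, (∀ p ∈ L, p.1 = x → y < p.2) → E (x, y) =
        (if a.1 ≤ x then 1 else 0) - (if b.1 ≤ x then 1 else 0)) := by
  refine h.induction' (fun d =>
    ∃ E : Site → ℤ,
      (∀ x y, (x, y + 1) ∉ L → E (x, y) = E (x, y + 1)) ∧
      (∀ x y, (x, y) ∉ L → (x + 1, y) ∉ L → E (x, y) - E (x + 1, y) =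
        (if d.1 = x + 1 ∧ y < d.2 then 1 else 0) - (if a.1 = x + 1 ∧ y < a.2 then 1 else 0)) ∧
      (∀ x y, (x, y) ∉ L → (x + 1, y - 1) ∉ L → E (x, y) - E (x + 1, y - 1) =
        (if d.1 = x + 1 ∧ y - 1 < d.2 then 1 else 0)
          - (if a.1 = x + 1 ∧ y - 1 < a.2 then 1 else 0)) ∧
      (∀ x y, (∀ p ∈ L, p.1 = x → p.2 ≤ y) → E (x, y) = 0) ∧
      (∀ x y, (∀ p ∈ L, p.1 = x → y < p.2) → E (x, y) =
        (if a.1 ≤ x then 1 else 0) - (if d.1 ≤ x then 1 else 0)))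
    ⟨fun _ => 0, by simp⟩ ?_
  rintro c d hc ⟨E, h1, h2, h3, h4, h5⟩ hcd hd
  have hcL := hc.right_mem
  obtain ⟨c1, c2⟩ := c
  obtain ⟨d1, d2⟩ := d
  simp only [adj_iff] at hcd
  refine ⟨fun z => E z + (if c1 = z.1 ∧ d1 = z.1 + 1 ∧ z.2 < c2 then 1 else 0)
    - (if d1 = z.1 ∧ c1 = z.1 + 1 ∧ z.2 < d2 then 1 else 0), ?_, ?_, ?_, ?_, ?_⟩
  · intro x y hz
    have := h1 x y hz
    have e1 : ¬ (c1 = x ∧ c2 = y + 1) := by rintro ⟨rfl, rfl⟩; exact hz hcL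
    have e2 : ¬ (d1 = x ∧ d2 = y + 1) := by rintro ⟨rfl, rfl⟩; exact hz hd
    simp only
    split_ifs <;> omega
  · intro x y hz hz'
    have := h2 x y hz hz'
    have e1 : ¬ (c1 = x ∧ c2 = y) := by rintro ⟨rfl, rfl⟩; exact hz hcL
    have e2 : ¬ (d1 = x ∧ d2 = y) := by rintro ⟨rfl, rfl⟩; exact hz hd
    have e3 : ¬ (c1 = x + 1 ∧ c2 = y) := by rintro ⟨rfl, rfl⟩; exact hz' hcL
    have e4 : ¬ (d1 = x + 1 ∧ d2 = y) := by rintro ⟨rfl, rfl⟩; exact hz' hd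
    simp only at this ⊢
    have := flux_edge_right x y hcd e1 e2 e3 e4
    linarith
  · intro x y hz hz'
    have := h3 x y hz hz'
    have e1 : ¬ (c1 = x ∧ c2 = y) := by rintro ⟨rfl, rfl⟩; exact hz hcL
    have e2 : ¬ (d1 = x ∧ d2 = y) := by rintro ⟨rfl, rfl⟩; exact hz hd
    have e3 : ¬ (c1 = x + 1 ∧ c2 = y - 1) := by rintro ⟨rfl, rfl⟩; exact hz' hcL
    have e4 : ¬ (d1 = x + 1 ∧ d2 = y - 1) := by rintro ⟨rfl, rfl⟩; exact hz' hd
    simp only at this ⊢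
    have := flux_edge_diag x y hcd e1 e2 e3 e4
    linarith
  · intro x y hz
    have := h4 x y hz
    have e1 := hz _ hcL
    have e2 := hz _ hd
    simp only at e1 e2 ⊢
    split_ifs <;> omega
  · intro x y hz
    have := h5 x y hz
    have e1 := hz _ hcL
    have e2 := hz _ hd
    simp only at e1 e2 this ⊢
    generalize (if a.1 ≤ x then (1:ℤ) else 0) = C at *
    clear h1 h2 h3 h4 h5 hz
    split_ifs at * <;> omega

/-- A walk above the line `y = y₀` with both ends on this line cannot separate a disjoint walk
starting on the line, whose end lies above the first walk. -/
theorem no_cross {L Q : Set Site} {u₁ u₂ v y₀ : ℤ} {z : Site}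
    (hL : Conn L (u₁, y₀) (u₂, y₀)) (hLy : ∀ p ∈ L, y₀ ≤ p.2)
    (hQ : Conn Q (v, y₀) z) (hQy : ∀ p ∈ Q, y₀ ≤ p.2)
    (hd : ∀ p ∈ L, p ∉ Q) (hz : ∀ p ∈ L, p.1 = z.1 → p.2 < z.2) : u₁ ≤ v ↔ u₂ ≤ v := by
  obtain ⟨E, h1, h2, h3, h4, h5⟩ := hL.exists_flux
  have hQL : ∀ p ∈ Q, p ∉ L := fun p hp hp' => hd p hp' hp
  have key : E (v, y₀) = E z := by
    refine hQ.induction' (fun z => E (v, y₀) = E z) rfl ?_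
    rintro ⟨c1, c2⟩ ⟨d1, d2⟩ hc ih hcd hd
    rw [ih]
    have hc1 := hQL _ hc.right_mem
    have hd1 := hQL _ hd
    have hc2 := hQy _ hc.right_mem
    have hd2 := hQy _ hd
    simp only [adj_iff] at hcd hc2 hd2
    rcases hcd with ⟨rfl, rfl⟩ | ⟨rfl, rfl⟩ | ⟨rfl, rfl⟩ | ⟨rfl, rfl⟩ | ⟨rfl, rfl⟩ | ⟨rfl, rfl⟩
    · have := h2 _ _ hc1 hd1
      simp only at this
      split_ifs at this <;> omega
    · have := h2 _ _ hd1 (by simpa using hc1)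
      simp only [sub_add_cancel] at this
      split_ifs at this <;> omega
    · exact h1 _ _ hd1
    · have := h1 _ (c2 - 1) (by simpa using hc1)
      simpa using this.symm
    · have := h3 _ _ hc1 hd1
      simp only at this
      split_ifs at this <;> omega
    · have := h3 _ _ hd1 (by simpa using hc1)
      simp only [sub_add_cancel, add_sub_cancel_right] at this
      split_ifs at this <;> omega
  have e1 : E z = 0 := h4 z.1 z.2 fun p hp hpz => (hz p hp hpz).le
  have e2 := h5 v y₀ fun p hp hpv => by
    have := hLy p hp
    rcases this.lt_or_eq with h | h
    · exact h
    · exact absurd (show p = (v, y₀) from Prod.ext hpv h.symm) (fun h => hd p hp (h ▸ hQ.1))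
  rw [key, e1] at e2
  simp only at e2
  split_ifs at e2 <;> omega

/-- A left-right walk and a bottom-top walk in a rectangle meet. -/
theorem rect_cross {P Q : Set Site} {x₀ x₁ y₀ y₁ : ℤ} {a b c d : Site}
    (hP : Conn P a b) (hPr : P ⊆ rect x₀ x₁ y₀ y₁) (ha : a.1 = x₀) (hb : b.1 = x₁)
    (hQ : Conn Q c d) (hQr : Q ⊆ rect x₀ x₁ y₀ y₁) (hc : c.2 = y₀) (hd : d.2 = y₁) :
    ∃ p ∈ P, p ∈ Q := by
  by_contra hcon
  push Not at hcon
  obtain ⟨a1, a2⟩ := a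
  obtain ⟨b1, b2⟩ := b
  obtain ⟨c1, c2⟩ := c
  obtain ⟨d1, d2⟩ := d
  simp only at ha hb hc hd
  subst ha hb hc hd
  have hpa := hPr hP.1
  have hpb := hPr hP.right_mem
  have hqc := hQr hQ.1
  have hqd := hQr hQ.right_mem
  simp only [rect, Set.mem_ofPred_eq] at hpa hpb hqc hqd
  set L : Set Site := P ∪ {p | (p.1 = a1 - 1 ∧ c2 ≤ p.2 ∧ p.2 ≤ a2) ∨ (p.1 = b1 + 1 ∧ c2 ≤ p.2 ∧ p.2 ≤ b2)}
    with hLdef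
  have hL : Conn L (a1 - 1, c2) (b1 + 1, c2) := by
    have h1 : Conn L (a1 - 1, c2) (a1 - 1, a2) :=
      .vert _ _ _ fun z h1 h2 => .inr (.inl ⟨rfl, by simp only; omega, by simp only; omega⟩)
    have h2 : Conn L (b1 + 1, b2) (b1 + 1, c2) :=
      .vert _ _ _ fun z h1 h2 => .inr (.inr ⟨rfl, by simp only; omega, by simp only; omega⟩)
    have h3 : Conn L (a1, a2) (b1, b2) := hP.mono Set.subset_union_left
    exact ((h1.tail (by rw [adj_iff]; simp) h3.1).trans h3).trans
      (.trans (.of_adj h3.right_mem (by rw [adj_iff]; simp) h2.1) h2)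
  have hQ' : Conn (Q ∪ {(d1, d2 + 1)}) (c1, c2) (d1, d2 + 1) :=
    (hQ.mono Set.subset_union_left).tail (by rw [adj_iff]; simp) (by simp)
  have := no_cross hL ?_ hQ' ?_ ?_ ?_
  · omega
  · rintro p (hp | hp | hp)
    · exact (hPr hp).2.2.1
    · exact hp.2.1
    · exact hp.2.1
  · rintro p (hp | rfl)
    · exact (hQr hp).2.2.1
    · simp only; omega
  · rintro p (hp | hp) (hq | rfl)
    · exact hcon p hp hq
    · have := hPr hp; simp only [rect, Set.mem_ofPred_eq] at this; omega
    · have := hQr hq; simp only [rect, Set.mem_ofPred_eq] at this hp; omega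
    · simp only [Set.mem_ofPred_eq] at hp; omega
  · rintro p (hp | hp) h
    · have := (hPr hp).2.2.2; simp only; omega
    · simp only [Set.mem_ofPred_eq] at hp h ⊢; omega

/-- Position along the perimeter of a rectangle: up the right side, leftwards along the top,
down the left side. -/
def perim (x₀ x₁ y₀ y₁ : ℤ) (t : Site) : ℤ :=
  if t.1 = x₁ then t.2 - y₀ else if t.2 = y₁ then (y₁ - y₀) + (x₁ - t.1)
  else (y₁ - y₀) + (x₁ - x₀) + (y₁ - t.2)

/-- Disjoint walks from the bottom side of a rectangle to the other sides are ordered. -/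
theorem perim_order {P Q : Set Site} {x₀ x₁ y₀ y₁ u v : ℤ} {s t : Site}
    (hP : Conn P (u, y₀) s) (hPr : P ⊆ rect x₀ x₁ y₀ y₁)
    (hs : s.1 = x₀ ∨ s.1 = x₁ ∨ s.2 = y₁)
    (hQ : Conn Q (v, y₀) t) (hQr : Q ⊆ rect x₀ x₁ y₀ y₁)
    (ht : t.1 = x₀ ∨ t.1 = x₁ ∨ t.2 = y₁) (hd : ∀ p ∈ P, p ∉ Q)
    (hlt : perim x₀ x₁ y₀ y₁ s < perim x₀ x₁ y₀ y₁ t) : v < u := by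
  obtain ⟨s1, s2⟩ := s
  obtain ⟨t1, t2⟩ := t
  have hps := hPr hP.right_mem
  have hpu := hPr hP.1
  have hqt := hQr hQ.right_mem
  have hqv := hQr hQ.1
  simp only [rect, Set.mem_ofPred_eq] at hps hpu hqt hqv hs ht
  -- the part of the outer ring from `s` clockwise
  obtain ⟨O, hO, hOr, hOt⟩ : ∃ O : Set Site, Conn (P ∪ O) (u, y₀) (x₁ + 1, y₀) ∧
      (∀ p ∈ O, p ∉ rect x₀ x₁ y₀ y₁ ∧ y₀ ≤ p.2 ∧ x₀ - 1 ≤ p.1) ∧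
      (∀ p ∈ O, (p.1 = x₁ + 1 → t1 = x₁ → p.2 < t2) ∧
        (x₀ ≤ p.1 → p.1 ≤ x₁ → t2 = y₁ → t1 < p.1) ∧ (p.1 = x₀ - 1 → t1 = x₀ → t2 < p.2)) := by
    by_cases h1 : s1 = x₁
    · refine ⟨{p | p.1 = x₁ + 1 ∧ y₀ ≤ p.2 ∧ p.2 ≤ s2}, ?_, ?_, ?_⟩
      · refine ((hP.mono Set.subset_union_left).tail (w := (x₁ + 1, s2)) ?_ ?_).trans (.vert _ _ _ ?_)
        · rw [adj_iff]; simp; omega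
        · right; simp; omega
        · intro z h1 h2; right; simp; omega
      · intro p hp; simp only [rect, Set.mem_ofPred_eq] at hp ⊢; omega
      · intro p hp; simp only [perim, Set.mem_ofPred_eq] at hp hlt ⊢
        rw [if_pos h1] at hlt
        refine ⟨fun _ h => ?_, by omega, by omega⟩
        rw [if_pos h] at hlt; omega
    by_cases h2 : s2 = y₁
    · refine ⟨{p | (p.2 = y₁ + 1 ∧ s1 ≤ p.1 ∧ p.1 ≤ x₁ + 1) ∨ (p.1 = x₁ + 1 ∧ y₀ ≤ p.2 ∧ p.2 ≤ y₁ + 1)},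
        ?_, ?_, ?_⟩
      · refine (((hP.mono Set.subset_union_left).tail (w := (s1, y₁ + 1)) ?_ ?_).trans
          (.horiz _ _ (x₁ + 1) ?_)).trans (.vert _ _ _ ?_)
        · rw [adj_iff]; simp; omega
        · right; simp; omega
        · intro z h1 h2; right; simp; omega
        · intro z h1 h2; right; simp; omega
      · intro p hp; simp only [rect, Set.mem_ofPred_eq] at hp ⊢; omega
      · intro p hp; simp only [perim, Set.mem_ofPred_eq] at hp hlt ⊢
        rw [if_neg h1, if_pos h2] at hlt
        split_ifs at hlt <;> omega
    · refine ⟨{p | (p.1 = x₀ - 1 ∧ s2 ≤ p.2 ∧ p.2 ≤ y₁ + 1) ∨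
        (p.2 = y₁ + 1 ∧ x₀ - 1 ≤ p.1 ∧ p.1 ≤ x₁ + 1) ∨ (p.1 = x₁ + 1 ∧ y₀ ≤ p.2 ∧ p.2 ≤ y₁ + 1)},
        ?_, ?_, ?_⟩
      · refine ((((hP.mono Set.subset_union_left).tail (w := (x₀ - 1, s2)) ?_ ?_).trans
          (.vert _ _ (y₁ + 1) ?_)).trans
          (.horiz _ _ (x₁ + 1) ?_)).trans (.vert _ _ _ ?_)
        · rw [adj_iff]; simp; omega
        · right; simp; omega
        · intro z h1 h2; right; simp; omega
        · intro z h1 h2; right; simp; omega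
        · intro z h1 h2; right; simp; omega
      · intro p hp; simp only [rect, Set.mem_ofPred_eq] at hp ⊢; omega
      · intro p hp; simp only [perim, Set.mem_ofPred_eq] at hp hlt ⊢
        rw [if_neg h1, if_neg h2] at hlt
        split_ifs at hlt <;> omega
  have hPO : ∀ p ∈ P ∪ O, y₀ ≤ p.2 := by
    rintro p (hp | hp)
    · exact (hPr hp).2.2.1
    · exact (hOr p hp).2.1
  -- the outgoing end of the other walk
  obtain ⟨T, z, hT, hTP, hTy, hz⟩ : ∃ (T : Set Site) (z : Site), Conn (Q ∪ T) (v, y₀) z ∧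
      (∀ p ∈ T, p ∉ P ∪ O) ∧ (∀ p ∈ T, y₀ ≤ p.2) ∧ (∀ p ∈ P ∪ O, p.1 = z.1 → p.2 < z.2) := by
    have hPb : ∀ p ∈ P, x₀ ≤ p.1 ∧ p.1 ≤ x₁ ∧ y₀ ≤ p.2 ∧ p.2 ≤ y₁ := fun p hp => hPr hp
    by_cases h1 : t1 = x₁
    · refine ⟨{(x₁ + 1, t2)}, (x₁ + 1, t2), (hQ.mono Set.subset_union_left).tail ?_ (by simp), ?_, ?_, ?_⟩
      · rw [adj_iff]; simp; omega
      · rintro p rfl (hp | hp)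
        · have := hPb _ hp; simp only at this; omega
        · have := (hOt _ hp).1 rfl h1; simp at this
      · rintro p rfl; simp only; omega
      · rintro p (hp | hp) hpz
        · have := hPb _ hp; simp only at this hpz; omega
        · exact (hOt _ hp).1 hpz h1
    by_cases h2 : t2 = y₁
    · refine ⟨{(t1, y₁ + 1)}, (t1, y₁ + 1), (hQ.mono Set.subset_union_left).tail ?_ (by simp), ?_, ?_, ?_⟩
      · rw [adj_iff]; simp; omega
      · rintro p rfl (hp | hp)
        · have := hPb _ hp; simp only at this; omega
        · have := (hOt _ hp).2.1; simp only at this; omega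
      · rintro p rfl; simp only; omega
      · rintro p (hp | hp) hpz
        · have := hPb _ hp; simp only at this hpz ⊢; omega
        · have := (hOt _ hp).2.1; simp only at this hpz; omega
    · refine ⟨{(x₀ - 1, t2), (x₀ - 2, t2)}, (x₀ - 2, t2),
        ((hQ.mono Set.subset_union_left).tail (w := (x₀ - 1, t2)) ?_ (by simp)).tail ?_ (by simp), ?_, ?_, ?_⟩
      · rw [adj_iff]; simp; omega
      · rw [adj_iff]; simp; omega
      · rintro p (rfl | rfl) (hp | hp)
        · have := hPb _ hp; simp only at this; omega
        · exact absurd ((hOt _ hp).2.2 rfl (by omega)) (lt_irrefl _)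
        · have := hPb _ hp; simp only at this; omega
        · have := (hOr _ hp).2.2; simp only at this; omega
      · rintro p (rfl | rfl) <;> simp only <;> omega
      · rintro p (hp | hp) hpz
        · have := hPb _ hp; simp only at this hpz ⊢; omega
        · have := (hOr _ hp).2.2; simp only at this hpz; omega
  have := no_cross hO hPO hT ?_ ?_ hz
  · omega
  · rintro p (hp | hp)
    · exact (hQr hp).2.2.1
    · exact hTy p hp
  · rintro p hp (hq | hq)
    · rcases hp with hp | hp
      · exact hd p hp hq
      · exact (hOr p hp).1 (hQr hq)
    · exact hTP p hq hp

theorem hex_triangle {p1 p2 p3 q1 q2 q3 : Prop} [Decidable ((p1 ∧ q2) ∨ (q1 ∧ p2))]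
    [Decidable ((p2 ∧ q3) ∨ (q2 ∧ p3))] [Decidable ((p1 ∧ q3) ∨ (q1 ∧ p3))]
    (a1 : p1 → ¬ q1) (a2 : p2 → ¬ q2) (a3 : p3 → ¬ q3)
    (w0 : p1 → q2 → p3 ∨ q3) (w1 : p1 → q3 → p2 ∨ q2) (w2 : p2 → q1 → p3 ∨ q3)
    (w3 : p2 → q3 → p1 ∨ q1) (w4 : p3 → q1 → p2 ∨ q2) (w5 : p3 → q2 → p1 ∨ q1) :
    (if (p1 ∧ q2) ∨ (q1 ∧ p2) then 1 else 0) + (if (p2 ∧ q3) ∨ (q2 ∧ p3) then 1 else 0)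
      + (if (p1 ∧ q3) ∨ (q1 ∧ p3) then 1 else 0) = (0 : ZMod 2) := by
  have e : (1 + 1 : ZMod 2) = 0 := by decide
  by_cases h1 : p1 <;> by_cases h2 : p2 <;> by_cases h3 : p3 <;>
    by_cases h4 : q1 <;> by_cases h5 : q2 <;> by_cases h6 : q3 <;> simp_all

/-- Hex: either `X` crosses the rectangle horizontally or its complement crosses it vertically. -/
theorem hex (X : Set Site) {x₀ x₁ y₀ y₁ : ℤ} (hx : x₀ ≤ x₁) (hy : y₀ ≤ y₁) :
    (∃ a b, a.1 = x₀ ∧ b.1 = x₁ ∧ Conn (X ∩ rect x₀ x₁ y₀ y₁) a b) ∨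
    (∃ a b, a.2 = y₀ ∧ b.2 = y₁ ∧ Conn (rect x₀ x₁ y₀ y₁ \ X) a b) := by
  classical
  by_contra hcon
  push Not at hcon
  obtain ⟨hcX, hcY⟩ := hcon
  set D := rect x₀ x₁ y₀ y₁ with hD
  set A : Set Site := {z | z.1 = x₀ - 1 ∨ ∃ a, a.1 = x₀ ∧ Conn (X ∩ D) a z} with hA
  set T : Set Site := {z | ∃ a, a.2 = y₀ ∧ Conn (D \ X) a z} with hT
  have hAT : ∀ z ∈ A, z ∉ T := by
    rintro z (hz | ⟨a, -, ha⟩) ⟨b, -, hb⟩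
    · have := hb.right_mem.1.1; omega
    · exact hb.right_mem.2 ha.right_mem.1
  have hAX : ∀ a ∈ A, ∀ c ∈ D, c ∈ X → Adj a c → c ∈ A := by
    rintro a (ha | ⟨s, hs, ha⟩) c hc hcX hac
    · refine .inr ⟨c, ?_, .refl ⟨hcX, hc⟩⟩
      have := hc.1
      rw [adj_iff] at hac; omega
    · exact .inr ⟨s, hs, ha.tail hac ⟨hcX, hc⟩⟩
  have hTX : ∀ a ∈ T, ∀ c ∈ D, c ∉ X → Adj a c → c ∈ T := by
    rintro a ⟨s, hs, ha⟩ c hc hcX hac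
    exact ⟨s, hs, ha.tail hac ⟨hc, hcX⟩⟩
  have third : ∀ a ∈ A, ∀ b ∈ T, ∀ c, (c.1 = x₀ - 1 ∨ c ∈ D) → Adj a c → Adj b c →
      c ∈ A ∨ c ∈ T := by
    rintro a ha b hb c (hc | hc) hac hbc
    · exact .inl (.inl hc)
    by_cases hX : c ∈ X
    · exact .inl (hAX a ha c hc hX hac)
    · exact .inr (hTX b hb c hc hX hbc)
  let k : Site → Site → ZMod 2 := fun a b =>
    if (a ∈ A ∧ b ∈ T) ∨ (a ∈ T ∧ b ∈ A) then 1 else 0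
  have tri : ∀ a b c, (a.1 = x₀ - 1 ∨ a ∈ D) → (b.1 = x₀ - 1 ∨ b ∈ D) → (c.1 = x₀ - 1 ∨ c ∈ D) →
      Adj a b → Adj b c → Adj a c → k a b + k b c + k a c = 0 := by
    intro a b c ha hb hc hab hbc hac
    have a1 := hAT a
    have a2 := hAT b
    have a3 := hAT c
    have t1 := third a
    have t2 := third b
    have t3 := third c
    have t1b := fun h => t1 h b
    have t1c := fun h => t1 h c
    have t2a := fun h => t2 h a
    have t2c := fun h => t2 h c
    have t3a := fun h => t3 h a
    have t3b := fun h => t3 h b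
    have w0 := fun h h' => t1b h h' c hc hac hbc
    have w1 := fun h h' => t1c h h' b hb hab hbc.symm
    have w2 := fun h h' => t2a h h' c hc hbc hac
    have w3 := fun h h' => t2c h h' a ha hab.symm hac.symm
    have w4 := fun h h' => t3a h h' b hb hbc.symm hab
    have w5 := fun h h' => t3b h h' a ha hac.symm hab.symm
    exact hex_triangle a1 a2 a3 w0 w1 w2 w3 w4 w5
  obtain ⟨n, hn⟩ : ∃ n : ℕ, x₁ = x₀ - 1 + n := ⟨(x₁ - x₀ + 1).toNat, by omega⟩
  let h : ℤ → ZMod 2 := fun y => ∑ i ∈ Finset.range n, k (x₀ - 1 + i, y) (x₀ - 1 + i + 1, y)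
  have inD : ∀ (i : ℕ) (y : ℤ), i ≤ n → y₀ ≤ y → y ≤ y₁ →
      ((x₀ - 1 + i, y) : Site).1 = x₀ - 1 ∨ ((x₀ - 1 + i, y) : Site) ∈ D := by
    intro i y hi h1 h2
    rcases Nat.eq_zero_or_pos i with rfl | hi'
    · simp
    · right; simp only [hD, rect, Set.mem_ofPred_eq]; omega
  have step : ∀ y, y₀ ≤ y → y + 1 ≤ y₁ → h y = h (y + 1) := by
    intro y h1 h2
    let v : ℕ → ZMod 2 := fun i => k (x₀ - 1 + i, y) (x₀ - 1 + i, y + 1)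
    have hv0 : v 0 = 0 := by
      simp only [v, k]
      rw [if_neg]
      rintro (⟨-, hh⟩ | ⟨hh, -⟩)
      · exact hAT _ (.inl (by simp)) hh
      · exact hAT _ (.inl (by simp)) hh
    have noA : ∀ y, ((x₀ - 1 + n, y) : Site) ∉ A := by
      rintro y (hh | ⟨a, ha, hh⟩)
      · simp only at hh; omega
      · exact hcX a _ ha hn.symm hh
    have hvn : v n = 0 := by
      simp only [v, k]
      rw [if_neg]
      rintro (⟨hh, -⟩ | ⟨-, hh⟩)
      · exact noA _ hh
      · exact noA _ hh
    have key : ∀ i ∈ Finset.range n, k (x₀ - 1 + i, y) (x₀ - 1 + i + 1, y)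
        - k (x₀ - 1 + i, y + 1) (x₀ - 1 + i + 1, y + 1) = v (i + 1) - v i := by
      intro i hi
      rw [Finset.mem_range] at hi
      have e1 := tri (x₀ - 1 + i, y) (x₀ - 1 + i + 1, y) (x₀ - 1 + i, y + 1)
        (inD i y hi.le h1 (by omega)) (by simpa [add_assoc] using inD (i + 1) y hi h1 (by omega))
        (inD i (y + 1) hi.le (by omega) h2)
        (by rw [adj_iff]; simp) (by rw [adj_iff]; simp) (by rw [adj_iff]; simp)
      have e2 := tri (x₀ - 1 + i + 1, y) (x₀ - 1 + i, y + 1) (x₀ - 1 + i + 1, y + 1)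
        (by simpa [add_assoc] using inD (i + 1) y hi h1 (by omega))
        (inD i (y + 1) hi.le (by omega) h2)
        (by simpa [add_assoc] using inD (i + 1) (y + 1) hi (by omega) h2)
        (by rw [adj_iff]; simp) (by rw [adj_iff]; simp) (by rw [adj_iff]; simp)
      simp only [v]
      push_cast
      rw [← add_assoc (x₀ - 1) (i : ℤ) 1]
      generalize k (x₀ - 1 + i, y) (x₀ - 1 + i + 1, y) = p1 at *
      generalize k (x₀ - 1 + i + 1, y) (x₀ - 1 + i, y + 1) = p2 at *
      generalize k (x₀ - 1 + i, y) (x₀ - 1 + i, y + 1) = p3 at *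
      generalize k (x₀ - 1 + i, y + 1) (x₀ - 1 + i + 1, y + 1) = p4 at *
      generalize k (x₀ - 1 + i + 1, y) (x₀ - 1 + i + 1, y + 1) = p5 at *
      clear * - e1 e2
      revert p1 p2 p3 p4 p5
      decide
    have := Finset.sum_congr rfl key
    rw [Finset.sum_sub_distrib, Finset.sum_range_sub, hv0, hvn] at this
    simpa [sub_eq_zero] using this
  have const : ∀ j : ℕ, y₀ + j ≤ y₁ → h y₀ = h (y₀ + j) := by
    intro j
    induction j with
    | zero => intro _; simp
    | succ j ih =>
      intro hj
      push_cast at hj ⊢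
      rw [ih (by omega), step _ (by omega) (by omega), add_assoc]
  have htop : h y₁ = 0 := by
    refine Finset.sum_eq_zero fun i _ => ?_
    simp only [k]
    rw [if_neg]
    rintro (⟨-, a, ha, hh⟩ | ⟨⟨a, ha, hh⟩, -⟩)
    · exact hcY _ _ ha rfl hh
    · exact hcY _ _ ha rfl hh
  have hbot : h y₀ = 1 := by
    let α : ℕ → ZMod 2 := fun i => if ((x₀ - 1 + i, y₀) : Site) ∈ A then 1 else 0
    have key : ∀ i ∈ Finset.range n, k (x₀ - 1 + i, y₀) (x₀ - 1 + i + 1, y₀) = α (i + 1) - α i := by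
      intro i hi
      rw [Finset.mem_range] at hi
      have m1 := inD i y₀ hi.le le_rfl hy
      have m2 : ((x₀ - 1 + i + 1, y₀) : Site).1 = x₀ - 1 ∨ ((x₀ - 1 + i + 1, y₀) : Site) ∈ D := by
        simpa [add_assoc] using inD (i + 1) y₀ hi le_rfl hy
      have ha : Adj (x₀ - 1 + i, y₀) (x₀ - 1 + i + 1, y₀) := by rw [adj_iff]; simp
      simp only [α, k]
      push_cast
      rw [← add_assoc (x₀ - 1) (i : ℤ) 1]
      have w : ∀ c d : Site, c ∈ A → (d.1 = x₀ - 1 ∨ d ∈ D) → d.2 = y₀ → Adj c d → d ∈ A ∨ d ∈ T := by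
        rintro c d hc (hd | hd) hd2 hcd
        · exact .inl (.inl hd)
        by_cases hX : d ∈ X
        · exact .inl (hAX c hc d hd hX hcd)
        · exact .inr ⟨d, hd2, .refl ⟨hd, hX⟩⟩
      have w1 := fun h => w _ _ h m2 rfl ha
      have w2 := fun h => w _ _ h m1 rfl ha.symm
      have a1 := hAT (x₀ - 1 + i, y₀)
      have a2 := hAT (x₀ - 1 + i + 1, y₀)
      have e : (1 : ZMod 2) = -1 := by decide
      by_cases p1 : ((x₀ - 1 + i, y₀) : Site) ∈ A <;>
        by_cases p2 : ((x₀ - 1 + i + 1, y₀) : Site) ∈ A <;> simp only [p1, p2, if_true, if_false]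
      · simp [a1 p1, a2 p2]
      · simp [a1 p1, (w1 p1).resolve_left p2]
      · simp [a2 p2, (w2 p2).resolve_left p1]
      · simp
    have := Finset.sum_congr rfl key
    rw [Finset.sum_range_sub] at this
    have e0 : α 0 = 1 := by simp only [α]; rw [if_pos]; exact .inl (by simp)
    have en : α n = 0 := by
      simp only [α]; rw [if_neg]
      rintro (hh | ⟨a, ha, hh⟩)
      · simp only at hh; omega
      · exact hcX a _ ha hn.symm hh
    rw [e0, en] at this
    exact this.trans (by decide)
  have := const (y₁ - y₀).toNat (by omega)
  rw [show y₀ + ((y₁ - y₀).toNat : ℤ) = y₁ by omega, htop, hbot] at this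
  exact absurd this (by decide)

/-! ### Events depending on finitely many sites -/

/-- The event `E` only depends on the sites of `V`. -/
def DepOn (V : Set Site) (E : Set Config) : Prop :=
  ∀ ω ω' : Config, (∀ v ∈ V, ω v = ω' v) → ω ∈ E → ω' ∈ E

/-- The event `E` depends on finitely many sites. -/
def FinDep (E : Set Config) : Prop := ∃ V : Set Site, V.Finite ∧ DepOn V E

theorem DepOn.mono {V W : Set Site} {E : Set Config} (h : DepOn V E) (hVW : V ⊆ W) : DepOn W E :=
  fun ω ω' hw => h ω ω' fun v hv => hw v (hVW hv)

theorem DepOn.inter {V : Set Site} {E F : Set Config} (hE : DepOn V E) (hF : DepOn V F) :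
    DepOn V (E ∩ F) := fun ω ω' hw h => ⟨hE ω ω' hw h.1, hF ω ω' hw h.2⟩

theorem DepOn.compl {V : Set Site} {E : Set Config} (hE : DepOn V E) : DepOn V Eᶜ :=
  fun ω ω' hw h h' => h (hE ω' ω (fun v hv => (hw v hv).symm) h')

theorem FinDep.inter {E F : Set Config} (hE : FinDep E) (hF : FinDep F) : FinDep (E ∩ F) := by
  obtain ⟨V, hV, hE⟩ := hE
  obtain ⟨W, hW, hF⟩ := hF
  exact ⟨V ∪ W, hV.union hW, (hE.mono Set.subset_union_left).inter (hF.mono Set.subset_union_right)⟩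

theorem FinDep.compl {E : Set Config} (hE : FinDep E) : FinDep Eᶜ := by
  obtain ⟨V, hV, hE⟩ := hE
  exact ⟨V, hV, hE.compl⟩

theorem FinDep.union {E F : Set Config} (hE : FinDep E) (hF : FinDep F) : FinDep (E ∪ F) := by
  have := (hE.compl.inter hF.compl).compl
  rwa [← Set.compl_union, compl_compl] at this

/-- Extend a finite configuration by closed sites. -/
noncomputable def cfg (V : Finset Site) (f : V → Bool) : Config := by
  classical exact fun v => if h : v ∈ V then f ⟨v, h⟩ else false

theorem cfg_of_mem {V : Finset Site} (f : V → Bool) {v : Site} (h : v ∈ V) :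
    cfg V f v = f ⟨v, h⟩ := by simp [cfg, h]

theorem cfg_of_notMem {V : Finset Site} (f : V → Bool) {v : Site} (h : v ∉ V) :
    cfg V f v = false := by simp [cfg, h]

theorem cfg_mono (V : Finset Site) : Monotone (cfg V) := by
  intro f g h v
  by_cases hv : v ∈ V
  · rw [cfg_of_mem f hv, cfg_of_mem g hv]; exact h _
  · rw [cfg_of_notMem f hv, cfg_of_notMem g hv]

theorem measurableSet_cylinder (S : Finset Site) (f : Site → Bool) :
    MeasurableSet {ω : Config | ∀ v ∈ S, ω v = f v} := by
  have : {ω : Config | ∀ v ∈ S, ω v = f v} = ⋂ v ∈ S, (fun ω : Config => ω v) ⁻¹' {f v} := by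
    ext; simp
  rw [this]
  exact Finset.measurableSet_biInter _ fun v _ => measurable_pi_apply v (measurableSet_singleton _)

/-- Restriction of a configuration to a finite set. -/
def restr (V : Finset Site) (ω : Config) : V → Bool := fun v => ω v

theorem DepOn.iff_restr {V : Finset Site} {E : Set Config} (hE : DepOn V E) (ω : Config) :
    ω ∈ E ↔ cfg V (restr V ω) ∈ E := by
  constructor <;> refine hE _ _ fun v hv => ?_
  · rw [cfg_of_mem _ hv]; rfl
  · rw [cfg_of_mem _ hv]; rfl

open Classical in
theorem DepOn.eq_biUnion {V : Finset Site} {E : Set Config} (hE : DepOn V E) :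
    E = ⋃ f ∈ (Finset.univ.filter fun f : V → Bool => cfg V f ∈ E),
      {ω : Config | ∀ v ∈ V, ω v = cfg V f v} := by
  ext ω
  simp only [Finset.mem_filter, Finset.mem_univ, true_and, Set.mem_iUnion, Set.mem_ofPred_eq,
    exists_prop]
  constructor
  · intro h
    refine ⟨restr V ω, (hE.iff_restr ω).1 h, fun v hv => ?_⟩
    rw [cfg_of_mem _ hv]; rfl
  · rintro ⟨f, hf, h⟩
    exact hE _ _ (fun v hv => (h v hv).symm) hf

theorem FinDep.measurableSet {E : Set Config} (hE : FinDep E) : MeasurableSet E := by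
  classical
  obtain ⟨V, hV, hE⟩ := hE
  rw [← hV.coe_toFinset] at hE
  rw [hE.eq_biUnion]
  exact Finset.measurableSet_biUnion _ fun f _ => measurableSet_cylinder _ _

open Classical in
/-- The probability of an event depending on `V` as a normalized count. -/
theorem IsBernoulliHalf.measure_eq {μ : Measure Config} (hμ : IsBernoulliHalf μ) {V : Finset Site}
    {E : Set Config} (hE : DepOn V E) :
    μ E = (Finset.univ.filter fun f : V → Bool => cfg V f ∈ E).card * (1 / 2 : ℝ≥0∞) ^ V.card := by
  conv_lhs => rw [hE.eq_biUnion]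
  rw [measure_biUnion_finset]
  · simp only [hμ.2, Finset.sum_const, nsmul_eq_mul]
  · intro f _ g _ hfg
    rw [Function.onFun, Set.disjoint_left]
    intro ω h1 h2
    apply hfg
    funext v
    have e1 := h1 v v.2
    have e2 := h2 v v.2
    rw [cfg_of_mem _ v.2] at e1 e2
    exact e1.symm.trans e2
  · exact fun f _ => measurableSet_cylinder _ _

open Classical in
theorem IsBernoulliHalf.real_eq {μ : Measure Config} (hμ : IsBernoulliHalf μ) {V : Finset Site}
    {E : Set Config} (hE : DepOn V E) :
    μ.real E = (∑ f : V → Bool, if cfg V f ∈ E then (1 : ℝ) else 0) / 2 ^ V.card := by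
  rw [Measure.real, hμ.measure_eq hE, ENNReal.toReal_mul, ENNReal.toReal_pow]
  rw [Finset.sum_boole, ENNReal.toReal_natCast, ENNReal.toReal_div]
  simp [div_eq_mul_inv]

theorem IsBernoulliHalf.measure_congr {μ μ' : Measure Config} (hμ : IsBernoulliHalf μ)
    (hμ' : IsBernoulliHalf μ') {E : Set Config} (hE : FinDep E) : μ E = μ' E := by
  classical
  obtain ⟨V, hV, hE⟩ := hE
  rw [← hV.coe_toFinset] at hE
  rw [hμ.measure_eq hE, hμ'.measure_eq hE]

/-- Invariance under permutations of the sites. -/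
theorem IsBernoulliHalf.comp_equiv {μ : Measure Config} (hμ : IsBernoulliHalf μ)
    (e : Site ≃ Site) {E : Set Config} (hE : FinDep E) :
    μ.real {ω | (fun v => ω (e v)) ∈ E} = μ.real E := by
  have hm : Measurable fun ω : Config => fun v => ω (e v) :=
    measurable_pi_lambda _ fun v => measurable_pi_apply _
  have h' : IsBernoulliHalf (μ.map fun ω : Config => fun v => ω (e v)) := by
    have := hμ.1
    refine ⟨Measure.isProbabilityMeasure_map hm.aemeasurable, fun S f => ?_⟩
    rw [Measure.map_apply hm (measurableSet_cylinder _ _)]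
    have := hμ.2 (S.map e.toEmbedding) (fun v => f (e.symm v))
    rw [Finset.card_map] at this
    rw [← this]
    congr 1
    ext ω
    simp only [Set.mem_preimage, Set.mem_ofPred_eq, Finset.forall_mem_map, Equiv.coe_toEmbedding,
      Equiv.symm_apply_apply]
  rw [Measure.real, Measure.real, ← h'.measure_congr hμ hE, Measure.map_apply hm hE.measurableSet]
  rfl

/-- Invariance under exchange of open and closed. -/
theorem IsBernoulliHalf.comp_not {μ : Measure Config} (hμ : IsBernoulliHalf μ)
    {E : Set Config} (hE : FinDep E) :
    μ.real {ω | (fun v => !ω v) ∈ E} = μ.real E := by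
  have hm : Measurable fun ω : Config => fun v => !ω v :=
    measurable_pi_lambda _ fun v => (measurable_of_countable Bool.not).comp (measurable_pi_apply v)
  have h' : IsBernoulliHalf (μ.map fun ω : Config => fun v => !ω v) := by
    have := hμ.1
    refine ⟨Measure.isProbabilityMeasure_map hm.aemeasurable, fun S f => ?_⟩
    rw [Measure.map_apply hm (measurableSet_cylinder _ _)]
    rw [← hμ.2 S (fun v => !f v)]
    congr 1
    ext ω
    simp [Bool.not_eq_eq_eq_not]
  rw [Measure.real, Measure.real, ← h'.measure_congr hμ hE, Measure.map_apply hm hE.measurableSet]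
  rfl

theorem IsBernoulliHalf.real_le_one {μ : Measure Config} (hμ : IsBernoulliHalf μ) (E : Set Config) :
    μ.real E ≤ 1 := by
  have := hμ.1
  exact measureReal_le_one

theorem IsBernoulliHalf.real_mono {μ : Measure Config} (hμ : IsBernoulliHalf μ) {E F : Set Config}
    (h : E ⊆ F) : μ.real E ≤ μ.real F := by
  have := hμ.1
  exact measureReal_mono h

theorem IsBernoulliHalf.real_compl {μ : Measure Config} (hμ : IsBernoulliHalf μ) {E : Set Config}
    (h : FinDep E) : μ.real Eᶜ = 1 - μ.real E := by
  have := hμ.1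
  rw [measureReal_compl h.measurableSet]; simp

/-! ### Positive association -/

theorem IsBernoulliHalf.fkg {μ : Measure Config} (hμ : IsBernoulliHalf μ) {E F : Set Config}
    (hE : FinDep E) (hF : FinDep F) (hEu : IsUpperSet E) (hFu : IsUpperSet F) :
    μ.real E * μ.real F ≤ μ.real (E ∩ F) := by
  classical
  obtain ⟨V, hV, hE⟩ := hE
  obtain ⟨W, hW, hF⟩ := hF
  set U := (hV.union hW).toFinset with hU
  have hE' : DepOn U E := hE.mono (by simp [hU])
  have hF' : DepOn U F := hF.mono (by simp [hU])
  rw [hμ.real_eq hE', hμ.real_eq hF', hμ.real_eq (hE'.inter hF')]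
  have := _root_.fkg (α := U → Bool) (β := ℝ) (μ := fun _ => 1) (f := fun f => if cfg U f ∈ E then (1 : ℝ) else 0)
    (g := fun f => if cfg U f ∈ F then (1 : ℝ) else 0) (fun _ => zero_le_one)
    (fun f => by simp only [Pi.zero_apply]; split_ifs <;> norm_num)
    (fun f => by simp only [Pi.zero_apply]; split_ifs <;> norm_num) ?_ ?_ (fun _ _ => le_rfl)
  · simp only [one_mul, Finset.sum_const, Finset.card_univ, nsmul_eq_mul, mul_one, Fintype.card_fun,
      Fintype.card_bool, Fintype.card_coe] at this
    rw [div_mul_div_comm, div_le_div_iff₀ (by positivity) (by positivity)]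
    have e : ∀ f : U → Bool, (if cfg U f ∈ E then (1 : ℝ) else 0) *
        (if cfg U f ∈ F then (1 : ℝ) else 0) = @ite _ (cfg U f ∈ E ∩ F) (Classical.propDecidable _) 1 0 := by
      intro f; simp only [Set.mem_inter_iff, ite_and]; split_ifs <;> simp
    simp only [e] at this
    push_cast at this
    have h2 : (0 : ℝ) < 2 ^ U.card := by positivity
    nlinarith [mul_le_mul_of_nonneg_right this h2.le]
  all_goals
    intro f g hfg
    simp only
    split_ifs with h1 h2 <;> try norm_num
  · exact absurd (hEu (cfg_mono U hfg) h1) h2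
  · exact absurd (hFu (cfg_mono U hfg) h1) h2

theorem IsBernoulliHalf.fkg_lower {μ : Measure Config} (hμ : IsBernoulliHalf μ) {E F : Set Config}
    (hE : FinDep E) (hF : FinDep F) (hEu : IsLowerSet E) (hFu : IsLowerSet F) :
    μ.real E * μ.real F ≤ μ.real (E ∩ F) := by
  have := hμ.fkg hE.compl hF.compl hEu.compl hFu.compl
  have h1 := hμ.real_compl (hE.union hF)
  rw [Set.compl_union] at h1
  rw [h1, hμ.real_compl hE, hμ.real_compl hF] at this
  have := hμ.1
  have h2 := measureReal_union_add_inter (μ := μ) (s := E) (t := F) hF.measurableSet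
  linarith

/-! ### Stopping sets -/

/-- A random set of sites that can be found without inspecting its complement. -/
def Stopping (A : Config → Set Site) : Prop :=
  ∀ ω ω' : Config, (∀ v ∈ A ω, ω v = ω' v) → A ω' = A ω

theorem Stopping.const (A : Set Site) : Stopping fun _ => A := fun _ _ _ => rfl

theorem Stopping.union {A B : Config → Set Site} (hA : Stopping A) (hB : Stopping B) :
    Stopping fun ω => A ω ∪ B ω := by
  intro ω ω' h
  simp only
  rw [hA ω ω' fun v hv => h v (.inl hv), hB ω ω' fun v hv => h v (.inr hv)]

theorem Stopping.reach {B : Config → Set Site} (hB : Stopping B) (D Y : Set Site) (c : Bool) :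
    Stopping fun ω => {v | Reach (B ω) D ({v | ω v = c} ∩ Y) v} := by
  intro ω ω' h
  have e : B ω' = B ω := hB ω ω' fun v hv => h v (.base hv)
  ext v
  simp only [Set.mem_ofPred_eq, e]
  refine (Reach.congr fun v hv => ?_).symm
  simp [h v hv]

open Classical in
/-- The configuration `ω` on `A`, and `ω'` elsewhere. -/
noncomputable def mix (A : Set Site) (ω ω' : Config) : Config := fun v => if v ∈ A then ω v else ω' v

theorem mix_of_mem {A : Set Site} {ω ω' : Config} {v : Site} (h : v ∈ A) : mix A ω ω' v = ω v := by
  simp [mix, h]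

theorem mix_of_notMem {A : Set Site} {ω ω' : Config} {v : Site} (h : v ∉ A) :
    mix A ω ω' v = ω' v := by
  simp [mix, h]

theorem mix_mono (A : Set Site) (ω : Config) : Monotone (mix A ω) := by
  intro f g h v
  by_cases hv : v ∈ A
  · rw [mix_of_mem hv, mix_of_mem hv]
  · rw [mix_of_notMem hv, mix_of_notMem hv]; exact h v

theorem DepOn.mix {V : Set Site} {E : Set Config} (hE : DepOn V E) (A : Set Site) (ω : Config) :
    DepOn V {ω' | mix A ω ω' ∈ E} := by
  intro ω₁ ω₂ h
  refine hE _ _ fun v hv => ?_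
  by_cases hvA : v ∈ A
  · rw [mix_of_mem hvA, mix_of_mem hvA]
  · rw [mix_of_notMem hvA, mix_of_notMem hvA]; exact h v hv

theorem FinDep.mix {E : Set Config} (hE : FinDep E) (A : Set Site) (ω : Config) :
    FinDep {ω' | mix A ω ω' ∈ E} := by
  obtain ⟨V, hV, hE⟩ := hE
  exact ⟨V, hV, hE.mix A ω⟩

theorem Stopping.mix {A : Config → Set Site} (hA : Stopping A) (ω ω' : Config) :
    A (mix (A ω) ω ω') = A ω :=
  hA _ _ fun _ hv => (mix_of_mem hv).symm

/-- Resampling outside a stopping set. -/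
theorem IsBernoulliHalf.real_eq_mix {μ : Measure Config} (hμ : IsBernoulliHalf μ) {V : Finset Site}
    {F : Set Config} (hF : DepOn V F) {A : Config → Set Site} (hA : Stopping A) :
    μ.real F = (∑ f : V → Bool, μ.real {ω' | mix (A (cfg V f)) (cfg V f) ω' ∈ F})
      / 2 ^ V.card := by
  classical
  have hmix : ∀ (B : Set Site) (f g : V → Bool),
      cfg V (restr V (mix B (cfg V f) (cfg V g))) = mix B (cfg V f) (cfg V g) := by
    intro B f g
    funext v
    by_cases hv : v ∈ V
    · rw [cfg_of_mem _ hv]; rfl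
    · rw [cfg_of_notMem _ hv]
      simp only [_root_.mix]
      rw [cfg_of_notMem _ hv, cfg_of_notMem _ hv, ite_self]
  have hs : ∀ f g : V → Bool, A (cfg V (restr V (mix (A (cfg V f)) (cfg V f) (cfg V g))))
      = A (cfg V f) := fun f g => by rw [hmix, hA.mix]
  let Φ : (V → Bool) × (V → Bool) → (V → Bool) × (V → Bool) := fun p =>
    (restr V (mix (A (cfg V p.1)) (cfg V p.1) (cfg V p.2)),
      restr V (mix (A (cfg V p.1)) (cfg V p.2) (cfg V p.1)))
  have hΦ : Function.Involutive Φ := by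
    rintro ⟨f, g⟩
    simp only [Φ, hs, Prod.mk.injEq]
    simp only [hmix]
    constructor <;> funext v <;> simp only [restr, _root_.mix] <;> split_ifs <;>
      exact cfg_of_mem _ v.2
  have key : ∑ p : (V → Bool) × (V → Bool), (if cfg V (Φ p).1 ∈ F then (1 : ℝ) else 0)
      = ∑ p : (V → Bool) × (V → Bool), if cfg V p.1 ∈ F then (1 : ℝ) else 0 :=
    Equiv.sum_comp hΦ.toPerm (fun p : (V → Bool) × (V → Bool) => if cfg V p.1 ∈ F then (1 : ℝ) else 0)
  rw [Fintype.sum_prod_type, Fintype.sum_prod_type] at key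
  have e1 : ∀ f : V → Bool, μ.real {ω' | mix (A (cfg V f)) (cfg V f) ω' ∈ F} =
      (∑ g : V → Bool, if cfg V (Φ (f, g)).1 ∈ F then (1 : ℝ) else 0) / 2 ^ V.card := by
    intro f
    rw [hμ.real_eq (hF.mix _ _)]
    simp only [Φ, hmix, Set.mem_ofPred_eq]
  simp only [e1]
  rw [← Finset.sum_div, key, hμ.real_eq hF]
  field_simp
  rw [Finset.sum_mul]
  refine Finset.sum_congr rfl fun f _ => ?_
  by_cases h : cfg V f ∈ F <;> simp [h]

/-- Comparing two events conditionally on the configuration in a stopping set. -/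
theorem IsBernoulliHalf.mix_le {μ : Measure Config} (hμ : IsBernoulliHalf μ) {F F' : Set Config}
    (hF : FinDep F) (hF' : FinDep F') {A : Config → Set Site} (hA : Stopping A) {p : ℝ}
    (h : ∀ ω, p * μ.real {ω' | mix (A ω) ω ω' ∈ F} ≤ μ.real {ω' | mix (A ω) ω ω' ∈ F'}) :
    p * μ.real F ≤ μ.real F' := by
  classical
  obtain ⟨V, hV, hF⟩ := hF
  obtain ⟨W, hW, hF'⟩ := hF'
  set U := (hV.union hW).toFinset with hU
  rw [hμ.real_eq_mix (V := U) (hF.mono (by simp [hU])) hA,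
    hμ.real_eq_mix (V := U) (hF'.mono (by simp [hU])) hA, ← mul_div_assoc, Finset.mul_sum]
  gcongr
  exact h _

/-- Independence of events depending on disjoint sets of sites. -/
theorem IsBernoulliHalf.indep {μ : Measure Config} (hμ : IsBernoulliHalf μ) {E F : Set Config}
    {V W : Set Site} (hV : V.Finite) (hW : W.Finite) (hE : DepOn V E) (hF : DepOn W F)
    (hVW : Disjoint V W) : μ.real E * μ.real F ≤ μ.real (E ∩ F) := by
  rw [mul_comm]
  refine hμ.mix_le ⟨V, hV, hE⟩ (.inter ⟨V, hV, hE⟩ ⟨W, hW, hF⟩) (Stopping.const V) fun ω => ?_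
  by_cases h : ω ∈ E
  · have : F ⊆ {ω' | mix V ω ω' ∈ E ∩ F} := by
      intro ω' hω'
      refine ⟨hE _ _ (fun v hv => (mix_of_mem hv).symm) h, hF _ _ (fun v hv => ?_) hω'⟩
      exact (mix_of_notMem fun h => Set.disjoint_left.1 hVW h hv).symm
    calc _ ≤ μ.real F * 1 := by gcongr; exact hμ.real_le_one _
      _ ≤ _ := by rw [mul_one]; exact hμ.real_mono this
  · have : {ω' | mix V ω ω' ∈ E} = ∅ := by
      ext ω'
      simp only [Set.mem_ofPred_eq, Set.mem_empty_iff_false, iff_false]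
      exact fun h' => h (hE _ _ (fun v hv => mix_of_mem hv) h')
    rw [this]; simp

/-! ### Crossing events -/

/-- Some site of `A` is connected to some site of `B` by sites of `D` of color `c`. -/
def ConnEv (c : Bool) (D A B : Set Site) : Set Config :=
  {ω | ∃ a ∈ A, ∃ b ∈ B, Conn ({v | ω v = c} ∩ D) a b}

theorem color_inter_congr {D : Set Site} {ω ω' : Config} (c : Bool) (h : ∀ v ∈ D, ω v = ω' v) :
    {v | ω v = c} ∩ D = {v | ω' v = c} ∩ D := by
  ext v
  simp only [Set.mem_inter_iff, Set.mem_ofPred_eq, and_congr_left_iff]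
  intro hv
  rw [h v hv]

theorem ConnEv.depOn (c : Bool) (D A B : Set Site) : DepOn D (ConnEv c D A B) := by
  rintro ω ω' h ⟨a, ha, b, hb, hab⟩
  exact ⟨a, ha, b, hb, by rwa [← color_inter_congr c h]⟩

theorem ConnEv.finDep {D : Set Site} (hD : D.Finite) (c : Bool) (A B : Set Site) :
    FinDep (ConnEv c D A B) := ⟨D, hD, ConnEv.depOn c D A B⟩

theorem ConnEv.isUpperSet (D A B : Set Site) : IsUpperSet (ConnEv true D A B) := by
  rintro ω ω' h ⟨a, ha, b, hb, hab⟩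
  refine ⟨a, ha, b, hb, hab.mono fun v hv => ⟨?_, hv.2⟩⟩
  have h1 := h v
  have h2 : ω v = true := hv.1
  rw [h2] at h1
  exact le_antisymm le_top h1

theorem ConnEv.isLowerSet (D A B : Set Site) : IsLowerSet (ConnEv false D A B) := by
  rintro ω ω' h ⟨a, ha, b, hb, hab⟩
  refine ⟨a, ha, b, hb, hab.mono fun v hv => ⟨?_, hv.2⟩⟩
  have h1 := h v
  have h2 : ω v = false := hv.1
  rw [h2] at h1
  exact le_antisymm h1 bot_le

theorem ConnEv.real_not {μ : Measure Config} (hμ : IsBernoulliHalf μ) {D : Set Site} (hD : D.Finite)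
    (c : Bool) (A B : Set Site) : μ.real (ConnEv (!c) D A B) = μ.real (ConnEv c D A B) := by
  rw [← hμ.comp_not (ConnEv.finDep hD c A B)]
  congr 1
  ext ω
  simp only [ConnEv, Set.mem_ofPred_eq]
  have : {v | ω v = !c} = {v | (!ω v) = c} := by
    ext v; simp only [Set.mem_ofPred_eq]; cases ω v <;> cases c <;> simp
  rw [this]

/-- Transport of crossing events by a lattice embedding. -/
theorem ConnEv.real_le_map {μ : Measure Config} (hμ : IsBernoulliHalf μ) {D A B D' A' B' : Set Site}
    (hD : D.Finite) (c : Bool) (e : Site ≃ Site) (he : ∀ a b, Adj a b → Adj (e a) (e b))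
    (h1 : ∀ v ∈ D, e v ∈ D') (h2 : ∀ v ∈ D, v ∈ A → e v ∈ A') (h3 : ∀ v ∈ D, v ∈ B → e v ∈ B') :
    μ.real (ConnEv c D A B) ≤ μ.real (ConnEv c D' A' B') := by
  rw [← hμ.comp_equiv e (ConnEv.finDep hD c A B)]
  refine hμ.real_mono ?_
  rintro ω ⟨a, ha, b, hb, hab⟩
  exact ⟨e a, h2 a hab.1.2 ha, e b, h3 b hab.right_mem.2 hb, hab.map he fun v hv => ⟨hv.1, h1 v hv.2⟩⟩

theorem rect_finite (x₀ x₁ y₀ y₁ : ℤ) : (rect x₀ x₁ y₀ y₁).Finite :=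
  (Set.finite_Icc ((x₀, y₀) : Site) (x₁, y₁)).subset fun _ hv =>
    ⟨⟨hv.1, hv.2.2.1⟩, ⟨hv.2.1, hv.2.2.2⟩⟩

/-- Horizontal crossing of a rectangle by sites of color `c`. -/
def HC (c : Bool) (x₀ x₁ y₀ y₁ : ℤ) : Set Config :=
  ConnEv c (rect x₀ x₁ y₀ y₁) {v | v.1 = x₀} {v | v.1 = x₁}

/-- Vertical crossing of a rectangle by sites of color `c`. -/
def VC (c : Bool) (x₀ x₁ y₀ y₁ : ℤ) : Set Config :=
  ConnEv c (rect x₀ x₁ y₀ y₁) {v | v.2 = y₀} {v | v.2 = y₁}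

/-- Exchange of the coordinates. -/
def swapSite : Site ≃ Site := Equiv.prodComm ℤ ℤ

theorem swapSite_apply (v : Site) : swapSite v = (v.2, v.1) := rfl

theorem swapSite_adj (a b : Site) (h : Adj a b) : Adj (swapSite a) (swapSite b) := by
  rw [adj_iff] at *; simp only [swapSite_apply]; omega

/-- Translation of the lattice. -/
def shiftSite (p : Site) : Site ≃ Site := Equiv.addRight p

theorem shiftSite_apply (p v : Site) : shiftSite p v = (v.1 + p.1, v.2 + p.2) := rfl

theorem shiftSite_adj (p : Site) (a b : Site) (h : Adj a b) : Adj (shiftSite p a) (shiftSite p b) := by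
  rw [adj_iff] at *; simp only [shiftSite_apply]; omega

/-- Rotation of the lattice. -/
def rotSite (L : ℤ) : Site ≃ Site where
  toFun v := (L - v.1 - v.2, v.1)
  invFun v := (v.2, L - v.1 - v.2)
  left_inv v := by obtain ⟨x, y⟩ := v; simp; ring
  right_inv v := by obtain ⟨x, y⟩ := v; simp

theorem rotSite_apply (L : ℤ) (v : Site) : rotSite L v = (L - v.1 - v.2, v.1) := rfl

theorem rotSite_symm_apply (L : ℤ) (v : Site) : (rotSite L).symm v = (v.2, L - v.1 - v.2) := rfl

theorem rotSite_adj (L : ℤ) (a b : Site) (h : Adj a b) : Adj (rotSite L a) (rotSite L b) := by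
  rw [adj_iff] at *; simp only [rotSite_apply]; omega

theorem rotSite_symm_adj (L : ℤ) (a b : Site) (h : Adj a b) :
    Adj ((rotSite L).symm a) ((rotSite L).symm b) := by
  rw [adj_iff] at *; simp only [rotSite_symm_apply]; omega

/-- The linear rotation `(x, y) ↦ (-y, x + y)`. -/
def turnSite : Site ≃ Site where
  toFun v := (-v.2, v.1 + v.2)
  invFun v := (v.1 + v.2, -v.1)
  left_inv v := by ext <;> simp
  right_inv v := by ext <;> simp

theorem turnSite_apply (v : Site) : turnSite v = (-v.2, v.1 + v.2) := rfl

theorem turnSite_adj (a b : Site) (h : Adj a b) : Adj (turnSite a) (turnSite b) := by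
  rw [adj_iff] at *; simp only [turnSite_apply]; omega

theorem Conn.sub_horiz {S : Set Site} {a b : Site} (h : Conn S a b) {x₀ x₁ : ℤ} (ha : a.1 ≤ x₀)
    (hx : x₀ ≤ x₁) (hb : x₁ ≤ b.1) :
    ∃ a' b', a'.1 = x₀ ∧ b'.1 = x₁ ∧ Conn (S ∩ {v | x₀ ≤ v.1 ∧ v.1 ≤ x₁}) a' b' := by
  obtain ⟨q, hq, haq⟩ : ∃ q, q.1 = x₁ ∧ Conn (S ∩ {v | v.1 ≤ x₁}) a q := by
    by_cases h1 : x₁ ≤ a.1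
    · exact ⟨a, by omega, .refl ⟨h.1, by simp only [Set.mem_ofPred_eq]; omega⟩⟩
    · obtain ⟨p, q, hp, hpq, hq, hqM⟩ := h.first_exit (M := {v | v.1 < x₁})
        (by simp only [Set.mem_ofPred_eq]; omega) (by simp only [Set.mem_ofPred_eq]; omega)
      have hp1 : p.1 < x₁ := hp.right_mem.2
      simp only [Set.mem_ofPred_eq] at hqM
      have hq1 : q.1 = x₁ := by rw [adj_iff] at hpq; omega
      refine ⟨q, hq1, (hp.mono ?_).tail hpq ⟨hq, hq1.le⟩⟩
      exact Set.inter_subset_inter_right _ fun v (hv : v.1 < x₁) => hv.le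
  rcases hx.eq_or_lt with rfl | hx
  · exact ⟨q, q, hq, hq, .refl ⟨haq.right_mem.1, hq.ge, hq.le⟩⟩
  · obtain ⟨p, p', hp, hpM, hpp', hc⟩ := haq.last_exit (M := {v | v.1 ≤ x₀}) ha
      (by simp only [Set.mem_ofPred_eq]; omega)
    have h1 := hc.1.2
    simp only [Set.mem_ofPred_eq] at h1 hpM
    have hp1 : p.1 = x₀ := by rw [adj_iff] at hpp'; omega
    have hc' : Conn (S ∩ {v | x₀ ≤ v.1 ∧ v.1 ≤ x₁}) p' q := hc.mono (by
      rintro v ⟨⟨hv, hv2⟩, hv1⟩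
      simp only [Set.mem_ofPred_eq] at hv1 hv2
      exact ⟨hv, by simp only [Set.mem_ofPred_eq]; omega⟩)
    exact ⟨p, q, hp1, hq, (Conn.of_adj (S := S ∩ {v | x₀ ≤ v.1 ∧ v.1 ≤ x₁})
      ⟨hp.1, by simp only [Set.mem_ofPred_eq]; omega⟩ hpp' hc'.1).trans hc'⟩

theorem Conn.swap {S : Set Site} {a b : Site} (h : Conn S a b) :
    Conn {v | swapSite v ∈ S} (swapSite a) (swapSite b) :=
  h.map swapSite_adj fun v hv => by simpa [swapSite_apply] using hv

theorem Conn.sub_vert {S : Set Site} {a b : Site} (h : Conn S a b) {y₀ y₁ : ℤ} (ha : a.2 ≤ y₀)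
    (hy : y₀ ≤ y₁) (hb : y₁ ≤ b.2) :
    ∃ a' b', a'.2 = y₀ ∧ b'.2 = y₁ ∧ Conn (S ∩ {v | y₀ ≤ v.2 ∧ v.2 ≤ y₁}) a' b' := by
  obtain ⟨a', b', h1, h2, h3⟩ := h.swap.sub_horiz (x₀ := y₀) (x₁ := y₁) ha hy hb
  refine ⟨swapSite a', swapSite b', h1, h2, h3.swap.mono ?_⟩
  rintro v ⟨hv, hv2⟩
  exact ⟨by simpa [swapSite_apply] using hv, hv2⟩

theorem HC.finDep (c : Bool) (x₀ x₁ y₀ y₁ : ℤ) : FinDep (HC c x₀ x₁ y₀ y₁) :=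
  ConnEv.finDep (rect_finite ..) ..

theorem VC.finDep (c : Bool) (x₀ x₁ y₀ y₁ : ℤ) : FinDep (VC c x₀ x₁ y₀ y₁) :=
  ConnEv.finDep (rect_finite ..) ..

theorem VC.real_eq {μ : Measure Config} (hμ : IsBernoulliHalf μ) (c : Bool) (x₀ x₁ y₀ y₁ : ℤ) :
    μ.real (VC c x₀ x₁ y₀ y₁) = μ.real (HC c y₀ y₁ x₀ x₁) := by
  apply le_antisymm
  · refine ConnEv.real_le_map hμ (rect_finite ..) c swapSite swapSite_adj ?_ ?_ ?_
    · rintro v ⟨h1, h2, h3, h4⟩; exact ⟨h3, h4, h1, h2⟩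
    · intro v _ h; exact h
    · intro v _ h; exact h
  · refine ConnEv.real_le_map hμ (rect_finite ..) c swapSite swapSite_adj ?_ ?_ ?_
    · rintro v ⟨h1, h2, h3, h4⟩; exact ⟨h3, h4, h1, h2⟩
    · intro v _ h; exact h
    · intro v _ h; exact h

theorem closed_eq_compl (ω : Config) (D : Set Site) : {v | ω v = false} ∩ D = D \ {v | ω v = true} := by
  ext v; simp [and_comm]

theorem half_le_square {μ : Measure Config} (hμ : IsBernoulliHalf μ) {m : ℤ} (hm : 0 ≤ m) :
    1 / 2 ≤ μ.real (HC true 0 m 0 m) := by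
  have h1 : μ.real (VC false 0 m 0 m) = μ.real (HC true 0 m 0 m) := by
    rw [VC.real_eq hμ]; exact ConnEv.real_not hμ (rect_finite ..) true _ _
  have := hμ.1
  have h2 : (Set.univ : Set Config) ⊆ HC true 0 m 0 m ∪ VC false 0 m 0 m := by
    intro ω _
    rcases hex {v | ω v = true} hm hm with ⟨a, b, ha, hb, h⟩ | ⟨a, b, ha, hb, h⟩
    · exact .inl ⟨a, ha, b, hb, h⟩
    · exact .inr ⟨a, ha, b, hb, by rwa [closed_eq_compl]⟩
  have h3 := (hμ.real_mono h2).trans (measureReal_union_le _ _)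
  rw [h1] at h3
  simp at h3
  linarith

/-! ### Crossings of trapezoids -/

/-- The trapezoid of sites of the first quadrant between the lines `x + y = L - m` and `x + y = L`. -/
def band (L m : ℤ) : Set Site := {v | 0 ≤ v.1 ∧ 0 ≤ v.2 ∧ L - m ≤ v.1 + v.2 ∧ v.1 + v.2 ≤ L}

/-- The part of the trapezoid `band L m` on the right of the diagonal. -/
def halfBand (L m : ℤ) : Set Site :=
  {v | v.2 ≤ v.1 ∧ 0 ≤ v.2 ∧ L - m ≤ v.1 + v.2 ∧ v.1 + v.2 ≤ L}

theorem mem_band {L m : ℤ} {v : Site} :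
    v ∈ band L m ↔ 0 ≤ v.1 ∧ 0 ≤ v.2 ∧ L - m ≤ v.1 + v.2 ∧ v.1 + v.2 ≤ L := Iff.rfl

theorem mem_halfBand {L m : ℤ} {v : Site} :
    v ∈ halfBand L m ↔ v.2 ≤ v.1 ∧ 0 ≤ v.2 ∧ L - m ≤ v.1 + v.2 ∧ v.1 + v.2 ≤ L := Iff.rfl

theorem mem_rect {x₀ x₁ y₀ y₁ : ℤ} {v : Site} :
    v ∈ rect x₀ x₁ y₀ y₁ ↔ x₀ ≤ v.1 ∧ v.1 ≤ x₁ ∧ y₀ ≤ v.2 ∧ v.2 ≤ y₁ := Iff.rfl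

theorem halfBand_subset (L m : ℤ) : halfBand L m ⊆ band L m := by
  intro v hv; rw [mem_halfBand] at hv; rw [mem_band]; omega

theorem band_finite (L m : ℤ) : (band L m).Finite :=
  (rect_finite 0 L 0 L).subset fun v hv => by rw [mem_band] at hv; rw [mem_rect]; omega

theorem halfBand_finite (L m : ℤ) : (halfBand L m).Finite := (band_finite L m).subset (halfBand_subset L m)

theorem halfBand_barrier {L m : ℤ} {X Y : Set Site} (hXY : ∀ v ∈ X, v ∉ Y) {a b c d : Site}
    (h1 : Conn (X ∩ halfBand L m) a b) (ha : a.2 = 0) (hb : b.1 - b.2 ≤ 1)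
    (h2 : Conn (Y ∩ halfBand L m) c d) (hc : c.1 + c.2 = L - m) (hd : d.1 + d.2 = L) : False := by
  have hbm := h1.right_mem.2
  rw [mem_halfBand] at hbm
  set P : Set Site := {v | rotSite L v ∈ X ∩ halfBand L m} ∪
    {v | v.2 = L - b.1 - b.2 ∧ b.2 ≤ v.1 ∧ v.1 ≤ L + 1 ∧ (v.1 = b.2 → v = (b.2, L - b.1 - b.2))} with hP
  set Q : Set Site := {v | rotSite L v ∈ Y ∩ halfBand L m} with hQ
  have hP1 : Conn P ((rotSite L).symm a) ((rotSite L).symm b) :=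
    h1.map (rotSite_symm_adj L) fun v hv => .inl (by simpa using hv)
  have hP2 : Conn P ((rotSite L).symm b) (L + 1, L - b.1 - b.2) := by
    rw [rotSite_symm_apply]
    refine Conn.horiz _ _ _ fun z h1 h2 => .inr ⟨rfl, ?_, ?_, ?_⟩ <;> simp <;> omega
  have hQ1 : Conn Q ((rotSite L).symm d) ((rotSite L).symm c) :=
    (h2.map (rotSite_symm_adj L) fun v hv => by simpa [hQ] using hv).symm
  obtain ⟨p, hp, hp'⟩ := rect_cross (x₀ := 0) (x₁ := L + 1) (y₀ := 0) (y₁ := m) (hP1.trans hP2)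
    (by
      rintro v (hv | hv)
      · have := hv.2
        rw [mem_halfBand, rotSite_apply] at this
        rw [mem_rect]; simp only at this; omega
      · simp only [Set.mem_ofPred_eq] at hv
        rw [mem_rect]; omega)
    (by rw [rotSite_symm_apply]; exact ha) rfl hQ1
    (by
      intro v hv
      have := hv.2
      rw [mem_halfBand, rotSite_apply] at this
      rw [mem_rect]; simp only at this; omega)
    (by rw [rotSite_symm_apply]; simp only; omega) (by rw [rotSite_symm_apply]; simp only; omega)
  rcases hp with hp | hp
  · exact hXY _ hp.1 hp'.1
  · have := hp'.2
    rw [mem_halfBand, rotSite_apply] at this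
    simp only [Set.mem_ofPred_eq] at hp this
    by_cases hpb : p.1 = b.2
    · have hpe := hp.2.2.2 hpb
      have : rotSite L p = b := by rw [hpe, rotSite_apply]; ext <;> simp
      exact hXY b h1.right_mem.1 (this ▸ hp'.1)
    · omega

/-- The sites of the half trapezoid reached from its inner side through closed sites. -/
def explored (L m : ℤ) (ω : Config) : Set Site :=
  {v | Reach {v | v ∈ halfBand L m ∧ v.1 + v.2 = L - m} (halfBand L m) ({v | ω v = false} ∩ Set.univ) v}

theorem explored_stopping (L m : ℤ) : Stopping (explored L m) :=
  Stopping.reach (Stopping.const _) _ _ _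

theorem explored_subset (L m : ℤ) (ω : Config) : explored L m ω ⊆ halfBand L m := by
  intro v hv
  rcases Reach.mem hv with h | h
  · exact h.1
  · exact h

/-- There is an open crossing inside the explored region. -/
def ExpCross (L m : ℤ) : Set Config :=
  {ω | ∃ (k : ℤ) (b : Site), Conn ({v | ω v = true} ∩ explored L m ω) (k, 0) b ∧ b.1 - b.2 ≤ 1}

theorem expCross_of_half {L m : ℤ} (hm : 1 ≤ m) (hL : m < L) :
    ConnEv true (halfBand L m) {v | v.2 = 0} {v | v.1 - v.2 ≤ 1} ⊆ ExpCross L m := by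
  rintro ω ⟨a, ha, b, hb, hab⟩
  set A := explored L m ω with hA
  have hAs : ∀ v ∈ A, v ∈ halfBand L m := explored_subset L m ω
  have hAb : ∀ v ∈ halfBand L m, v.1 + v.2 = L - m → v ∈ A := fun v hv h => .base ⟨hv, h⟩
  have hAr : ∀ v ∈ A, ω v = false → ∀ w ∈ halfBand L m, Adj v w → w ∈ A :=
    fun v hv h w hw ha => Reach.step hv ⟨h, trivial⟩ ha hw
  have hbar : ∀ v ∈ A, ω v = false → v.1 + v.2 ≠ L := by
    intro v hv hc hs
    have : ∃ s : Site, s.1 + s.2 = L - m ∧ Conn ({v | ω v = false} ∩ halfBand L m) s v := by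
      rcases Reach.exists_conn hv with h | ⟨s, hs, hsX, u, h1, h2, h3⟩
      · exact ⟨v, h.2, .refl ⟨hc, h.1⟩⟩
      · refine ⟨s, hs.2, (h1.mono ?_).tail h2 ⟨hc, h3⟩⟩
        rintro w ⟨⟨-, hw, -⟩, hw2⟩
        exact ⟨hw, hw2.elim (fun h => h.1) id⟩
    obtain ⟨s, hs1, hs2⟩ := this
    exact halfBand_barrier (by intro v h1 h2; simp_all) hab ha hb hs2 hs1 hs
  rcases hex (({v | ω v = true} ∩ A ∪ {v | v ∈ band L m ∧ v.1 < v.2})ᶜ) (x₀ := 0) (x₁ := L)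
    (y₀ := 0) (y₁ := L) (by omega) (by omega) with ⟨c, d, hc, hd, h⟩ | ⟨c, d, hc, hd, h⟩
  · exfalso
    have key : ∀ v ∈ rect 0 L 0 L, v ∉ ({v | ω v = true} ∩ A ∪ {v | v ∈ band L m ∧ v.1 < v.2}) →
        v.1 + v.2 < L - m ∨ L < v.1 + v.2 ∨ (v ∈ halfBand L m ∧ (v ∈ A → ω v = false)) := by
      intro v hv hn
      simp only [Set.mem_union, Set.mem_inter_iff, Set.mem_ofPred_eq, not_or, mem_band] at hn
      rw [mem_rect] at hv
      rw [mem_halfBand]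
      by_cases h1 : v.1 + v.2 < L - m
      · exact .inl h1
      by_cases h2 : L < v.1 + v.2
      · exact .inr (.inl h2)
      refine .inr (.inr ⟨by omega, fun hvA => ?_⟩)
      by_contra hh
      exact hn.1 ⟨by simpa using hh, hvA⟩
    have inv : d.1 + d.2 < L - m ∨ (d ∈ A ∧ ω d = false ∧ d.1 + d.2 < L) := by
      refine h.induction' (fun v => v.1 + v.2 < L - m ∨ (v ∈ A ∧ ω v = false ∧ v.1 + v.2 < L)) ?_ ?_
      · have h1 := key c h.1.2 h.1.1
        have h2 := h.1.2
        rw [mem_rect] at h2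
        rw [mem_halfBand] at h1
        omega
      · intro p q _ hp hpq hq
        have hpq' := adj_iff.1 hpq
        rcases key q hq.2 hq.1 with h1 | h1 | ⟨h1, h2⟩
        · exact .inl h1
        · rcases hp with hp | ⟨-, -, hp⟩ <;> omega
        · rcases hp with hp | ⟨hp, hpc, hps⟩
          · have hs : q.1 + q.2 = L - m := by rw [mem_halfBand] at h1; omega
            have hqA := hAb q h1 hs
            exact .inr ⟨hqA, h2 hqA, by omega⟩
          · have hqA := hAr p hp hpc q h1 hpq
            have := hbar q hqA (h2 hqA)
            rw [mem_halfBand] at h1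
            exact .inr ⟨hqA, h2 hqA, by omega⟩
    have h1 := h.right_mem.2
    rw [mem_rect] at h1
    rcases inv with h2 | ⟨-, -, h2⟩ <;> omega
  · have hN : ∀ v ∈ rect 0 L 0 L \ (({v | ω v = true} ∩ A ∪ {v | v ∈ band L m ∧ v.1 < v.2})ᶜ),
        (ω v = true ∧ v ∈ A) ∨ (v ∈ band L m ∧ v.1 < v.2) := by
      rintro v ⟨-, hv⟩
      exact Set.notMem_compl_iff.1 hv
    have hcA : ω c = true ∧ c ∈ A := by
      rcases hN c h.1 with h | ⟨h, h'⟩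
      · exact h
      · rw [mem_band] at h; omega
    have hdA : ¬ d.2 ≤ d.1 := by
      rcases hN d h.right_mem with ⟨-, h⟩ | ⟨h, h'⟩
      · have := hAs d h
        rw [mem_halfBand] at this; omega
      · omega
    have hc' := hAs c hcA.2
    rw [mem_halfBand] at hc'
    obtain ⟨p, q, h1, h2, h3, h4⟩ := h.first_exit (M := {v | v.2 ≤ v.1}) hc'.1 hdA
    refine ⟨c.1, p, ?_, ?_⟩
    · rw [show ((c.1, 0) : Site) = c by ext <;> simp [hc]]
      refine h1.mono ?_
      rintro v ⟨hv, hv'⟩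
      rcases hN v hv with h | ⟨h, h'⟩
      · exact h
      · simp only [Set.mem_ofPred_eq] at hv'; omega
    · simp only [Set.mem_ofPred_eq] at h4
      have := h1.right_mem.2
      simp only [Set.mem_ofPred_eq] at this
      rw [adj_iff] at h2; omega

/-- The set used in the reflection argument for the trapezoid. -/
def reflSet (L m k : ℤ) (e : Set Site) (ω : Config) : Set Site :=
  {v | v ∈ e ∨ (v.1 + v.2 < L - m ∧ v.2 ≤ v.1) ∨ (L - m ≤ v.1 + v.2 ∧ v.1 + v.2 ≤ L ∧ v.2 < 0 ∧ v.1 ≤ k) ∨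
    (v ∈ band L m ∧ v ∉ e ∧ swapSite v ∉ e ∧ ω v = true) ∨
    (L < v.1 + v.2 ∧ v.1 ≤ v.2) ∨ (L - m ≤ v.1 + v.2 ∧ v.1 + v.2 ≤ L ∧ v.1 < 0 ∧ k < v.2)}

theorem reflSet_compl {L m k : ℤ} (hmL : m < L) {e : Set Site} {ω : Config} {v : Site}
    (hv : v ∉ reflSet L m k e ω) : swapSite v ∈ reflSet L m k e (fun v => !ω (swapSite v)) := by
  have hss : swapSite (swapSite v) = v := rfl
  simp only [reflSet, Set.mem_ofPred_eq, hss, mem_band, not_or, not_and] at hv ⊢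
  by_cases hs : swapSite v ∈ e
  · exact .inl hs
  simp only [swapSite_apply] at hs ⊢
  obtain ⟨h1, h2, h3, h4, h5, h6⟩ := hv
  by_cases hb : 0 ≤ v.1 ∧ 0 ≤ v.2 ∧ L - m ≤ v.1 + v.2 ∧ v.1 + v.2 ≤ L
  · have := h4 hb h1 hs
    refine .inr (.inr (.inr (.inl ⟨by omega, hs, h1, by simpa using this⟩)))
  · clear h4 h1 hs
    omega

/-- The target sites for the reflection argument. -/
def farSide (L : ℤ) : Set Site := {v | v.1 = 0 ∨ (v.1 + v.2 = L ∧ v.1 ≤ v.2 + 1)}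

theorem reflSet_join {L m k : ℤ} (hm : 1 ≤ m) (hL : m < L) {ω ω' : Config} {b : Site}
    (hkb : Conn ({v | ω v = true} ∩ explored L m ω) (k, 0) b) (hb : b.1 - b.2 ≤ 1)
    {c d : Site} (hc : c.2 = -1) (hd : d.2 = L + 1)
    (h : Conn (rect (-1) (L + 1) (-1) (L + 1) ∩ reflSet L m k (explored L m ω) ω') c d) :
    mix (explored L m ω) ω ω' ∈ ConnEv true (band L m) {v | v.2 = 0} (farSide L) := by
  set e := explored L m ω with he
  have heb : ∀ v ∈ e, v ∈ halfBand L m := explored_subset L m ω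
  have hk := heb _ hkb.1.2
  rw [mem_halfBand] at hk
  simp only at hk
  set G : Set Site := {v | Conn ({v | ω v = true} ∩ e) (k, 0) v} with hG
  have hGe : ∀ v ∈ G, v ∈ e ∧ ω v = true := fun v hv => ⟨hv.right_mem.2, hv.right_mem.1⟩
  have hkG : ((k, 0) : Site) ∈ G := .refl hkb.1
  have hZ : ∀ v ∈ rect (-1) (L + 1) (-1) (L + 1) ∩ reflSet L m k e ω', (-1 ≤ v.1 ∧ -1 ≤ v.2) ∧
      (v ∈ e ∨ (v.1 + v.2 < L - m ∧ v.2 ≤ v.1) ∨ (L - m ≤ v.1 + v.2 ∧ v.1 + v.2 ≤ L ∧ v.2 < 0 ∧ v.1 ≤ k) ∨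
    (v ∈ band L m ∧ v ∉ e ∧ swapSite v ∉ e ∧ ω' v = true) ∨
    (L < v.1 + v.2 ∧ v.1 ≤ v.2) ∨ (L - m ≤ v.1 + v.2 ∧ v.1 + v.2 ≤ L ∧ v.1 < 0 ∧ k < v.2)) := by
    rintro v ⟨h1, h2⟩
    rw [mem_rect] at h1
    exact ⟨by omega, h2⟩
  set M : Set Site := {v | v ∈ e ∨ (v.1 + v.2 < L - m ∧ v.2 ≤ v.1) ∨
    (L - m ≤ v.1 + v.2 ∧ v.1 + v.2 ≤ L ∧ v.2 < 0 ∧ v.1 ≤ k)} with hM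
  have hcM : c ∈ M := by
    obtain ⟨h1, h2⟩ := hZ c h.1
    rcases h2 with h2 | h2 | h2 | h2 | h2 | h2
    · exact .inl h2
    · exact .inr (.inl h2)
    · exact .inr (.inr h2)
    · have := h2.1; rw [mem_band] at this; omega
    · omega
    · omega
  have hdM : d ∉ M := by
    obtain ⟨h1, -⟩ := hZ d h.right_mem
    rintro (h2 | h2 | h2)
    · have := heb d h2; rw [mem_halfBand] at this; omega
    · omega
    · omega
  obtain ⟨u, v, hu, huM, huv, hvd⟩ := h.last_exit hcM hdM
  -- the sites of the new open walk
  set O : Set Site := {v | v ∈ band L m ∧ v ∉ e ∧ swapSite v ∉ e ∧ ω' v = true} with hO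
  set C : Set Site := {v | (-1 ≤ v.1 ∧ -1 ≤ v.2) ∧ ((L < v.1 + v.2 ∧ v.1 ≤ v.2) ∨
    (L - m ≤ v.1 + v.2 ∧ v.1 + v.2 ≤ L ∧ v.1 < 0 ∧ k < v.2))} with hC
  have hOC : ∀ x ∈ (rect (-1) (L + 1) (-1) (L + 1) ∩ reflSet L m k e ω') \ M, x ∈ O ∨ x ∈ C := by
    rintro x ⟨hx, hxM⟩
    obtain ⟨h1, h2⟩ := hZ x hx
    rcases h2 with h2 | h2 | h2 | h2 | h2 | h2
    · exact absurd (.inl h2) hxM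
    · exact absurd (.inr (.inl h2)) hxM
    · exact absurd (.inr (.inr h2)) hxM
    · exact .inl h2
    · exact .inr ⟨h1, .inl h2⟩
    · exact .inr ⟨h1, .inr h2⟩
  have hOnC : ∀ x ∈ O, x ∉ C := by
    rintro x hx hxC
    have h1 := hx.1
    rw [mem_band] at h1
    simp only [hC, Set.mem_ofPred_eq] at hxC
    omega
  have hdC : d ∈ C := by
    rcases hOC d hvd.right_mem with h1 | h1
    · have := h1.1; rw [mem_band] at this; omega
    · exact h1
  have hTC : ∀ x ∈ band L m, ∀ w ∈ C, Adj x w → x ∈ farSide L := by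
    intro x hx w hw ha
    rw [mem_band] at hx
    simp only [hC, Set.mem_ofPred_eq] at hw
    rw [adj_iff] at ha
    simp only [farSide, Set.mem_ofPred_eq]
    omega
  -- the walk from `v` to the first site of `C`
  obtain ⟨w, hwC, hvw⟩ : ∃ w ∈ C, v = w ∨ ∃ x, Conn O v x ∧ Adj x w := by
    by_cases hvC : v ∈ C
    · exact ⟨v, hvC, .inl rfl⟩
    · obtain ⟨x, w, h1, h2, h3, h4⟩ := hvd.first_exit (M := Cᶜ) hvC (by simpa using hdC)
      refine ⟨w, by simpa using h4, .inr ⟨x, h1.mono ?_, h2⟩⟩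
      rintro y ⟨hy, hyC⟩
      exact (hOC y hy).resolve_right hyC
  have hup := hZ u hu
  have huv' := adj_iff.1 huv
  have hwC' := hwC
  simp only [hC, Set.mem_ofPred_eq] at hwC'
  have hmixe : ∀ x ∈ e, mix e ω ω' x = ω x := fun x hx => mix_of_mem hx
  have hmixO : ∀ x ∈ O, mix e ω ω' x = true := fun x hx => by rw [mix_of_notMem hx.2.1]; exact hx.2.2.2
  by_cases huG : u ∈ G
  · have h1 : Conn ({v | mix e ω ω' v = true} ∩ band L m) (k, 0) u := by
      refine Conn.mono ?_ huG
      rintro x ⟨hx, hxe⟩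
      exact ⟨by simp only [Set.mem_ofPred_eq]; rw [hmixe x hxe]; exact hx, halfBand_subset _ _ (heb x hxe)⟩
    rcases hvw with rfl | ⟨x, hx, hxw⟩
    · exact ⟨_, rfl, u, hTC u h1.right_mem.2 _ hwC huv, h1⟩
    · have h2 : Conn ({v | mix e ω ω' v = true} ∩ band L m) v x :=
        hx.mono fun y hy => ⟨hmixO y hy, hy.1⟩
      exact ⟨_, rfl, x, hTC x h2.right_mem.2 _ hwC hxw, (h1.tail huv h2.1).trans h2⟩
  · exfalso
    -- the arch
    set Ls : Set Site := G ∪ {v | swapSite v ∈ G} ∪ {v | v.1 = -1 ∧ 0 ≤ v.2 ∧ v.2 ≤ k} with hLs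
    have hLs' : ∀ x ∈ Ls, (x ∈ G ∧ x ∈ halfBand L m ∧ x ∈ e) ∨
        (swapSite x ∈ G ∧ swapSite x ∈ halfBand L m ∧ swapSite x ∈ e) ∨
        (x.1 = -1 ∧ 0 ≤ x.2 ∧ x.2 ≤ k) := by
      rintro x ((hx | hx) | hx)
      · exact .inl ⟨hx, heb _ (hGe _ hx).1, (hGe _ hx).1⟩
      · exact .inr (.inl ⟨hx, heb _ (hGe _ hx).1, (hGe _ hx).1⟩)
      · exact .inr (.inr hx)
    have hLsb : ∀ x ∈ Ls, (0 ≤ x.1 ∧ 0 ≤ x.2 ∧ L - m ≤ x.1 + x.2 ∧ x.1 + x.2 ≤ L) ∨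
        (x.1 = -1 ∧ 0 ≤ x.2 ∧ x.2 ≤ k) := by
      intro x hx
      rcases hLs' x hx with ⟨-, h1, -⟩ | ⟨-, h1, -⟩ | h1
      · rw [mem_halfBand] at h1; omega
      · rw [mem_halfBand, swapSite_apply] at h1; simp only at h1; omega
      · exact .inr h1
    have harch : Conn Ls (-1, 0) (k, 0) := by
      have hk0 : (0 : ℤ) ≤ k := by omega
      have h1 : Conn Ls (-1, 0) (-1, k) := Conn.vert _ _ _ fun z h1 h2 => .inr ⟨rfl, by simp; omega, by simp; omega⟩
      have hkb' : Conn G (k, 0) b := hkb.within_cluster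
      have h2 : Conn Ls (0, k) (swapSite b) := hkb'.map swapSite_adj fun x hx => .inl (.inr hx)
      have h3 : Conn Ls b (k, 0) := hkb'.symm.mono fun x hx => .inl (.inl hx)
      have h4 := h1.tail (w := (0, k)) (by rw [adj_iff]; simp) h2.1
      have h5 := h4.trans h2
      have hbh := heb b hkb.right_mem.2
      rw [mem_halfBand] at hbh
      by_cases hb1 : b.1 = b.2
      · rw [show swapSite b = b by ext <;> simp [swapSite_apply, hb1]] at h5
        exact h5.trans h3
      · exact (h5.tail (w := b) (by rw [adj_iff, swapSite_apply]; simp only; omega) h3.1).trans h3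
    -- a site of the explored region on the arch lies in `G`
    have hLsG : ∀ x ∈ e, x ∈ Ls → x ∈ G := by
      intro x hx hxL
      have hxb := heb x hx
      rw [mem_halfBand] at hxb
      rcases hLs' x hxL with ⟨h1, -⟩ | ⟨h1, h2, -⟩ | h1
      · exact h1
      · rw [mem_halfBand, swapSite_apply] at h2
        simp only at h2
        rwa [show swapSite x = x by rw [swapSite_apply]; ext <;> simp only <;> omega] at h1
      · omega
    have hOL : ∀ x ∈ O, x ∉ Ls := by
      intro x hx hxL
      rcases hLs' x hxL with ⟨-, -, h1⟩ | ⟨-, -, h1⟩ | h1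
      · exact hx.2.1 h1
      · exact hx.2.2.1 h1
      · have := hx.1; rw [mem_band] at this; omega
    have hCL : ∀ x ∈ C, x ∉ Ls := by
      intro x hx hxL
      simp only [hC, Set.mem_ofPred_eq] at hx
      rcases hLsb x hxL with h1 | h1 <;> omega
    suffices hs : ∃ (s : ℤ) (Q : Set Site), s < k ∧ 0 ≤ s ∧ Conn Q (s, 0) w ∧ (∀ x ∈ Q, 0 ≤ x.2) ∧
        ∀ x ∈ Q, x ∉ Ls by
      obtain ⟨s, Q, hsk, hs0, hQ, hQy, hQL⟩ := hs
      have := no_cross harch (fun x hx => by rcases hLsb x hx with h1 | h1 <;> omega) hQ hQy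
        (fun x hx hxQ => hQL x hxQ hx) (by
          intro x hx hxw
          rcases hLsb x hx with h1 | h1 <;> omega)
      omega
    -- it suffices to reach `v` or a neighbor
    have hwy : 0 ≤ w.2 := by omega
    have hQv : ∀ Q : Set Site, ∀ s : ℤ, Conn Q (s, 0) u → (∀ x ∈ Q, 0 ≤ x.2) → (∀ x ∈ Q, x ∉ Ls) →
        ∃ Q : Set Site, Conn Q (s, 0) w ∧ (∀ x ∈ Q, 0 ≤ x.2) ∧ ∀ x ∈ Q, x ∉ Ls := by
      intro Q s hQ hQy hQL
      refine ⟨Q ∪ O ∪ {w}, ?_, ?_, ?_⟩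
      · have h1 : Conn (Q ∪ O ∪ {w}) (s, 0) u := hQ.mono fun x hx => .inl (.inl hx)
        rcases hvw with rfl | ⟨x, hx, hxw⟩
        · exact h1.tail huv (.inr rfl)
        · have h2 : Conn (Q ∪ O ∪ {w}) v x := hx.mono fun x hx => .inl (.inr hx)
          exact ((h1.tail huv h2.1).trans h2).tail hxw (.inr rfl)
      · rintro x ((hx | hx) | rfl)
        · exact hQy x hx
        · have := hx.1; rw [mem_band] at this; omega
        · exact hwy
      · rintro x ((hx | hx) | rfl)
        · exact hQL x hx
        · exact hOL x hx
        · exact hCL _ hwC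
    have hcol : ∀ x : Site, 0 ≤ x.2 → (∀ y, 0 ≤ y → y ≤ x.2 → ((x.1, y) : Site) ∉ Ls) →
        ∃ Q : Set Site, Conn Q (x.1, 0) x ∧ (∀ y ∈ Q, 0 ≤ y.2) ∧ ∀ y ∈ Q, y ∉ Ls := by
      intro x hx hxL
      refine ⟨{y | y.1 = x.1 ∧ 0 ≤ y.2 ∧ y.2 ≤ x.2}, ?_, fun y hy => hy.2.1, ?_⟩
      · refine Conn.vert (S := {y | y.1 = x.1 ∧ 0 ≤ y.2 ∧ y.2 ≤ x.2}) x.1 0 x.2 fun z h1 h2 => ⟨rfl, ?_, ?_⟩ <;> simp only <;> omega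
      · rintro ⟨y1, y2⟩ ⟨h1, h2, h3⟩
        simp only at h1 h2 h3
        subst h1
        exact hxL y2 h2 h3
    have hvOC := hOC v hvd.1
    have hvM := hvd.1.2
    by_cases huy : u.2 < 0
    · -- start at `v`
      have hv0 : v.2 = 0 := by
        by_contra hv0
        have hvneg : v.2 = -1 := by have := (hZ v hvd.1.1).1; omega
        rcases hvOC with h1 | h1
        · have := h1.1; rw [mem_band] at this; omega
        · simp only [hC, Set.mem_ofPred_eq] at h1; omega
      have hvO : v ∈ O := by
        refine hvOC.resolve_right fun h1 => ?_
        simp only [hC, Set.mem_ofPred_eq] at h1; omega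
      have hvb := hvO.1
      rw [mem_band] at hvb
      have huk : u.1 ≤ k := by
        rcases huM with h1 | h1 | h1
        · have := heb u h1; rw [mem_halfBand] at this; omega
        · omega
        · omega
      have hvk : v.1 ≠ k := by
        intro hvk
        apply hvO.2.1
        rw [show v = (k, 0) by ext <;> simp [hvk, hv0]]
        exact (hGe _ hkG).1
      have hve : v = (v.1, 0) := by ext <;> simp [hv0]
      refine ⟨v.1, O ∪ {w}, by omega, hvb.1, ?_, ?_, ?_⟩
      · rw [← hve]
        rcases hvw with rfl | ⟨x, hx, hxw⟩
        · exact .refl (.inr rfl)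
        · exact (hx.mono fun x hx => .inl hx).tail hxw (.inr rfl)
      · rintro x (hx | rfl)
        · have := hx.1; rw [mem_band] at this; omega
        · exact hwy
      · rintro x (hx | rfl)
        · exact hOL x hx
        · exact hCL _ hwC
    · rcases huM with h1 | h1 | h1
      · -- a closed chain from the inner side
        have hbase : ∀ s ∈ halfBand L m, s.1 + s.2 = L - m → s ∉ G → s ∈ e →
            0 ≤ s.1 ∧ s.1 < k ∧ ∀ y, 0 ≤ y → y ≤ s.2 → ((s.1, y) : Site) ∉ Ls := by
          intro s hs hsum hsG hse
          rw [mem_halfBand] at hs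
          refine ⟨by omega, ?_, ?_⟩
          · by_contra hsk
            apply hsG
            rw [show s = (k, 0) by ext <;> simp only <;> omega]
            exact hkG
          · intro y hy1 hy2 hyL
            by_cases hy : y = s.2
            · subst hy; exact hsG (hLsG s hse hyL)
            · rcases hLsb _ hyL with h1 | h1 <;> simp only at h1 <;> omega
        rcases Reach.exists_conn h1 with h2 | ⟨s, hs, hsX, x, h2, h3, h4⟩
        · obtain ⟨h3, h4, h5⟩ := hbase u h2.1 h2.2 huG h1
          obtain ⟨Q, hQ, hQy, hQL⟩ := hcol u (by omega) h5
          obtain ⟨Q, hQ⟩ := hQv Q _ hQ hQy hQL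
          exact ⟨u.1, Q, h4, h3, hQ⟩
        · have hcl : ∀ x ∈ {w | Reach {v | v ∈ halfBand L m ∧ v.1 + v.2 = L - m} (halfBand L m)
              ({v | ω v = false} ∩ Set.univ) w} ∩ ({v | ω v = false} ∩ Set.univ) ∩
              ({v | v ∈ halfBand L m ∧ v.1 + v.2 = L - m} ∪ halfBand L m), x ∈ e ∧ ω x = false :=
            fun x hx => ⟨hx.1.1, hx.1.2.1⟩
          have hsG : s ∉ G := fun h => by
            have h5 := (hGe s h).2
            have h6 : ω s = false := hsX.1
            rw [h5] at h6; cases h6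
          have hse : s ∈ e := Reach.base hs
          obtain ⟨h6, h7, h8⟩ := hbase s hs.1 hs.2 hsG hse
          obtain ⟨Q, hQ, hQy, hQL⟩ := hcol s (by have := heb s hse; rw [mem_halfBand] at this; omega) h8
          set K : Set Site := {x | x ∈ e ∧ ω x = false} with hK
          have h9 : Conn (Q ∪ K ∪ {u}) s u := (h2.mono fun x hx => .inl (.inr (hcl x hx))).tail h3 (.inr rfl)
          obtain ⟨Q', hQ'⟩ := hQv (Q ∪ K ∪ {u}) s.1 ((hQ.mono fun x hx => .inl (.inl hx)).trans h9)
            (by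
              rintro x ((hx | hx) | rfl)
              · exact hQy x hx
              · have := heb x hx.1; rw [mem_halfBand] at this; omega
              · omega)
            (by
              rintro x ((hx | hx) | rfl) hxL
              · exact hQL x hx hxL
              · have := (hGe x (hLsG x hx.1 hxL)).2
                rw [hx.2] at this; cases this
              · exact huG (hLsG _ h1 hxL))
          exact ⟨s.1, Q', h7, h6, hQ'⟩
      · obtain ⟨Q, hQ, hQy, hQL⟩ := hcol u (by omega) (by
          intro y hy1 hy2 hyL
          rcases hLsb _ hyL with h2 | h2 <;> simp only at h2 <;> omega)
        obtain ⟨Q, hQ⟩ := hQv Q _ hQ hQy hQL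
        exact ⟨u.1, Q, by omega, by omega, hQ⟩
      · omega

theorem ExpCross.depOn (L m : ℤ) : DepOn (halfBand L m) (ExpCross L m) := by
  rintro ω ω' h ⟨k, b, h1, h2⟩
  have he : explored L m ω' = explored L m ω :=
    explored_stopping L m ω ω' fun v hv => h v (explored_subset L m ω hv)
  refine ⟨k, b, ?_, h2⟩
  rw [he, ← color_inter_congr true fun v hv => h v (explored_subset L m ω hv)]
  exact h1

theorem FinDep.not {E : Set Config} (hE : FinDep E) : FinDep {ω | (fun v => !ω v) ∈ E} := by
  obtain ⟨V, hV, hE⟩ := hE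
  refine ⟨V, hV, fun ω ω' h hω => hE _ _ (fun v hv => ?_) hω⟩
  rw [h v hv]

/-- Vertical crossings in the reflection argument. -/
def ReflCross (L m k : ℤ) (e : Set Site) : Set Config :=
  {ω | ∃ c d, c.2 = -1 ∧ d.2 = L + 1 ∧ Conn (rect (-1) (L + 1) (-1) (L + 1) ∩ reflSet L m k e ω) c d}

theorem half_le_reflCross {μ : Measure Config} (hμ : IsBernoulliHalf μ) {L m : ℤ} (hm : 1 ≤ m)
    (hL : m < L) (k : ℤ) (e : Set Site) : 1 / 2 ≤ μ.real (ReflCross L m k e) := by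
  have hF : FinDep (ReflCross L m k e) := by
    refine ⟨_, band_finite L m, ?_⟩
    rintro ω ω' h ⟨c, d, h1, h2, h3⟩
    refine ⟨c, d, h1, h2, h3.mono fun v hv => ⟨hv.1, ?_⟩⟩
    have hv2 := hv.2
    simp only [reflSet, Set.mem_ofPred_eq] at hv2 ⊢
    by_cases hb : v ∈ band L m
    · rwa [← h v hb]
    · simpa [hb] using hv2
  have h0 := hμ.comp_equiv swapSite hF.not
  rw [hμ.comp_not hF] at h0
  have hsub : (Set.univ : Set Config) ⊆ ReflCross L m k e ∪
      {ω | (fun v => ω (swapSite v)) ∈ {ω | (fun v => !ω v) ∈ ReflCross L m k e}} := by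
    intro ω _
    rcases hex (reflSet L m k e ω)ᶜ (x₀ := -1) (x₁ := L + 1) (y₀ := -1) (y₁ := L + 1)
      (by omega) (by omega) with ⟨a, b, ha, hb, h⟩ | ⟨a, b, ha, hb, h⟩
    · refine .inr ⟨swapSite a, swapSite b, ha, hb, h.map swapSite_adj ?_⟩
      rintro v ⟨hv, hvr⟩
      refine ⟨?_, reflSet_compl hL hv⟩
      rw [mem_rect] at hvr ⊢
      rw [swapSite_apply]; simp only; omega
    · refine .inl ⟨a, b, ha, hb, h.mono ?_⟩
      rintro v ⟨hv, hvr⟩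
      exact ⟨hv, Set.notMem_compl_iff.1 hvr⟩
  have := hμ.1
  have h3 := (hμ.real_mono hsub).trans (measureReal_union_le _ _)
  rw [h0] at h3
  simp at h3
  linarith

theorem expCross_le_farSide {μ : Measure Config} (hμ : IsBernoulliHalf μ) {L m : ℤ} (hm : 1 ≤ m)
    (hL : m < L) : 1 / 2 * μ.real (ExpCross L m) ≤
      μ.real (ConnEv true (band L m) {v | v.2 = 0} (farSide L)) := by
  refine hμ.mix_le ⟨_, halfBand_finite L m, ExpCross.depOn L m⟩
    (ConnEv.finDep (band_finite L m) ..) (explored_stopping L m) fun ω => ?_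
  by_cases hω : ω ∈ ExpCross L m
  · obtain ⟨k, b, h1, h2⟩ := hω
    refine le_trans ?_ ((half_le_reflCross hμ hm hL k (explored L m ω)).trans (hμ.real_mono ?_))
    · have := hμ.real_le_one {ω' | mix (explored L m ω) ω ω' ∈ ExpCross L m}
      linarith
    · rintro ω' ⟨c, d, hc, hd, h⟩
      exact reflSet_join hm hL h1 h2 hc hd h
  · have : {ω' | mix (explored L m ω) ω ω' ∈ ExpCross L m} = ∅ := by
      ext ω'
      simp only [Set.mem_ofPred_eq, Set.mem_empty_iff_false, iff_false]
      rintro ⟨k, b, h1, h2⟩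
      rw [(explored_stopping L m).mix] at h1
      exact hω ⟨k, b, by rwa [← color_inter_congr true fun v hv => mix_of_mem hv], h2⟩
    rw [this]
    simp

theorem leg_cross_of_farSide {L m : ℤ} {S : Set Site} {a b c d : Site}
    (h1 : Conn (S ∩ band L m) a b) (ha : a.2 = 0) (hb : b ∈ farSide L)
    (h2 : Conn (S ∩ band L m) c d) (hc : c.1 = 0) (hd : swapSite d ∈ farSide L) :
    ∃ a' c', a'.2 = 0 ∧ c'.1 = 0 ∧ Conn (S ∩ band L m) a' c' := by
  by_cases hb0 : b.1 = 0
  · exact ⟨a, b, ha, hb0, h1⟩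
  by_cases hd0 : d.2 = 0
  · exact ⟨d, c, hd0, hc, h2.symm⟩
  simp only [farSide, Set.mem_ofPred_eq, swapSite_apply] at hb hd
  replace hb := hb.resolve_left hb0
  replace hd := hd.resolve_left hd0
  by_cases hbd : d.1 < b.1
  · refine ⟨a, c, ha, hc, (h1.tail (w := d) ?_ h2.right_mem).trans h2.symm⟩
    rw [adj_iff]; omega
  by_contra hcon
  push Not at hcon
  have hdisj : ∀ v, Conn (S ∩ band L m) a v → ¬ Conn (S ∩ band L m) c v := fun v h3 h4 =>
    hcon a c ha hc (h3.trans h4.symm)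
  have hcb := h2.1.2
  have hdb := h2.right_mem.2
  have hab := h1.1.2
  have hbb := h1.right_mem.2
  rw [mem_band] at hcb hdb hab hbb
  set K : Set Site := {v | Conn (S ∩ band L m) c v} ∪ {v | v.1 = -1 ∧ 0 ≤ v.2} ∪
    {v | d.1 < v.1 ∧ d.2 = v.2} ∪ {v | v.1 = L + 2 ∧ 0 ≤ v.2 ∧ v.2 ≤ d.2} with hK
  have k1 : Conn K (-1, 0) (-1, c.2) :=
    Conn.vert _ _ _ fun z h3 h4 => .inl (.inl (.inr ⟨rfl, by simp; omega⟩))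
  have k2 : Conn K c d := h2.within_cluster.mono fun v hv => .inl (.inl (.inl hv))
  have k3 : Conn K (d.1 + 1, d.2) (L + 2, d.2) :=
    Conn.horiz _ _ _ fun z h3 h4 => .inl (.inr ⟨by simp; omega, rfl⟩)
  have k4 : Conn K (L + 2, d.2) (L + 2, 0) :=
    Conn.vert _ _ _ fun z h3 h4 => .inr ⟨rfl, by simp; omega, by simp; omega⟩
  have k5 := (((k1.tail (w := c) (by rw [adj_iff]; simp [show c.1 = 0 from hc]) k2.1).trans k2).tail
    (w := (d.1 + 1, d.2)) (by rw [adj_iff]; simp) k3.1).trans (k3.trans k4)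
  have hae : a = (a.1, 0) := by ext <;> simp [ha]
  have h1' := h1.within_cluster
  rw [hae] at h1'
  have hKb : ∀ v ∈ K, v ∉ {w | Conn (S ∩ band L m) (a.1, 0) w} := by
    intro v hv hv'
    have hv2 : v ∈ band L m := (Conn.right_mem hv').2
    rw [mem_band] at hv2
    rcases hv with ((hv | hv) | hv) | hv
    · rw [← hae] at hv'
      exact hdisj v hv' hv
    · have := hv.1; omega
    · have := hv.1; have := hv.2; omega
    · have := hv.1; omega
  have := no_cross k5 (by
      rintro v (((hv | hv) | hv) | hv)
      · have : v ∈ band L m := (Conn.right_mem hv).2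
        rw [mem_band] at this; omega
      · exact hv.2
      · have := hv.2; omega
      · exact hv.2.1) h1' (fun v hv => by
        have : v ∈ band L m := (Conn.right_mem hv).2
        rw [mem_band] at this; omega) hKb (by
      rintro v (((hv | hv) | hv) | hv) hvb
      · have h5 : v ∈ band L m := (Conn.right_mem hv).2
        rw [mem_band] at h5
        rcases lt_or_ge v.2 b.2 with h6 | h6
        · exact h6
        · have : v = b := by ext <;> omega
          exact absurd hv (hdisj v (this ▸ h1))
      · have := hv.1; omega
      · have := hv.1; omega
      · have := hv.1; omega)
  omega

theorem band_doubling {μ : Measure Config} (hμ : IsBernoulliHalf μ) {L m : ℤ} (hm : 1 ≤ m)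
    (hL : m < L) :
    (1 / 2 * μ.real (ConnEv true (halfBand L m) {v | v.2 = 0} {v | v.1 - v.2 ≤ 1})) ^ 2 ≤
      μ.real (ConnEv true (band L m) {v | v.2 = 0} {v | v.1 = 0}) := by
  have h1 := (mul_le_mul_of_nonneg_left (hμ.real_mono (expCross_of_half hm hL))
    (by norm_num : (0 : ℝ) ≤ 1 / 2)).trans (expCross_le_farSide hμ hm hL)
  set E := ConnEv true (band L m) {v | v.2 = 0} (farSide L)
  set F := ConnEv true (band L m) {v | v.1 = 0} {v | swapSite v ∈ farSide L}
  have h2 : μ.real E ≤ μ.real F := by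
    refine ConnEv.real_le_map hμ (band_finite L m) true swapSite swapSite_adj ?_ ?_ ?_
    · intro v hv; rw [mem_band] at *; rw [swapSite_apply]; simp only; omega
    · intro v _ hv; exact hv
    · intro v _ hv; exact hv
  have h3 : μ.real E * μ.real F ≤ μ.real (E ∩ F) :=
    hμ.fkg (ConnEv.finDep (band_finite L m) ..) (ConnEv.finDep (band_finite L m) ..)
      (ConnEv.isUpperSet ..) (ConnEv.isUpperSet ..)
  have h4 : E ∩ F ⊆ ConnEv true (band L m) {v | v.2 = 0} {v | v.1 = 0} := by
    rintro ω ⟨⟨a, ha, b, hb, hab⟩, ⟨c, hc, d, hd, hcd⟩⟩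
    obtain ⟨a', c', h5, h6, h7⟩ := leg_cross_of_farSide hab ha hb hcd hc hd
    exact ⟨a', h5, c', h6, h7⟩
  refine le_trans ?_ (h3.trans (hμ.real_mono h4))
  have : 0 ≤ μ.real E := measureReal_nonneg
  have h0 : 0 ≤ 1 / 2 * μ.real (ConnEv true (halfBand L m) {v | v.2 = 0} {v | v.1 - v.2 ≤ 1}) := by
    positivity
  rw [sq]
  exact mul_le_mul h1 (h1.trans h2) h0 this

theorem half_of_band {L m : ℤ} : ConnEv true (band L m) {v | v.2 = 0} {v | v.1 - v.2 ≤ 1} ⊆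
    ConnEv true (halfBand L m) {v | v.2 = 0} {v | v.1 - v.2 ≤ 1} := by
  rintro ω ⟨a, ha, b, hb, hab⟩
  have ha' := hab.1.2
  rw [mem_band] at ha'
  simp only [Set.mem_ofPred_eq] at ha hb
  by_cases h1 : a.1 - a.2 ≤ 1
  · exact ⟨a, ha, a, h1, .refl ⟨hab.1.1, by rw [mem_halfBand]; omega⟩⟩
  · obtain ⟨p, q, h2, h3, h4, h5⟩ := hab.first_exit (M := {v | 2 ≤ v.1 - v.2})
      (by simp only [Set.mem_ofPred_eq]; omega) (by simp only [Set.mem_ofPred_eq]; omega)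
    have h6 := h2.right_mem.2
    have h7 := h4.2
    rw [mem_band] at h7
    simp only [Set.mem_ofPred_eq] at h5 h6
    rw [adj_iff] at h3
    refine ⟨a, ha, q, ?_, (h2.mono ?_).tail (adj_iff.2 h3) ⟨h4.1, ?_⟩⟩
    · simp only [Set.mem_ofPred_eq]; omega
    · rintro v ⟨⟨hv1, hv2⟩, hv3⟩
      rw [mem_band] at hv2
      simp only [Set.mem_ofPred_eq] at hv3
      exact ⟨hv1, by rw [mem_halfBand]; omega⟩
    · rw [mem_halfBand]; omega

theorem half_le_halfBand {μ : Measure Config} (hμ : IsBernoulliHalf μ) {m : ℤ} (hm : 1 ≤ m) :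
    1 / 2 ≤ μ.real (ConnEv true (halfBand (2 * m) m) {v | v.2 = 0} {v | v.1 - v.2 ≤ 1}) := by
  refine (half_le_square hμ (by omega : 0 ≤ m)).trans (le_trans ?_ (hμ.real_mono half_of_band))
  refine ConnEv.real_le_map hμ (rect_finite ..) true (rotSite (2 * m)) (rotSite_adj _) ?_ ?_ ?_
  · intro v hv; rw [mem_rect] at hv; rw [mem_band, rotSite_apply]; simp only; omega
  · intro v _ hv; exact hv
  · intro v hv hv'
    rw [mem_rect] at hv
    simp only [Set.mem_ofPred_eq, rotSite_apply] at *; omega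

theorem halfBand_ge_band {μ : Measure Config} (hμ : IsBernoulliHalf μ) {L L' m : ℤ} (hL : L' ≤ L)
    (h2 : L + m ≤ 2 * L') : μ.real (ConnEv true (band L' m) {v | v.2 = 0} {v | v.1 = 0}) ≤
      μ.real (ConnEv true (halfBand L m) {v | v.2 = 0} {v | v.1 - v.2 ≤ 1}) := by
  refine le_trans ?_ (hμ.real_mono half_of_band)
  refine ConnEv.real_le_map hμ (band_finite ..) true (shiftSite (L - L', 0)) (shiftSite_adj _) ?_ ?_ ?_
  · intro v hv; rw [mem_band] at hv; rw [mem_band, shiftSite_apply]; simp only; omega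
  · intro v _ hv; simp only [Set.mem_ofPred_eq, shiftSite_apply] at *; omega
  · intro v hv hv'
    rw [mem_band] at hv
    simp only [Set.mem_ofPred_eq, shiftSite_apply] at *; omega

theorem band_ge {μ : Measure Config} (hμ : IsBernoulliHalf μ) {m : ℤ} (hm : 1 ≤ m) :
    (1 / 2 : ℝ) ^ 94 ≤ μ.real (ConnEv true (band (17 * m) m) {v | v.2 = 0} {v | v.1 = 0}) := by
  have step : ∀ (L : ℤ) (n : ℕ), m < L →
      (1 / 2 : ℝ) ^ n ≤ μ.real (ConnEv true (halfBand L m) {v | v.2 = 0} {v | v.1 - v.2 ≤ 1}) →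
      (1 / 2 : ℝ) ^ (2 * n + 2) ≤ μ.real (ConnEv true (band L m) {v | v.2 = 0} {v | v.1 = 0}) := by
    intro L n hL h
    refine le_trans ?_ (band_doubling hμ hm hL)
    rw [show (1 / 2 : ℝ) ^ (2 * n + 2) = (1 / 2 * (1 / 2) ^ n) ^ 2 by ring]
    gcongr
  have h2 := step (2 * m) 1 (by omega) (by simpa using half_le_halfBand hμ hm)
  have h3 := step (3 * m) 4 (by omega) (h2.trans (halfBand_ge_band hμ (by omega) (by omega)))
  have h5 := step (5 * m) 10 (by omega) (h3.trans (halfBand_ge_band hμ (by omega) (by omega)))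
  have h9 := step (9 * m) 22 (by omega) (h5.trans (halfBand_ge_band hμ (by omega) (by omega)))
  exact step (17 * m) 46 (by omega) (h9.trans (halfBand_ge_band hμ (by omega) (by omega)))

/-- A lower bound for the probability of crossing long rectangles. -/
noncomputable def rsw : ℝ := (1 / 2) ^ 94

theorem rsw_pos : 0 < rsw := by unfold rsw; positivity

theorem rsw_le_one : rsw ≤ 1 := by unfold rsw; exact pow_le_one₀ (by norm_num) (by norm_num)

theorem HC.ge {μ : Measure Config} (hμ : IsBernoulliHalf μ) (c : Bool) {x₀ x₁ y₀ y₁ : ℤ}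
    (hx : x₀ ≤ x₁) (hy : y₀ < y₁) (h : x₁ - x₀ ≤ 16 * (y₁ - y₀)) :
    rsw ≤ μ.real (HC c x₀ x₁ y₀ y₁) := by
  have key : μ.real (HC c x₀ x₁ y₀ y₁) = μ.real (HC true x₀ x₁ y₀ y₁) := by
    cases c
    · exact ConnEv.real_not hμ (rect_finite ..) true _ _
    · rfl
  rw [key]
  have hm : 1 ≤ y₁ - y₀ := by omega
  refine (band_ge hμ hm).trans ?_
  set m := y₁ - y₀ with hmdef
  have h1 : μ.real (ConnEv true (band (17 * m) m) {v | v.2 = 0} {v | v.1 = 0}) ≤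
      μ.real (ConnEv true {v | v.1 ≤ x₁ ∧ y₀ ≤ v.2 ∧ v.2 ≤ y₁} {v | v.1 = x₁} {v | v.1 ≤ x₀}) := by
    refine ConnEv.real_le_map hμ (band_finite ..) true
      (turnSite.trans (shiftSite (x₁, y₀ - 16 * m))) ?_ ?_ ?_ ?_
    · intro a b hab; exact shiftSite_adj _ _ _ (turnSite_adj _ _ hab)
    all_goals
      intro v hv
      rw [mem_band] at hv
      simp only [Set.mem_ofPred_eq, Equiv.trans_apply, turnSite_apply, shiftSite_apply]
      omega
  refine h1.trans (hμ.real_mono ?_)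
  rintro ω ⟨a, ha, b, hb, hab⟩
  obtain ⟨a', b', h2, h3, h4⟩ := hab.symm.sub_horiz (x₀ := x₀) (x₁ := x₁) hb hx ha.ge
  refine ⟨a', h2, b', h3, h4.mono ?_⟩
  rintro v ⟨⟨hv1, hv2⟩, hv3⟩
  simp only [Set.mem_ofPred_eq] at hv2 hv3
  exact ⟨hv1, by rw [mem_rect]; omega⟩

theorem VC.ge {μ : Measure Config} (hμ : IsBernoulliHalf μ) (c : Bool) {x₀ x₁ y₀ y₁ : ℤ}
    (hy : y₀ ≤ y₁) (hx : x₀ < x₁) (h : y₁ - y₀ ≤ 16 * (x₁ - x₀)) :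
    rsw ≤ μ.real (VC c x₀ x₁ y₀ y₁) := by
  rw [VC.real_eq hμ]; exact HC.ge hμ c hy hx h

/-! ### Walks and lists -/

theorem Conn.exists_path {S : Set Site} {u v : Site} (h : Conn S u v) :
    ∃ p : List Site, IsPath p ∧ p.head? = some u ∧ p.getLast? = some v ∧ ∀ x ∈ p, x ∈ S := by
  refine h.symm.induction' (fun u => ∃ p : List Site, IsPath p ∧ p.head? = some u ∧
    p.getLast? = some v ∧ ∀ x ∈ p, x ∈ S) ?_ ?_
  · exact ⟨[v], ⟨by simp, by simp, List.isChain_singleton _⟩, rfl, rfl, by simpa using h.right_mem⟩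
  · rintro a b _ ⟨p, ⟨h1, h2, h3⟩, h4, h5, h6⟩ hab hb
    by_cases hbp : b ∈ p
    · obtain ⟨s, t, rfl⟩ := List.append_of_mem hbp
      refine ⟨b :: t, ⟨by simp, ?_, ?_⟩, rfl, ?_, ?_⟩
      · exact (List.nodup_append.1 h2).2.1
      · exact (List.isChain_append.1 h3).2.1
      · simpa using h5
      · intro x hx; exact h6 x (by simp at hx ⊢; tauto)
    · refine ⟨b :: p, ⟨by simp, List.nodup_cons.2 ⟨hbp, h2⟩, ?_⟩, rfl, ?_, ?_⟩
      · refine List.isChain_cons.2 ⟨fun y hy => ?_, h3⟩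
        rw [h4] at hy
        simp only [Option.mem_def, Option.some.injEq] at hy
        rw [← hy]; exact hab.symm
      · rw [List.getLast?_cons, h5]; rfl
      · simp only [List.mem_cons, forall_eq_or_imp]; exact ⟨hb, h6⟩

theorem Conn.of_chain {p : List Site} {u v : Site} (h : List.IsChain Adj p) (hu : p.head? = some u)
    (hv : p.getLast? = some v) : Conn {x | x ∈ p} u v := by
  induction p generalizing u with
  | nil => simp at hu
  | cons a p ih =>
    simp only [List.head?_cons, Option.some.injEq] at hu
    subst hu
    rcases p with _ | ⟨b, p⟩
    · simp only [List.getLast?_singleton, Option.some.injEq] at hv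
      subst hv
      exact .refl (by simp)
    · have h1 := List.isChain_cons_cons.1 h
      have := ih h1.2 rfl (by simpa using hv)
      exact (Conn.of_adj (by simp) h1.1 (by simp)).trans (this.mono fun x hx => List.mem_cons_of_mem _ hx)

/-- A horseshoe arm yields a walk. -/
theorem HorseArm.exists_conn {a b r₁ r₂ : ℤ} {p : List Site} (h : HorseArm a b r₁ r₂ p) :
    ∃ u t, p.head? = some u ∧ p.getLast? = some t ∧ u ∈ hBoxPlus a b r₁ ∧ t ∈ hBoxPlus a b r₂ ∧
      Conn {x | x ∈ p} u t ∧ ∀ x ∈ p, x = u ∨ x ∈ hBox a b r₂ \ hBox a b r₁ := by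
  obtain ⟨⟨-, -, h3⟩, ⟨u, hu, hu'⟩, ⟨t, ht, ht'⟩, h4⟩ := h
  refine ⟨u, t, hu', ht', hu, ht, Conn.of_chain h3 hu' ht', fun x hx => ?_⟩
  rcases p with _ | ⟨a, p⟩
  · simp at hx
  · simp only [List.head?_cons, Option.some.injEq] at hu'
    subst hu'
    rcases List.mem_cons.1 hx with rfl | hx
    · exact .inl rfl
    · exact .inr (h4 x hx)

/-- A walk that leaves the inner box at once yields a horseshoe arm. -/
theorem Conn.exists_arm {a b r₁ r₂ : ℤ} {S : Set Site} {u u' t : Site} (hu : u ∈ hBoxPlus a b r₁)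
    (huS : u ∈ S) (ht : t ∈ hBoxPlus a b r₂) (ha : Adj u u')
    (h : Conn ((S ∩ hBox a b r₂) \ hBox a b r₁) u' t) :
    ∃ p, HorseArm a b r₁ r₂ p ∧ p.head? = some u ∧ p.getLast? = some t ∧ ∀ x ∈ p, x ∈ S := by
  obtain ⟨p, ⟨h1, h2, h3⟩, h4, h5, h6⟩ := h.exists_path
  refine ⟨u :: p, ⟨⟨by simp, List.nodup_cons.2 ⟨fun hup => (h6 u hup).2 hu.1, h2⟩, ?_⟩, ⟨u, hu, rfl⟩,
    ⟨t, ht, ?_⟩, fun v hv => ⟨(h6 v hv).1.2, (h6 v hv).2⟩⟩, rfl, ?_, ?_⟩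
  · refine List.isChain_cons.2 ⟨fun y hy => ?_, h3⟩
    rw [h4] at hy
    simp only [Option.mem_def, Option.some.injEq] at hy
    rw [← hy]; exact ha
  · rw [List.getLast?_cons, h5]; rfl
  · rw [List.getLast?_cons, h5]; rfl
  · simp only [List.mem_cons, forall_eq_or_imp]; exact ⟨huS, fun x hx => (h6 x hx).1.1⟩

theorem HorseArm.singleton {a b r : ℤ} {t : Site} (ht : t ∈ hBoxPlus a b r) : HorseArm a b r r [t] :=
  ⟨⟨by simp, by simp, List.isChain_singleton _⟩, ⟨t, ht, rfl⟩, ⟨t, ht, rfl⟩, by simp⟩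

/-! ### Invariance of the three-arm event -/

theorem hBox_shift {a b r s t : ℤ} {v : Site} :
    shiftSite (s, t) v ∈ hBox (a + s) (b + t) r ↔ v ∈ hBox a b r := by
  simp only [hBox, Set.mem_ofPred_eq, shiftSite_apply]; omega

theorem hBoxPlus_shift {a b r s t : ℤ} {v : Site} :
    shiftSite (s, t) v ∈ hBoxPlus (a + s) (b + t) r ↔ v ∈ hBoxPlus a b r := by
  simp only [hBoxPlus, hBox, Set.mem_ofPred_eq, shiftSite_apply]; omega

theorem ccw_shift (a b r s t : ℤ) (v : Site) :
    ccw (a + s) (b + t) r (shiftSite (s, t) v) = ccw a b r v := by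
  simp only [ccw, shiftSite_apply]
  grind

theorem HorseArm.shift {a b r₁ r₂ : ℤ} {p : List Site} (h : HorseArm a b r₁ r₂ p) (s t : ℤ) :
    HorseArm (a + s) (b + t) r₁ r₂ (p.map (shiftSite (s, t))) := by
  obtain ⟨⟨h1, h2, h3⟩, ⟨u, hu, hu'⟩, ⟨w, hw, hw'⟩, h4⟩ := h
  refine ⟨⟨by simpa using h1, h2.map (shiftSite (s, t)).injective, ?_⟩,
    ⟨_, hBoxPlus_shift.2 hu, by simp [hu']⟩, ⟨_, hBoxPlus_shift.2 hw, by simp [hw']⟩, ?_⟩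
  · exact (List.isChain_map _).2 (h3.imp fun _ _ => shiftSite_adj _ _ _)
  · intro v hv
    rw [← List.map_tail, List.mem_map] at hv
    obtain ⟨x, hx, rfl⟩ := hv
    exact ⟨hBox_shift.2 (h4 x hx).1, fun h => (h4 x hx).2 (hBox_shift.1 h)⟩

theorem J3.shift {a b r₁ r₂ : ℤ} (s t : ℤ) {ω : Config}
    (h : J3 a b r₁ r₂ (fun v => ω (shiftSite (s, t) v))) : J3 (a + s) (b + t) r₁ r₂ ω := by
  obtain ⟨p, q, p', h1, h2, h3, h4, h5, h6, h7, h8, h9, o1, o2, o3, o4⟩ := h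
  have hd : ∀ {l l' : List Site}, List.Disjoint l l' →
      List.Disjoint (l.map (shiftSite (s, t))) (l'.map (shiftSite (s, t))) := by
    intro l l' h v hv hv'
    rw [List.mem_map] at hv hv'
    obtain ⟨x, hx, rfl⟩ := hv
    obtain ⟨y, hy, hxy⟩ := hv'
    exact h hx ((shiftSite (s, t)).injective hxy ▸ hy)
  refine ⟨_, _, _, h1.shift s t, ?_, h3.shift s t, ?_, h5.shift s t, ?_, hd h7, hd h8, hd h9,
    ?_, ?_, ?_, ?_⟩
  · intro v hv
    rw [List.mem_map] at hv
    obtain ⟨x, hx, rfl⟩ := hv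
    exact h2 x hx
  · intro v hv
    rw [List.mem_map] at hv
    obtain ⟨x, hx, rfl⟩ := hv
    exact h4 x hx
  · intro v hv
    rw [List.mem_map] at hv
    obtain ⟨x, hx, rfl⟩ := hv
    exact h6 x hx
  all_goals
    intro u w hu hw
    simp only [List.head?_map, List.getLast?_map, Option.map_eq_some_iff] at hu hw
    obtain ⟨u, hu, rfl⟩ := hu
    obtain ⟨w, hw, rfl⟩ := hw
    rw [ccw_shift, ccw_shift]
    first
      | exact o1 u w hu hw
      | exact o2 u w hu hw
      | exact o3 u w hu hw
      | exact o4 u w hu hw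

theorem hBox_finite (a b r : ℤ) : (hBox a b r).Finite := rect_finite (a - r) (a + r) b (b + 2 * r)

theorem HorseArm.mem {a b r₁ r₂ : ℤ} {p : List Site} (h : HorseArm a b r₁ r₂ p) {v : Site}
    (hv : v ∈ p) : v ∈ hBox a b r₁ ∪ hBox a b r₂ := by
  obtain ⟨u, t, -, -, hu, -, -, h1⟩ := h.exists_conn
  rcases h1 v hv with rfl | h2
  · exact .inl hu.1
  · exact .inr h2.1

theorem J3.finDep (a b r₁ r₂ : ℤ) : FinDep {ω | J3 a b r₁ r₂ ω} := by
  refine ⟨_, (hBox_finite a b r₁).union (hBox_finite a b r₂), ?_⟩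
  rintro ω ω' h ⟨p, q, p', h1, h2, h3, h4, h5, h6, h7⟩
  exact ⟨p, q, p', h1, fun v hv => by rw [← h v (h1.mem hv)]; exact h2 v hv,
    h3, fun v hv => by rw [← h v (h3.mem hv)]; exact h4 v hv,
    h5, fun v hv => by rw [← h v (h5.mem hv)]; exact h6 v hv, h7⟩

theorem J3.real_eq {μ : Measure Config} (hμ : IsBernoulliHalf μ) (a b r₁ r₂ : ℤ) :
    μ.real {ω | J3 a b r₁ r₂ ω} = μ.real {ω | J3 0 0 r₁ r₂ ω} := by
  apply le_antisymm
  · rw [← hμ.comp_equiv (shiftSite (-a, -b)) (J3.finDep a b r₁ r₂)]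
    refine hμ.real_mono fun ω hω => ?_
    have := J3.shift (-a) (-b) hω
    simpa using this
  · rw [← hμ.comp_equiv (shiftSite (a, b)) (J3.finDep 0 0 r₁ r₂)]
    refine hμ.real_mono fun ω hω => ?_
    have := J3.shift a b hω
    simpa using this

/-! ### Positions of horseshoe arms -/

theorem ccw_eq_perim (a b r : ℤ) (v : Site) :
    ccw a b r v = perim (a - r) (a + r) b (b + 2 * r) v := by
  unfold ccw perim; split_ifs <;> ring

theorem perim_bottom (x₀ x₁ y₀ y₀' y₁ : ℤ) (v : Site) :
    perim x₀ x₁ y₀ y₁ v = perim x₀ x₁ y₀' y₁ v + (y₀' - y₀) := by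
  unfold perim; split_ifs <;> ring

theorem ccw_injOn {a b r : ℤ} {u w : Site} (hu : u ∈ hBoxPlus a b r) (hw : w ∈ hBoxPlus a b r)
    (h : ccw a b r u = ccw a b r w) : u = w := by
  obtain ⟨u1, u2⟩ := u
  obtain ⟨w1, w2⟩ := w
  simp only [hBoxPlus, hBox, Set.mem_ofPred_eq, ccw] at hu hw h
  ext <;> simp only <;> split_ifs at h <;> omega

/-- The boundary arc from the bottom right corner. -/
theorem hBoxPlus_arc_right {a b r : ℤ} (hr : 0 ≤ r) {u : Site} (hu : u ∈ hBoxPlus a b r) :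
    Conn {v | v ∈ hBoxPlus a b r ∧ ccw a b r v ≤ ccw a b r u} (a + r, b) u := by
  obtain ⟨u1, u2⟩ := u
  simp only [hBoxPlus, hBox, Set.mem_ofPred_eq, ccw] at *
  by_cases h1 : u1 = a + r
  · subst h1
    exact .vert _ _ _ fun z h1 h2 => by simp; omega
  by_cases h2 : u2 = b + 2 * r
  · subst h2
    refine (Conn.vert _ _ (b + 2 * r) fun z h3 h4 => ?_).trans (.horiz _ _ _ fun z h3 h4 => ?_)
    · simp; split_ifs; omega
    · simp; split_ifs <;> omega
  · refine ((Conn.vert _ _ (b + 2 * r) fun z h3 h4 => ?_).trans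
      (.horiz _ _ (a - r) fun z h3 h4 => ?_)).trans ?_
    · simp; split_ifs; omega
    · simp; split_ifs <;> omega
    · obtain rfl : u1 = a - r := by omega
      refine Conn.vert _ _ _ fun z h3 h4 => ?_
      simp; split_ifs <;> omega

/-- The boundary arc from the bottom left corner. -/
theorem hBoxPlus_arc_left {a b r : ℤ} (hr : 0 ≤ r) {u : Site} (hu : u ∈ hBoxPlus a b r) :
    Conn {v | v ∈ hBoxPlus a b r ∧ ccw a b r u ≤ ccw a b r v} (a - r, b) u := by
  obtain ⟨u1, u2⟩ := u
  simp only [hBoxPlus, hBox, Set.mem_ofPred_eq, ccw] at *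
  by_cases h1 : u1 = a + r
  · subst h1
    refine ((Conn.vert _ _ (b + 2 * r) fun z h3 h4 => ?_).trans
      (.horiz _ _ (a + r) fun z h3 h4 => ?_)).trans (.vert _ _ _ fun z h3 h4 => ?_)
    all_goals simp; omega
  by_cases h2 : u2 = b + 2 * r
  · subst h2
    refine (Conn.vert _ _ (b + 2 * r) fun z h3 h4 => ?_).trans (.horiz _ _ _ fun z h3 h4 => ?_)
    all_goals simp; split_ifs <;> omega
  · obtain rfl : u1 = a - r := by omega
    refine Conn.vert _ _ _ fun z h3 h4 => ?_
    simp; split_ifs <;> omega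

/-- The order of the ends of disjoint arms determines the order of their starting points. -/
theorem HorseArm.head_lt {a b r R : ℤ} {p q : List Site} (hr : 0 ≤ r) (hrR : r ≤ R)
    (hp : HorseArm a b r R p) (hq : HorseArm a b r R q) (hpq : List.Disjoint p q)
    (hlt : ∀ u w, p.getLast? = some u → q.getLast? = some w → ccw a b R u < ccw a b R w) :
    ∀ u w, p.head? = some u → q.head? = some w → ccw a b r u < ccw a b r w := by
  intro u w hu hw
  obtain ⟨u', s, hu', hs, hub, hsb, hus, hup⟩ := hp.exists_conn
  obtain ⟨w', t, hw', ht, hwb, htb, hwt, hwq⟩ := hq.exists_conn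
  obtain rfl : u' = u := by rw [hu] at hu'; simpa using hu'.symm
  obtain rfl : w' = w := by rw [hw] at hw'; simpa using hw'.symm
  have hst := hlt s t hs ht
  by_contra hcon
  push Not at hcon
  have hne : u' ≠ w' := by
    rintro rfl; exact hpq hus.1 hwt.1
  have hlt' : ccw a b r w' < ccw a b r u' :=
    lt_of_le_of_ne hcon fun h => hne (ccw_injOn hub hwb h.symm)
  have h1 := (hBoxPlus_arc_left hr hub).mono (T := {x | x ∈ p} ∪
    {v | v ∈ hBoxPlus a b r ∧ ccw a b r u' ≤ ccw a b r v}) Set.subset_union_right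
  have h2 := (hBoxPlus_arc_right hr hwb).mono (T := {x | x ∈ q} ∪
    {v | v ∈ hBoxPlus a b r ∧ ccw a b r v ≤ ccw a b r w'}) Set.subset_union_right
  have hsub : hBox a b r ⊆ hBox a b R := by
    intro v hv; simp only [hBox, Set.mem_ofPred_eq] at hv ⊢; omega
  have hbox : hBox a b R = rect (a - R) (a + R) b (b + 2 * R) := rfl
  have := perim_order (x₀ := a - R) (x₁ := a + R) (y₁ := b + 2 * R)
    (h1.trans (hus.mono Set.subset_union_left)) ?_ hsb.2
    (h2.trans (hwt.mono Set.subset_union_left)) ?_ htb.2 ?_ ?_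
  · have h3 := ccw_injOn hub hwb
    omega
  · rw [← hbox]
    rintro v (hv | hv)
    · exact (hp.mem hv).elim (fun h => hsub h) id
    · exact hsub hv.1.1
  · rw [← hbox]
    rintro v (hv | hv)
    · exact (hq.mem hv).elim (fun h => hsub h) id
    · exact hsub hv.1.1
  · rintro v (hv | hv) (hv' | hv')
    · exact hpq hv hv'
    · rcases hup v hv with rfl | h
      · exact absurd hv'.2 (not_le.2 hlt')
      · exact h.2 hv'.1.1
    · rcases hwq v hv' with rfl | h
      · exact absurd hv.2 (not_le.2 hlt')
      · exact h.2 hv.1.1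
    · exact absurd (hv.2.trans hv'.2) (not_le.2 hlt')
  · rwa [← ccw_eq_perim, ← ccw_eq_perim]

/-- A walk from the inner box to the outside of the outer box contains an arm. -/
theorem Conn.exists_horseArm {a b r R : ℤ} {S : Set Site} {u t : Site} (hrR : r ≤ R)
    (hS : ∀ v ∈ S, b ≤ v.2) (hu : u ∈ hBox a b r) (ht : t ∉ hBox a b R) (h : Conn S u t) :
    ∃ p, HorseArm a b r R p ∧ (∀ x ∈ p, x ∈ S) ∧ ∃ t', p.getLast? = some t' ∧
      t' ∈ hBoxPlus a b R ∧ Conn (S ∩ hBox a b R) u t' := by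
  have hsub : hBox a b r ⊆ hBox a b R := by
    intro v hv; simp only [hBox, Set.mem_ofPred_eq] at hv ⊢; omega
  obtain ⟨c, d, huc, hcd, hdS, hd⟩ := h.first_exit (hsub hu) ht
  have hc : c ∈ hBoxPlus a b R := by
    have h1 := huc.right_mem.2
    have h2 := hS d hdS
    refine ⟨h1, ?_⟩
    simp only [hBox, Set.mem_ofPred_eq] at h1 hd
    rw [adj_iff] at hcd
    omega
  by_cases hcr : c ∈ hBox a b r
  · obtain rfl : r = R := by
      simp only [hBox, hBoxPlus, Set.mem_ofPred_eq] at hcr hc; omega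
    exact ⟨[c], .singleton hc, by simpa using huc.right_mem.1, c, rfl, hc, huc⟩
  · obtain ⟨e, f, he, her, hef, hfc⟩ := huc.last_exit hu hcr
    have hep : e ∈ hBoxPlus a b r := by
      have h1 := hfc.1.2
      have h2 := hS f hfc.1.1.1
      refine ⟨her, ?_⟩
      simp only [hBox, Set.mem_ofPred_eq] at h1 her
      rw [adj_iff] at hef
      omega
    obtain ⟨p, h1, h2, h3, h4⟩ := Conn.exists_arm hep he.1 hc hef hfc
    exact ⟨p, h1, h4, c, h3, hc, huc⟩

/-- Three disjoint walks emanating from three consecutive sites yield the three-arm event. -/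
theorem J3.of_conn {ω : Config} {a b r R x h : ℤ} {P K M : Set Site} {p k m m₀ : Site}
    (hr : 0 ≤ r) (hrR : r ≤ R)
    (hP : Conn P (x + 1, h) p) (hK : Conn K (x, h + 1) k) (hM : Conn M m₀ m)
    (hm₀ : m₀ = (x - 1, h) ∨ m₀ = (x - 1, h + 1))
    (hPh : ∀ v ∈ P, h ≤ v.2) (hKh : ∀ v ∈ K, h < v.2) (hMh : ∀ v ∈ M, h ≤ v.2)
    (hPo : ∀ v ∈ P, v ∈ hBox a b R → ω v = true) (hKo : ∀ v ∈ K, v ∈ hBox a b R → ω v = false)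
    (hMo : ∀ v ∈ M, v ∈ hBox a b R → ω v = true)
    (hPK : ∀ v ∈ P, v ∉ K) (hPM : ∀ v ∈ P, v ∉ M) (hKM : ∀ v ∈ K, v ∉ M)
    (hxP : (x, h) ∉ P) (hxM : (x, h) ∉ M)
    (hp : p ∉ hBox a b R) (hk : k ∉ hBox a b R) (hm : m ∉ hBox a b R)
    (h1 : a ≤ x) (h2 : x + 1 ≤ a + r) (h3 : b ≤ h) (h4 : h + 1 ≤ b + 2 * r) : J3 a b r R ω := by
  obtain ⟨lp, p1, p2, p', p3, p4, p5⟩ := hP.exists_horseArm (a := a) (b := b) hrR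
    (fun v hv => h3.trans (hPh v hv)) (by simp only [hBox, Set.mem_ofPred_eq]; omega) hp
  obtain ⟨lk, k1, k2, k', k3, k4, k5⟩ := hK.exists_horseArm (a := a) (b := b) hrR
    (fun v hv => h3.trans (hKh v hv).le) (by simp only [hBox, Set.mem_ofPred_eq]; omega) hk
  obtain ⟨lm, m1, m2, m', m3, m4, m5⟩ := hM.exists_horseArm (a := a) (b := b) hrR
    (fun v hv => h3.trans (hMh v hv))
    (by rcases hm₀ with rfl | rfl <;> simp only [hBox, Set.mem_ofPred_eq] <;> omega) hm
  have hRK : Conn (K ∩ hBox a b R ∪ {(x, h)}) (x, h) k' :=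
    (Conn.of_adj (by simp) (by rw [adj_iff]; simp) (.inl k5.1)).trans (k5.mono Set.subset_union_left)
  have hRM : Conn (M ∩ hBox a b R ∪ {(x - 1, h)}) (x - 1, h) m' := by
    rcases hm₀ with rfl | rfl
    · exact m5.mono Set.subset_union_left
    · exact (Conn.of_adj (by simp) (by rw [adj_iff]; simp) (.inl m5.1)).trans
        (m5.mono Set.subset_union_left)
  have hkr : K ∩ hBox a b R ∪ {(x, h)} ⊆ rect (a - R) (a + R) h (b + 2 * R) := by
    rintro v (hv | rfl)
    · exact ⟨hv.2.1, hv.2.2.1, (hKh v hv.1).le, hv.2.2.2.2⟩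
    · rw [mem_rect]; simp only; omega
  have o1 : ∀ u w, lp.getLast? = some u → lk.getLast? = some w → ccw a b R u < ccw a b R w := by
    intro u w hu hw
    obtain rfl : p' = u := by rw [hu] at p3; simpa using p3.symm
    obtain rfl : k' = w := by rw [hw] at k3; simpa using k3.symm
    by_contra hcon
    have hne : ccw a b R p' ≠ ccw a b R k' := fun hh => by
      have := ccw_injOn p4 k4 hh
      exact hPK _ p5.right_mem.1 (this ▸ k5.right_mem.1)
    have := perim_order hRK hkr k4.2 p5 ?_ p4.2 ?_ ?_
    · omega
    · exact fun v hv => ⟨hv.2.1, hv.2.2.1, hPh v hv.1, hv.2.2.2.2⟩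
    · rintro v (hv | rfl) hv'
      · exact hPK v hv'.1 hv.1
      · exact hxP hv'.1
    · rw [ccw_eq_perim, ccw_eq_perim, perim_bottom _ _ _ h, perim_bottom _ _ _ h _ k'] at hne hcon
      omega
  have o2 : ∀ u w, lk.getLast? = some u → lm.getLast? = some w → ccw a b R u < ccw a b R w := by
    intro u w hu hw
    obtain rfl : k' = u := by rw [hu] at k3; simpa using k3.symm
    obtain rfl : m' = w := by rw [hw] at m3; simpa using m3.symm
    by_contra hcon
    have hne : ccw a b R k' ≠ ccw a b R m' := fun hh => by
      have := ccw_injOn k4 m4 hh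
      exact hKM _ k5.right_mem.1 (this ▸ m5.right_mem.1)
    have := perim_order hRM ?_ m4.2 hRK hkr k4.2 ?_ ?_
    · omega
    · rintro v (hv | rfl)
      · exact ⟨hv.2.1, hv.2.2.1, hMh v hv.1, hv.2.2.2.2⟩
      · rw [mem_rect]; simp only; omega
    · rintro v (hv | rfl) (hv' | hv')
      · exact hKM v hv'.1 hv.1
      · rw [hv'] at hv; exact hxM hv.1
      · exact absurd (hKh _ hv'.1) (lt_irrefl _)
      · simp only [Set.mem_singleton_iff, Prod.mk.injEq] at hv'; omega
    · rw [ccw_eq_perim, ccw_eq_perim, perim_bottom _ _ _ h, perim_bottom _ _ _ h _ m'] at hne hcon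
      omega
  have d1 : List.Disjoint lp lk := fun v h h' => hPK v (p2 v h) (k2 v h')
  have d2 : List.Disjoint lp lm := fun v h h' => hPM v (p2 v h) (m2 v h')
  have d3 : List.Disjoint lk lm := fun v h h' => hKM v (k2 v h) (m2 v h')
  have hb : hBox a b r ⊆ hBox a b R := by
    intro v hv; simp only [hBox, Set.mem_ofPred_eq] at hv ⊢; omega
  have hmem : ∀ {l : List Site}, HorseArm a b r R l → ∀ v ∈ l, v ∈ hBox a b R := fun hl v hv =>
    (hl.mem hv).elim (fun h => hb h) id
  exact ⟨lp, lk, lm, p1, fun v hv => hPo v (p2 v hv) (hmem p1 v hv), k1,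
    fun v hv => hKo v (k2 v hv) (hmem k1 v hv), m1, fun v hv => hMo v (m2 v hv) (hmem m1 v hv),
    d1, d2, d3, p1.head_lt hr hrR k1 d1 o1, o1, k1.head_lt hr hrR m1 d3 o2, o2⟩

/-! ### The lower bound -/

/-- Around the lowest point of a large closed cluster one sees three arms. -/
theorem exists_J3_of_crossings {ω : Config} {R r : ℤ} (hr : 1 ≤ r) (hrR : r ≤ R)
    (ho1 : ω ∈ VC true (-3 * R) (-2 * R) 0 (4 * R)) (ho2 : ω ∈ HC true (-3 * R) (3 * R) 0 R)
    (ho3 : ω ∈ VC true (2 * R) (3 * R) 0 (4 * R)) (hc : ω ∈ VC false 0 R (R + 1) (4 * R)) :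
    ∃ x h : ℤ, -3 * R < x ∧ x < 3 * R ∧ 0 ≤ h ∧ h ≤ R ∧ J3 (r * (x / r)) (r * (h / r)) r R ω := by
  obtain ⟨s₀, hs₀, t₀, ht₀, hst⟩ := hc
  replace hs₀ : s₀.2 = R + 1 := hs₀
  replace ht₀ : t₀.2 = 4 * R := ht₀
  have ht₀r := hst.right_mem.2
  rw [mem_rect] at ht₀r
  set D := rect (-6 * R) (6 * R) 0 (4 * R) with hD
  set K : Set Site := {v | Conn ({v | ω v = false} ∩ D) t₀ v} with hK
  have hst' : Conn ({v | ω v = false} ∩ D) t₀ s₀ := hst.symm.mono (by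
    rintro v ⟨hv, hv'⟩
    rw [mem_rect] at hv'
    exact ⟨hv, by rw [hD, mem_rect]; omega⟩)
  have hKD : ∀ v ∈ K, ω v = false ∧ v ∈ D := fun v hv => Conn.right_mem hv
  have hcol : ∀ {v : Site}, ω v = true → ω v = false → False := by
    intro v h1 h2; rw [h1] at h2; simp at h2
  have hKl : ∀ v ∈ K, -3 * R < v.1 := by
    intro v hv
    by_contra hcon
    obtain ⟨a', b', ha, hb, hab⟩ := (Conn.symm hv).sub_horiz (x₀ := -3 * R) (x₁ := -2 * R)
      (by omega) (by omega) (by omega)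
    obtain ⟨e, he, f, hf, hef⟩ := ho1
    obtain ⟨z, hz, hz'⟩ := rect_cross (x₀ := -3 * R) (x₁ := -2 * R) (y₀ := 0) (y₁ := 4 * R) hab
      (by rintro z ⟨⟨-, hz⟩, hz1, hz2⟩; rw [hD, mem_rect] at hz; rw [mem_rect]; omega) ha hb hef
      (fun z hz => hz.2) he hf
    exact hcol hz'.1 hz.1.1
  have hKr : ∀ v ∈ K, v.1 < 3 * R := by
    intro v hv
    by_contra hcon
    obtain ⟨a', b', ha, hb, hab⟩ := Conn.sub_horiz hv (x₀ := 2 * R) (x₁ := 3 * R)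
      (by omega) (by omega) (by omega)
    obtain ⟨e, he, f, hf, hef⟩ := ho3
    obtain ⟨z, hz, hz'⟩ := rect_cross (x₀ := 2 * R) (x₁ := 3 * R) (y₀ := 0) (y₁ := 4 * R) hab
      (by rintro z ⟨⟨-, hz⟩, hz1, hz2⟩; rw [hD, mem_rect] at hz; rw [mem_rect]; omega) ha hb hef
      (fun z hz => hz.2) he hf
    exact hcol hz'.1 hz.1.1
  have hKb : ∀ v ∈ K, 0 < v.2 := by
    intro v hv
    by_contra hcon
    obtain ⟨a', b', ha, hb, hab⟩ := (Conn.within_cluster hv).symm.sub_vert (y₀ := 0) (y₁ := R)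
      (by omega) (by omega) (by omega)
    obtain ⟨e, he, f, hf, hef⟩ := ho2
    obtain ⟨z, hz, hz'⟩ := rect_cross (x₀ := -3 * R) (x₁ := 3 * R) (y₀ := 0) (y₁ := R) hef
      (fun z hz => hz.2) he hf hab
      (by
        rintro z ⟨hz, hz1, hz2⟩
        have h1 := hKl z hz
        have h2 := hKr z hz
        rw [mem_rect]; omega) ha hb
    exact hcol hz.1 (hKD z hz'.1).1
  obtain ⟨⟨x, y⟩, hu, humin⟩ := Set.exists_min_image K (fun v => v.2)
    ((rect_finite _ _ _ _).subset fun v hv => (hKD v hv).2) ⟨s₀, hst'⟩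
  obtain ⟨h, rfl⟩ : ∃ h, y = h + 1 := ⟨y - 1, by ring⟩
  simp only at humin
  have hxl := hKl _ hu
  have hxr := hKr _ hu
  have hh0 := hKb _ hu
  have hhR := humin s₀ hst'
  simp only at hxl hxr hh0
  -- the boundary of the cluster
  set K' : Set Site := K ∪ {v | v.2 = 4 * R + 1} with hK'
  set X : Set Site := {v | v ∉ K' ∧ ∃ w ∈ K', Adj v w} with hX
  obtain ⟨a, b, ha, hb, hab⟩ : ∃ a b, a.1 = -6 * R ∧ b.1 = 6 * R ∧
      Conn (X ∩ rect (-6 * R) (6 * R) 0 (4 * R + 1)) a b := by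
    refine (hex X (by omega) (by omega)).resolve_right ?_
    rintro ⟨a, b, ha, hb, hab⟩
    obtain ⟨c, d, hac, hcd, -, hd⟩ := hab.first_exit (M := K'ᶜ)
      (by
        rintro (h1 | h1)
        · have := hKb a h1; omega
        · simp only [Set.mem_ofPred_eq] at h1; omega)
      (by simp only [Set.mem_compl_iff, not_not]; exact .inr hb)
    exact hac.right_mem.1.2 ⟨hac.right_mem.2, d, Set.notMem_compl_iff.1 hd, hcd⟩
  have hXp : ∀ v ∈ X ∩ rect (-6 * R) (6 * R) 0 (4 * R + 1), v ∉ K ∧ v ∈ rect (-6 * R) (6 * R) h (4 * R) ∧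
      (v.2 < 4 * R → ω v = true) := by
    rintro v ⟨⟨hv1, w, hw, hvw⟩, hvr⟩
    have h1 : v ∉ K := fun hh => hv1 (.inl hh)
    have h2 : v.2 ≠ 4 * R + 1 := fun hh => hv1 (.inr hh)
    rw [mem_rect] at hvr
    have h3 : v.2 < 4 * R → w ∈ K := by
      intro hlt
      refine hw.resolve_right fun (hw : w.2 = 4 * R + 1) => ?_
      rw [adj_iff] at hvw; omega
    refine ⟨h1, ?_, fun hlt => ?_⟩
    · rw [mem_rect]
      refine ⟨hvr.1, hvr.2.1, ?_, by omega⟩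
      by_contra hcon
      have := humin w (h3 (by omega))
      rw [adj_iff] at hvw; omega
    · by_contra hcon
      refine h1 (Conn.tail (h3 hlt) hvw.symm ⟨by simpa using hcon, ?_⟩)
      rw [hD, mem_rect]; omega
  obtain ⟨l, ⟨hl1, hl2, hl3⟩, hl4, hl5, hl6⟩ := hab.exists_path
  replace hl6 := fun v hv => hXp v (hl6 v hv)
  have hwl : ((x, h) : Site) ∈ l := by
    have hQ : Conn ({v | v.1 = x ∧ 0 ≤ v.2 ∧ v.2 ≤ h} ∪ K ∪ {(t₀.1, 4 * R + 1)}) (x, 0)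
        (t₀.1, 4 * R + 1) := by
      have e1 : Conn ({v | v.1 = x ∧ 0 ≤ v.2 ∧ v.2 ≤ h} ∪ K ∪ {(t₀.1, 4 * R + 1)}) (x, 0) (x, h) :=
        .vert _ _ _ fun z h1 h2 => .inl (.inl ⟨rfl, by simp only; omega, by simp only; omega⟩)
      have e2 : Conn ({v | v.1 = x ∧ 0 ≤ v.2 ∧ v.2 ≤ h} ∪ K ∪ {(t₀.1, 4 * R + 1)}) (x, h + 1) t₀ :=
        (Conn.within_cluster hu).symm.mono fun v hv => .inl (.inr hv)
      refine ((e1.tail ?_ e2.1).trans e2).tail ?_ (.inr rfl)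
      · rw [adj_iff]; simp
      · rw [adj_iff]; simp; omega
    have hlr : {v | v ∈ l} ⊆ rect (-6 * R) (6 * R) 0 (4 * R + 1) := by
      intro z hz
      have := (hl6 z hz).2.1
      rw [mem_rect] at this ⊢; omega
    obtain ⟨z, hz, hz'⟩ := rect_cross (Conn.of_chain hl3 hl4 hl5) hlr ha hb hQ (by
      rintro z ((hz | hz) | rfl)
      · simp only [Set.mem_ofPred_eq] at hz; rw [mem_rect]; omega
      · have := (hKD z hz).2
        rw [hD, mem_rect] at this; rw [mem_rect]; omega
      · rw [mem_rect]; simp only; omega) rfl rfl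
    have h1 := hl6 z hz
    rw [mem_rect] at h1
    rcases hz' with (hz' | hz') | hz'
    · have : z = (x, h) := by ext; exacts [hz'.1, by have := hz'.2.2; simp only; omega]
      exact this ▸ hz
    · exact absurd hz' h1.1
    · rw [hz'] at h1; simp only at h1; omega
  obtain ⟨s, t, rfl⟩ := List.append_of_mem hwl
  rw [List.nodup_append] at hl2
  obtain ⟨hs2, ht2, hd2⟩ := hl2
  rw [List.nodup_cons] at ht2
  obtain ⟨hs3, ht3, hst3⟩ := List.isChain_append.1 hl3
  rw [List.isChain_cons] at ht3
  have hnb : ∀ v ∈ s ++ (x, h) :: t, Adj (x, h) v →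
      v = (x + 1, h) ∨ v = (x - 1, h) ∨ v = (x - 1, h + 1) := by
    rintro ⟨v1, v2⟩ hv hav
    have h1 := hl6 _ hv
    have h2 : ((v1, v2) : Site) ≠ (x, h + 1) := fun e => h1.1 (e ▸ hu)
    have h3 := h1.2.1
    rw [mem_rect] at h3
    rw [adj_iff] at hav
    simp only [ne_eq, Prod.mk.injEq] at *
    omega
  -- the part to the right
  obtain ⟨p₀, t', rfl⟩ : ∃ p₀ t', t = p₀ :: t' := by
    rcases t with _ | ⟨p₀, t'⟩
    · simp at hl5
      rw [← hl5] at hb; simp only at hb; omega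
    · exact ⟨_, _, rfl⟩
  have hP : Conn {v | v ∈ p₀ :: t'} p₀ b := Conn.of_chain ht3.2 rfl (by simpa using hl5)
  have hM' : ∃ m₀, s.getLast? = some m₀ ∧ Conn {v | v ∈ s} m₀ a := by
    rcases hs : s.getLast? with _ | m₀
    · rw [List.getLast?_eq_none_iff] at hs
      rw [hs] at hl4
      simp only [List.nil_append, List.head?_cons, Option.some.injEq] at hl4
      rw [← hl4] at ha; simp only at ha; omega
    · refine ⟨m₀, rfl, (Conn.of_chain hs3 ?_ hs).symm⟩
      rcases s with _ | ⟨s1, s⟩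
      · simp at hs
      · simpa using hl4
  obtain ⟨m₀, hm₀, hM⟩ := hM'
  have hp₀ : p₀ = (x + 1, h) := by
    have h1 := hnb p₀ (by simp) (ht3.1 p₀ (by simp))
    refine h1.resolve_right fun h1 => ?_
    have hP' : Conn ({v | v ∈ p₀ :: t'} ∪ {(x - 1, h)}) (x - 1, h) b := by
      rcases h1 with rfl | rfl
      · exact hP.mono Set.subset_union_left
      · exact (Conn.of_adj (.inr rfl) (by rw [adj_iff]; simp) (.inl hP.1)).trans
          (hP.mono Set.subset_union_left)
    have hK1 : Conn (K ∪ {(x, h)}) (x, h) t₀ :=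
      (Conn.of_adj (.inr rfl) (by rw [adj_iff]; simp) (.inl hu)).trans
        ((Conn.within_cluster hu).symm.mono Set.subset_union_left)
    have hbr := (hl6 b (by
      have := hP.right_mem
      simp only [Set.mem_ofPred_eq] at this
      simp only [List.mem_append, List.mem_cons] at this ⊢; tauto)).2.1
    rw [mem_rect] at hbr
    have := perim_order (x₀ := -6 * R) (x₁ := 6 * R) (y₁ := 4 * R) hP' ?_ (.inr (.inl hb)) hK1 ?_
      (.inr (.inr ht₀)) ?_ ?_
    · omega
    · rintro v (hv | rfl)
      · exact (hl6 v (List.mem_append_right _ (List.mem_cons_of_mem _ hv))).2.1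
      · rw [mem_rect]; simp only; omega
    · rintro v (hv | rfl)
      · have h2 := (hKD v hv).2
        have h3 := humin v hv
        rw [hD, mem_rect] at h2
        rw [mem_rect]; omega
      · rw [mem_rect]; simp only; omega
    · rintro v (hv | rfl) (hv' | hv')
      · exact (hl6 v (List.mem_append_right _ (List.mem_cons_of_mem _ hv))).1 hv'
      · rw [hv'] at hv; exact ht2.1 hv
      · have := humin _ hv'; simp only at this; omega
      · simp only [Set.mem_singleton_iff, Prod.mk.injEq] at hv'; omega
    · unfold perim
      rw [if_pos hb, if_neg (by omega), if_pos ht₀]; omega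
  have hm₀s : m₀ ∈ s := List.mem_of_getLast? hm₀
  have hm₀' : m₀ = (x - 1, h) ∨ m₀ = (x - 1, h + 1) := by
    refine (hnb m₀ (by simp [hm₀s]) (Adj.symm (hst3 m₀ hm₀ _ rfl))).resolve_left fun e => ?_
    exact hd2 m₀ hm₀s p₀ (by simp) (by rw [e, hp₀])
  subst hp₀
  have hlP : ∀ v ∈ (x + 1, h) :: t', v ∈ s ++ (x, h) :: (x + 1, h) :: t' := fun v hv =>
    List.mem_append_right _ (List.mem_cons_of_mem _ hv)
  have hlM : ∀ v ∈ s, v ∈ s ++ (x, h) :: (x + 1, h) :: t' := fun v hv => List.mem_append_left _ hv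
  have e1 := Int.emod_add_mul_ediv x r
  have e2 := Int.emod_nonneg x (by omega : r ≠ 0)
  have e3 := Int.emod_lt_of_pos x (by omega : 0 < r)
  have f1 := Int.emod_add_mul_ediv h r
  have f2 := Int.emod_nonneg h (by omega : r ≠ 0)
  have f3 := Int.emod_lt_of_pos h (by omega : 0 < r)
  refine ⟨x, h, hxl, hxr, by omega, by omega, ?_⟩
  generalize r * (x / r) = A at *
  generalize r * (h / r) = B at *
  have hlow : ∀ v ∈ hBox A B R, v.2 < 4 * R := by
    intro v hv
    have := hv.2.2.2
    omega
  refine J3.of_conn (by omega) hrR hP (Conn.within_cluster hu).symm hM hm₀' (P := {v | v ∈ (x + 1, h) :: t'})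
    (K := K) (M := {v | v ∈ s}) ?_ ?_ ?_ ?_ ?_ ?_ ?_ ?_ ?_ ?_ ?_ ?_ ?_ ?_ ?_ ?_ ?_ ?_
  · intro v hv; exact (hl6 v (hlP v hv)).2.1.2.2.1
  · intro v hv; have := humin v hv; omega
  · intro v hv; exact (hl6 v (hlM v hv)).2.1.2.2.1
  · intro v hv hv'; exact (hl6 v (hlP v hv)).2.2 (hlow v hv')
  · intro v hv _; exact (hKD v hv).1
  · intro v hv hv'; exact (hl6 v (hlM v hv)).2.2 (hlow v hv')
  · intro v hv; exact (hl6 v (hlP v hv)).1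
  · intro v hv hv'; exact hd2 v hv' v (List.mem_cons_of_mem _ hv) rfl
  · intro v hv hv'; exact (hl6 v (hlM v hv')).1 hv
  · exact ht2.1
  · intro hv; exact hd2 _ hv _ List.mem_cons_self rfl
  · simp only [hBox, Set.mem_ofPred_eq]; omega
  · intro h1; have := hlow _ h1; omega
  · simp only [hBox, Set.mem_ofPred_eq]; omega
  all_goals omega

theorem HC.isUpperSet (x₀ x₁ y₀ y₁ : ℤ) : IsUpperSet (HC true x₀ x₁ y₀ y₁) := ConnEv.isUpperSet ..

theorem VC.isUpperSet (x₀ x₁ y₀ y₁ : ℤ) : IsUpperSet (VC true x₀ x₁ y₀ y₁) := ConnEv.isUpperSet ..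

theorem HC.isLowerSet (x₀ x₁ y₀ y₁ : ℤ) : IsLowerSet (HC false x₀ x₁ y₀ y₁) := ConnEv.isLowerSet ..

theorem VC.isLowerSet (x₀ x₁ y₀ y₁ : ℤ) : IsLowerSet (VC false x₀ x₁ y₀ y₁) := ConnEv.isLowerSet ..

theorem HC.depOn (c : Bool) (x₀ x₁ y₀ y₁ : ℤ) : DepOn (rect x₀ x₁ y₀ y₁) (HC c x₀ x₁ y₀ y₁) :=
  ConnEv.depOn _ _ _ _

theorem VC.depOn (c : Bool) (x₀ x₁ y₀ y₁ : ℤ) : DepOn (rect x₀ x₁ y₀ y₁) (VC c x₀ x₁ y₀ y₁) :=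
  ConnEv.depOn _ _ _ _

theorem crossings_ge {μ : Measure Config} (hμ : IsBernoulliHalf μ) {R : ℤ} (hR : 1 ≤ R) :
    rsw ^ 4 ≤ μ.real (((VC true (-3 * R) (-2 * R) 0 (4 * R) ∩ HC true (-3 * R) (3 * R) 0 R) ∩
      VC true (2 * R) (3 * R) 0 (4 * R)) ∩ VC false 0 R (R + 1) (4 * R)) := by
  have h1 := VC.ge hμ true (x₀ := -3 * R) (x₁ := -2 * R) (y₀ := 0) (y₁ := 4 * R)
    (by omega) (by omega) (by omega)
  have h2 := HC.ge hμ true (x₀ := -3 * R) (x₁ := 3 * R) (y₀ := 0) (y₁ := R)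
    (by omega) (by omega) (by omega)
  have h3 := VC.ge hμ true (x₀ := 2 * R) (x₁ := 3 * R) (y₀ := 0) (y₁ := 4 * R)
    (by omega) (by omega) (by omega)
  have h4 := VC.ge hμ false (x₀ := 0) (x₁ := R) (y₀ := R + 1) (y₁ := 4 * R)
    (by omega) (by omega) (by omega)
  have h12 := hμ.fkg (VC.finDep true (-3 * R) (-2 * R) 0 (4 * R)) (HC.finDep true (-3 * R) (3 * R) 0 R)
    (VC.isUpperSet ..) (HC.isUpperSet ..)
  have h123 := hμ.fkg ((VC.finDep true (-3 * R) (-2 * R) 0 (4 * R)).inter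
    (HC.finDep true (-3 * R) (3 * R) 0 R)) (VC.finDep true (2 * R) (3 * R) 0 (4 * R))
    ((VC.isUpperSet ..).inter (HC.isUpperSet ..)) (VC.isUpperSet ..)
  have hind := hμ.indep (((rect_finite (-3 * R) (-2 * R) 0 (4 * R)).union
    (rect_finite (-3 * R) (3 * R) 0 R)).union (rect_finite (2 * R) (3 * R) 0 (4 * R)))
    (rect_finite 0 R (R + 1) (4 * R))
    ((((VC.depOn true _ _ _ _).mono (fun v hv => .inl (.inl hv))).inter
      ((HC.depOn true _ _ _ _).mono (fun v hv => .inl (.inr hv)))).inter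
      ((VC.depOn true _ _ _ _).mono (fun v hv => .inr hv))) (VC.depOn false _ _ _ _)
    (Set.disjoint_left.2 (by
      rintro v ((hv | hv) | hv) hv' <;> rw [mem_rect] at hv hv' <;> omega))
  have hp := rsw_pos
  calc rsw ^ 4 = ((rsw * rsw) * rsw) * rsw := by ring
    _ ≤ _ := ?_
  refine le_trans ?_ hind
  gcongr
  refine le_trans ?_ h123
  gcongr
  exact le_trans (by gcongr) h12

/-- The lower bound for the probability of the three-arm event. -/
theorem J3.ge {μ : Measure Config} (hμ : IsBernoulliHalf μ) (a b : ℤ) {r n : ℤ} (hr : 1 ≤ r)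
    (hn : 1 ≤ n) : rsw ^ 4 ≤ 14 * (n : ℝ) ^ 2 * μ.real {ω | J3 a b r (r * n) ω} := by
  have hμ1 := hμ.1
  set R := r * n with hR
  have hrR : r ≤ R := by rw [hR]; nlinarith
  refine (crossings_ge hμ (R := R) (by omega)).trans ?_
  set I := Finset.Icc (-3 * n) (3 * n) ×ˢ Finset.Icc 0 n with hI
  have hsub : ((VC true (-3 * R) (-2 * R) 0 (4 * R) ∩ HC true (-3 * R) (3 * R) 0 R) ∩
      VC true (2 * R) (3 * R) 0 (4 * R)) ∩ VC false 0 R (R + 1) (4 * R) ⊆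
      ⋃ i ∈ I, {ω | J3 (r * i.1) (r * i.2) r R ω} := by
    rintro ω ⟨⟨⟨h1, h2⟩, h3⟩, h4⟩
    obtain ⟨x, h, hx1, hx2, hh1, hh2, hJ⟩ := exists_J3_of_crossings hr hrR h1 h2 h3 h4
    simp only [Set.mem_iUnion]
    refine ⟨(x / r, h / r), ?_, hJ⟩
    have hr0 : 0 < r := by omega
    rw [hI, Finset.mem_product, Finset.mem_Icc, Finset.mem_Icc]
    refine ⟨⟨?_, ?_⟩, ?_, ?_⟩
    · rw [Int.le_ediv_iff_mul_le hr0]; nlinarith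
    · rw [← Int.lt_add_one_iff, Int.ediv_lt_iff_lt_mul hr0]; nlinarith
    · exact Int.ediv_nonneg hh1 hr0.le
    · rw [← Int.lt_add_one_iff, Int.ediv_lt_iff_lt_mul hr0]; nlinarith
  have hcard : (I.card : ℝ) ≤ 14 * (n : ℝ) ^ 2 := by
    have h1 : (I.card : ℤ) = (6 * n + 1) * (n + 1) := by
      rw [hI, Finset.card_product, Int.card_Icc, Int.card_Icc]; push_cast
      rw [Int.toNat_of_nonneg (by omega), Int.toNat_of_nonneg (by omega)]; ring
    have h2 : (I.card : ℤ) ≤ 14 * n ^ 2 := by rw [h1]; nlinarith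
    exact_mod_cast h2
  calc _ ≤ μ.real (⋃ i ∈ I, {ω | J3 (r * i.1) (r * i.2) r R ω}) := hμ.real_mono hsub
    _ ≤ ∑ i ∈ I, μ.real {ω | J3 (r * i.1) (r * i.2) r R ω} := measureReal_biUnion_finset_le _ _
    _ = I.card * μ.real {ω | J3 a b r R ω} := by
      rw [Finset.sum_congr rfl fun i _ => (J3.real_eq hμ _ _ r R).trans (J3.real_eq hμ a b r R).symm]
      simp
    _ ≤ _ := by gcongr

/-! ### Separation -/

/-- Exchanging the roles of the two sides: if the sites reached from `B` by a closed and then an open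
walk are not reached from `C` by a closed walk, then the same holds with `B` and `C` exchanged. -/
theorem Reach.separation_symm {B C D : Set Site} {ω : Config} (hC : C ⊆ D)
    (h : ∀ v, Reach {u | Reach B D {w | ω w = false} u} D {w | ω w = true} v →
      ¬ Reach C D {w | ω w = false} v) {v : Site}
    (hv : Reach {u | Reach C D {w | ω w = false} u} D {w | ω w = true} v) :
    ¬ Reach B D {w | ω w = false} v := by
  have hD : ∀ {u}, Reach {u | Reach C D {w | ω w = false} u} D {w | ω w = true} u → u ∈ D := by
    intro u hu
    rcases hu.mem with h1 | h1
    · exact (Reach.mem h1).elim (fun h => hC h) id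
    · exact h1
  have key : ∀ {u}, Reach {u | Reach C D {w | ω w = false} u} D {w | ω w = true} u → ω u = true →
      ¬ Reach {u | Reach B D {w | ω w = false} u} D {w | ω w = true} u := by
    intro u hu
    induction hu with
    | base h1 => exact fun _ h2 => h _ h2 h1
    | @step u w hu h1 h2 h3 ih =>
      intro h4 h5
      exact ih h1 (.step h5 h4 h2.symm (hD hu))
  intro hB
  cases hv with
  | base h1 => exact h v (.base hB) h1
  | @step u _ hu h1 h2 h3 =>
    rcases hb : ω v with _ | _
    · exact key hu h1 (Reach.base (show Reach B D {w | ω w = false} u from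
        Reach.step hB hb h2.symm (hD hu)))
    · exact key (.step hu h1 h2 h3) hb (.base hB)

/-- The horseshoe between the boxes of radii `r` and `R`. -/
def horseshoe (r R : ℤ) : Set Site := hBox 0 0 R \ hBox 0 0 r

/-- The right (`s = 1`) or left (`s = -1`) part of the bottom side of the horseshoe. -/
def foot (r R s : ℤ) : Set Site := {v | v.2 = 0 ∧ r < s * v.1 ∧ s * v.1 ≤ R}

/-- The sites reached from a foot by closed sites. -/
def closedHull (r R s : ℤ) (ω : Config) : Set Site :=
  {v | Reach (foot r R s) (horseshoe r R) {v | ω v = false} v}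

/-- The sites reached from a foot by closed and then open sites. -/
def openHull (r R s : ℤ) (ω : Config) : Set Site :=
  {v | Reach (closedHull r R s ω) (horseshoe r R) {v | ω v = true} v}

/-- The feet are separated by three arms. -/
def Separated (r R : ℤ) (ω : Config) : Prop :=
  ∀ v ∈ openHull r R 1 ω, v ∉ closedHull r R (-1) ω

theorem foot_subset {r R s : ℤ} (hr : 0 ≤ r) (hs : s = 1 ∨ s = -1) :
    foot r R s ⊆ horseshoe r R := by
  intro v hv
  simp only [foot, horseshoe, hBox, Set.mem_sdiff, Set.mem_ofPred_eq] at hv ⊢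
  rcases hs with rfl | rfl <;> omega

theorem Separated.symm {r R : ℤ} {ω : Config} (hr : 0 ≤ r) (h : Separated r R ω) :
    ∀ v ∈ openHull r R (-1) ω, v ∉ closedHull r R 1 ω := fun _ hv =>
  Reach.separation_symm (foot_subset hr (.inr rfl)) h hv

theorem closedHull_subset {r R s : ℤ} (hr : 0 ≤ r) (hs : s = 1 ∨ s = -1) (ω : Config) :
    closedHull r R s ω ⊆ horseshoe r R := fun _ hv =>
  (Reach.mem hv).elim (fun h => foot_subset hr hs h) id

theorem openHull_subset {r R s : ℤ} (hr : 0 ≤ r) (hs : s = 1 ∨ s = -1) (ω : Config) :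
    openHull r R s ω ⊆ horseshoe r R := fun _ hv =>
  (Reach.mem hv).elim (fun h => closedHull_subset hr hs ω h) id

/-- A site reached by closed sites is connected to the foot by closed sites, except for itself. -/
theorem closedHull_conn {r R s : ℤ} {ω : Config} {v : Site}
    (hv : v ∈ closedHull r R s ω) : ∃ x : ℤ, r < s * x ∧
      Conn (closedHull r R s ω ∩ ({w | ω w = false} ∪ {v})) (x, 0) v := by
  rcases Reach.exists_conn hv with h | ⟨⟨x, y⟩, h1, -, u, h2, h3, h4⟩
  · obtain ⟨x, y⟩ := v
    obtain ⟨rfl, h1, -⟩ : y = 0 ∧ r < s * x ∧ s * x ≤ R := h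
    refine ⟨x, h1, Conn.refl ?_⟩
    exact ⟨hv, Or.inr rfl⟩
  · obtain ⟨rfl, h1, -⟩ : y = 0 ∧ r < s * x ∧ s * x ≤ R := h1
    have h5 := h2.mono (T := closedHull r R s ω ∩ ({w | ω w = false} ∪ {v})) fun w hw =>
      ⟨hw.1.1, .inl hw.1.2⟩
    exact ⟨x, h1, h5.tail h3 ⟨hv, .inr rfl⟩⟩

theorem horseshoe_subset_rect (r R : ℤ) : horseshoe r R ⊆ rect (0 - R) (0 + R) 0 (0 + 2 * R) :=
  fun _ hv => hv.1

theorem J3.separated {r R : ℤ} (hr : 0 ≤ r) (hrR : r ≤ R) {ω : Config} (h : J3 0 0 r R ω) :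
    Separated r R ω := by
  obtain ⟨p, q, p', p1, p2, q1, q2, p1', p2', d1, -, d2, o1, o2, o3, o4⟩ := h
  have hsub : hBox 0 0 r ⊆ hBox 0 0 R := by
    intro v hv; simp only [hBox, Set.mem_ofPred_eq] at hv ⊢; omega
  have hmem : ∀ {l : List Site}, HorseArm 0 0 r R l → ∀ v ∈ l, v ∈ hBox 0 0 R := fun hl v hv =>
    (hl.mem hv).elim (fun h => hsub h) id
  have hcol : ∀ {v : Site}, ω v = true → ω v = false → False := by
    intro v h1 h2; rw [h1] at h2; simp at h2
  obtain ⟨u, s, hu, hs, hub, hsb, hus, hup⟩ := p1.exists_conn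
  obtain ⟨w, t, hw, ht, hwb, htb, hwt, hwq⟩ := q1.exists_conn
  obtain ⟨u', s', hu', hs', hub', hsb', hus', hup'⟩ := p1'.exists_conn
  replace o1 := o1 u w hu hw
  replace o2 := o2 s t hs ht
  replace o3 := o3 w u' hw hu'
  replace o4 := o4 t s' ht hs'
  rw [ccw_eq_perim, ccw_eq_perim] at o2 o4
  have hQ : ∀ z ∈ q, Conn {x | x ∈ q} z t := by
    intro z hz
    obtain ⟨l₁, l₂, rfl⟩ := List.append_of_mem hz
    have h1 := (List.isChain_append.1 q1.1.2.2).2.1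
    refine (Conn.of_chain h1 rfl (by simpa using ht)).mono fun x hx => List.mem_append_right _ hx
  -- the closed arm is not reached from the right
  have hR : ∀ v ∈ closedHull r R 1 ω, v ∉ q := by
    intro v hv hvq
    obtain ⟨x, hx, hc⟩ := closedHull_conn hv
    have hA := (hBoxPlus_arc_right hr hub).mono (T := {x | x ∈ p} ∪
      {v | v ∈ hBoxPlus 0 0 r ∧ ccw 0 0 r v ≤ ccw 0 0 r u}) Set.subset_union_right
    have hB := (hc.mono (T := closedHull r R 1 ω ∩ ({w | ω w = false} ∪ {v}) ∪ {x | x ∈ q})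
      Set.subset_union_left).trans ((hQ v hvq).mono Set.subset_union_right)
    have := perim_order (hA.trans (hus.mono Set.subset_union_left)) ?_ hsb.2 hB ?_ htb.2 ?_ o2
    · omega
    · rintro z (hz | hz)
      · exact hmem p1 z hz
      · exact hsub hz.1.1
    · rintro z (hz | hz)
      · exact (closedHull_subset hr (.inl rfl) ω hz.1).1
      · exact hmem q1 z hz
    · rintro z (hz | hz) (hz' | hz')
      · rcases hz'.2 with h | rfl
        · exact hcol (p2 z hz) h
        · exact d1 hz hvq
      · exact d1 hz hz'
      · exact (closedHull_subset hr (.inl rfl) ω hz'.1).2 hz.1.1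
      · rcases hwq z hz' with rfl | h
        · exact absurd hz.2 (not_le.2 o1)
        · exact h.2 hz.1.1
  have hL : ∀ v ∈ closedHull r R (-1) ω, v ∉ q := by
    intro v hv hvq
    obtain ⟨x, hx, hc⟩ := closedHull_conn hv
    have hA := (hBoxPlus_arc_left hr hub').mono (T := {x | x ∈ p'} ∪
      {v | v ∈ hBoxPlus 0 0 r ∧ ccw 0 0 r u' ≤ ccw 0 0 r v}) Set.subset_union_right
    have hB := (hc.mono (T := closedHull r R (-1) ω ∩ ({w | ω w = false} ∪ {v}) ∪ {x | x ∈ q})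
      Set.subset_union_left).trans ((hQ v hvq).mono Set.subset_union_right)
    have := perim_order hB ?_ htb.2 (hA.trans (hus'.mono Set.subset_union_left)) ?_ hsb'.2 ?_ o4
    · omega
    · rintro z (hz | hz)
      · exact (closedHull_subset hr (.inr rfl) ω hz.1).1
      · exact hmem q1 z hz
    · rintro z (hz | hz)
      · exact hmem p1' z hz
      · exact hsub hz.1.1
    · rintro z (hz' | hz') (hz | hz)
      · rcases hz'.2 with h | rfl
        · exact hcol (p2' z hz) h
        · exact d2 hvq hz
      · exact (closedHull_subset hr (.inr rfl) ω hz'.1).2 hz.1.1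
      · exact d2 hz' hz
      · rcases hwq z hz' with rfl | h
        · exact absurd hz.2 (not_le.2 o3)
        · exact h.2 hz.1.1
  -- a walk between the feet avoiding the closed arm
  intro v hv hv'
  obtain ⟨y, hy, hc'⟩ := closedHull_conn hv'
  set L : Set Site := {z | z ∈ horseshoe r R ∧ z ∉ q} with hLdef
  have hc1 : ∀ {s : ℤ} (_ : s = 1 ∨ s = -1) (_ : ∀ v ∈ closedHull r R s ω, v ∉ q),
      closedHull r R s ω ⊆ L := fun hs h z hz => ⟨closedHull_subset hr hs ω hz, h z hz⟩
  have hfin : ∀ {z}, z ∈ closedHull r R 1 ω → ∃ x : ℤ, r < x ∧ Conn L (x, 0) z := by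
    intro z hz
    obtain ⟨x, hx, hc⟩ := closedHull_conn hz
    exact ⟨x, by omega, hc.mono fun z hz => hc1 (.inl rfl) hR hz.1⟩
  obtain ⟨x, hx, hxv⟩ : ∃ x : ℤ, r < x ∧ Conn L (x, 0) v := by
    rcases Reach.exists_conn hv with h | ⟨z, h1, h2, z', h3, h4, h5⟩
    · exact hfin h
    · obtain ⟨x, hx, hc⟩ := hfin h1
      refine ⟨x, hx, (hc.trans (h3.mono ?_)).tail h4 ⟨h5, hL v hv'⟩⟩
      rintro z ⟨⟨hz1, hz2⟩, -⟩
      exact ⟨openHull_subset hr (.inl rfl) ω hz1, fun hz => hcol hz2 (q2 z hz)⟩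
  have hA := (hBoxPlus_arc_right hr hwb).mono (T := {x | x ∈ q} ∪
    {v | v ∈ hBoxPlus 0 0 r ∧ ccw 0 0 r v ≤ ccw 0 0 r w}) Set.subset_union_right
  have hA' := hA.trans (hwt.mono Set.subset_union_left)
  have key : ∀ z ∈ L, z ∉ {x | x ∈ q} ∪ {v | v ∈ hBoxPlus 0 0 r ∧ ccw 0 0 r v ≤ ccw 0 0 r w} := by
    rintro z hz (h | h)
    · exact hz.2 h
    · exact hz.1.2 h.1.1
  have hLr : L ⊆ rect (0 - R) (0 + R) 0 (0 + 2 * R) := fun z hz => horseshoe_subset_rect r R hz.1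
  have hAr : {x | x ∈ q} ∪ {v | v ∈ hBoxPlus 0 0 r ∧ ccw 0 0 r v ≤ ccw 0 0 r w} ⊆
      rect (0 - R) (0 + R) 0 (0 + 2 * R) := by
    rintro z (hz | hz)
    · exact hmem q1 z hz
    · exact hsub hz.1.1
  have hLL : Conn L (x, 0) (y, 0) :=
    hxv.trans (hc'.symm.mono fun z hz => hc1 (.inr rfl) hL hz.1)
  obtain ⟨t1, t2⟩ := t
  have htr := hAr hA'.right_mem
  have htb2 := htb.2
  simp only [mem_rect] at htr htb2
  -- the end of the closed arm is prolonged out of the box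
  obtain ⟨z, T, hz, hzT, hTr, hT0⟩ : ∃ (z : Site) (T : Set Site), Conn (({x | x ∈ q} ∪
      {v | v ∈ hBoxPlus 0 0 r ∧ ccw 0 0 r v ≤ ccw 0 0 r w}) ∪ T) (0 + r, 0) z ∧
      (∀ p ∈ L, p.1 = z.1 → p.2 < z.2) ∧ (∀ p ∈ T, p ∉ rect (0 - R) (0 + R) 0 (0 + 2 * R)) ∧
      (∀ p ∈ T, 0 ≤ p.2) := by
    by_cases h2 : t2 = 0 + 2 * R
    · refine ⟨(t1, t2 + 1), {(t1, t2 + 1)}, (hA'.mono Set.subset_union_left).tail ?_ (.inr rfl), ?_, ?_, ?_⟩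
      · rw [adj_iff]; simp
      · intro p hp hp1; have := hLr hp; rw [mem_rect] at this; simp only; omega
      · rintro p rfl; rw [mem_rect]; simp only; omega
      · rintro p rfl; simp only; omega
    · rcases (show t1 = 0 - R ∨ t1 = 0 + R by omega) with h1 | h1
      · refine ⟨(t1 - 1, t2), {(t1 - 1, t2)}, (hA'.mono Set.subset_union_left).tail ?_ (.inr rfl), ?_, ?_, ?_⟩
        · rw [adj_iff]; simp
        · intro p hp hp1; have := hLr hp; rw [mem_rect] at this; simp only at *; omega
        · rintro p rfl; rw [mem_rect]; simp only; omega
        · rintro p rfl; simp only; omega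
      · refine ⟨(t1 + 1, t2), {(t1 + 1, t2)}, (hA'.mono Set.subset_union_left).tail ?_ (.inr rfl), ?_, ?_, ?_⟩
        · rw [adj_iff]; simp
        · intro p hp hp1; have := hLr hp; rw [mem_rect] at this; simp only at *; omega
        · rintro p rfl; rw [mem_rect]; simp only; omega
        · rintro p rfl; simp only; omega
  have := no_cross hLL (fun p hp => (hLr hp).2.2.1) hz ?_ ?_ hzT
  · omega
  · rintro p (hp | hp)
    · exact (hAr hp).2.2.1
    · exact hT0 p hp
  · rintro p hp (hp' | hp')
    · exact key p hp hp'
    · exact hTr p hp' (hLr hp)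

/-! ### Sheltering the core -/

/-- The outer box with a slab below the inner box. -/
def region (r R : ℤ) : Set Site :=
  {v | v ∈ hBox 0 0 R ∨ (-6 * r ≤ v.1 ∧ v.1 ≤ 6 * r ∧ -8 * r ≤ v.2 ∧ v.2 ≤ -1)}

/-- A neighborhood of the inner box in `region`. -/
def core (r : ℤ) : Set Site := {v | -3 * r ≤ v.1 ∧ v.1 ≤ 3 * r ∧ -8 * r ≤ v.2 ∧ v.2 ≤ 6 * r}

/-- The right (`s = 1`) or left (`s = -1`) part of the slab. -/
def leg (r s : ℤ) : Set Site := {v | 3 * r + 1 ≤ s * v.1 ∧ s * v.1 ≤ 6 * r ∧ -8 * r ≤ v.2 ∧ v.2 ≤ -1}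

/-- The right (`s = 1`) or left (`s = -1`) part of the lower boundary of `region`. -/
def side (r R s : ℤ) : Set Site :=
  {v | (v.2 = 0 ∧ 6 * r ≤ s * v.1 ∧ s * v.1 ≤ R) ∨ (s * v.1 = 6 * r ∧ -8 * r ≤ v.2 ∧ v.2 ≤ -1)}

theorem mem_hBox_zero {r : ℤ} {v : Site} :
    v ∈ hBox 0 0 r ↔ -r ≤ v.1 ∧ v.1 ≤ r ∧ 0 ≤ v.2 ∧ v.2 ≤ 2 * r := by
  simp only [hBox, Set.mem_ofPred_eq]; omega

theorem mem_horseshoe {r R : ℤ} {v : Site} : v ∈ horseshoe r R ↔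
    (-R ≤ v.1 ∧ v.1 ≤ R ∧ 0 ≤ v.2 ∧ v.2 ≤ 2 * R) ∧
    ¬ (-r ≤ v.1 ∧ v.1 ≤ r ∧ 0 ≤ v.2 ∧ v.2 ≤ 2 * r) := by
  rw [horseshoe, Set.mem_sdiff, mem_hBox_zero, mem_hBox_zero]

theorem mem_foot {r R s : ℤ} {v : Site} :
    v ∈ foot r R s ↔ v.2 = 0 ∧ r < s * v.1 ∧ s * v.1 ≤ R := Iff.rfl

theorem mem_region {r R : ℤ} {v : Site} : v ∈ region r R ↔
    (-R ≤ v.1 ∧ v.1 ≤ R ∧ 0 ≤ v.2 ∧ v.2 ≤ 2 * R) ∨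
      (-6 * r ≤ v.1 ∧ v.1 ≤ 6 * r ∧ -8 * r ≤ v.2 ∧ v.2 ≤ -1) := by
  rw [← mem_hBox_zero]; rfl

theorem mem_core {r : ℤ} {v : Site} :
    v ∈ core r ↔ -3 * r ≤ v.1 ∧ v.1 ≤ 3 * r ∧ -8 * r ≤ v.2 ∧ v.2 ≤ 6 * r := Iff.rfl

theorem mem_leg {r s : ℤ} {v : Site} :
    v ∈ leg r s ↔ 3 * r + 1 ≤ s * v.1 ∧ s * v.1 ≤ 6 * r ∧ -8 * r ≤ v.2 ∧ v.2 ≤ -1 := Iff.rfl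

theorem mem_side {r R s : ℤ} {v : Site} :
    v ∈ side r R s ↔ (v.2 = 0 ∧ 6 * r ≤ s * v.1 ∧ s * v.1 ≤ R) ∨
      (s * v.1 = 6 * r ∧ -8 * r ≤ v.2 ∧ v.2 ≤ -1) := Iff.rfl

/-- The sites reached from a side by closed sites. -/
def sideHull (r R s : ℤ) (ω : Config) : Set Site :=
  {v | Reach (side r R s) (region r R) {v | ω v = false} v}

/-- The core and the opposite leg are not reached from a side by closed sites. -/
def Sheltered (r R s : ℤ) (ω : Config) : Prop := ∀ v ∈ sideHull r R s ω, v ∉ core r ∪ leg r (-s)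

theorem reach_side_subset {r R s : ℤ} (hr : 1 ≤ r) (hs : s = 1 ∨ s = -1) {ω : Config} {v : Site}
    (h : Reach (side r R s) (region r R \ (core r ∪ leg r (-s))) {v | ω v = false} v) :
    v ∈ leg r s ∨ (0 ≤ v.2 ∧ v ∈ closedHull r R s ω) := by
  induction h with
  | @base v h =>
    rw [mem_side] at h
    rcases h with h | h
    · refine .inr ⟨by omega, Reach.base ?_⟩
      rw [mem_foot]; omega
    · left; rw [mem_leg]; omega
  | @step u v hu hc ha hv ih =>
    have hv1 := hv.1
    have hv2 := hv.2
    rw [Set.mem_union, not_or, mem_core, mem_leg] at hv2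
    rw [mem_region] at hv1
    rw [adj_iff] at ha
    rcases ih with ih | ⟨ih1, ih⟩
    · rw [mem_leg] at ih
      by_cases h0 : v.2 ≤ -1
      · left; rw [mem_leg]; rcases hs with rfl | rfl <;> omega
      · refine .inr ⟨by omega, Reach.base ?_⟩
        rw [mem_foot]; rcases hs with rfl | rfl <;> omega
    · by_cases h0 : v.2 ≤ -1
      · have hh := closedHull_subset (by omega) hs ω ih
        rw [mem_horseshoe] at hh
        left; rw [mem_leg]; rcases hs with rfl | rfl <;> omega
      · refine .inr ⟨by omega, Reach.step ih hc (by rw [adj_iff]; exact ha) ?_⟩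
        rw [mem_horseshoe]; rcases hs with rfl | rfl <;> omega

theorem side_subset_region {r R s : ℤ} (hr : 1 ≤ r) (hs : s = 1 ∨ s = -1) :
    side r R s ⊆ region r R := by
  intro v hv
  rw [mem_side] at hv
  rw [mem_region]
  rcases hs with rfl | rfl <;> omega

theorem side_disjoint {r R s : ℤ} (hr : 1 ≤ r) (hs : s = 1 ∨ s = -1) {v : Site}
    (hv : v ∈ side r R s) : v ∉ core r ∪ leg r (-s) := by
  rw [mem_side] at hv
  rw [Set.mem_union, mem_core, mem_leg]
  rcases hs with rfl | rfl <;> omega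

theorem Sheltered.reach {r R s : ℤ} {ω : Config} (h : Sheltered r R s ω) {v : Site}
    (hv : v ∈ sideHull r R s ω) :
    Reach (side r R s) (region r R \ (core r ∪ leg r (-s))) {v | ω v = false} v := by
  have : Reach (side r R s) (region r R) {v | ω v = false} v := hv
  induction this with
  | base h1 => exact .base h1
  | step h1 h2 h3 h4 ih =>
    exact Reach.step (ih h1) h2 h3 ⟨h4, h _ (Reach.step h1 h2 h3 h4)⟩

theorem Sheltered.subset {r R s : ℤ} (hr : 1 ≤ r) (hs : s = 1 ∨ s = -1) {ω : Config}
    (h : Sheltered r R s ω) {v : Site} (hv : v ∈ sideHull r R s ω) :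
    v ∈ leg r s ∨ (0 ≤ v.2 ∧ v ∈ closedHull r R s ω) :=
  reach_side_subset hr hs (h.reach hv)

/-- A vertical crossing meets a horizontal one. -/
theorem Conn.meet {P Q : Set Site} {a b c d : Site} {x₀ x₁ y₀ y₁ : ℤ} (hx : x₀ ≤ x₁) (hy : y₀ ≤ y₁)
    (hP : Conn P a b) (hPx : ∀ v ∈ P, x₀ ≤ v.1 ∧ v.1 ≤ x₁) (ha : a.2 ≤ y₀) (hb : y₁ ≤ b.2)
    (hQ : Conn Q c d) (hQy : ∀ v ∈ Q, y₀ ≤ v.2 ∧ v.2 ≤ y₁) (hc : c.1 ≤ x₀) (hd : x₁ ≤ d.1) :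
    ∃ p, Conn P a p ∧ Conn Q c p := by
  obtain ⟨a', b', ha', hb', h1⟩ := hP.within_cluster.sub_vert ha hy hb
  obtain ⟨c', d', hc', hd', h2⟩ := hQ.within_cluster.sub_horiz hc hx hd
  obtain ⟨p, hp1, hp2⟩ := rect_cross h2 (fun v hv => ⟨hv.2.1, hv.2.2, hQy _ (hv.1.right_mem)⟩) hc' hd'
    h1 (fun v hv => ⟨(hPx _ hv.1.right_mem).1, (hPx _ hv.1.right_mem).2, hv.2⟩) ha' hb'
  exact ⟨p, hp2.1, hp1.1⟩

/-- Three crossings form an arch. -/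
theorem exists_arch {c : Bool} {ω : Config} {A B y₀ y₁ y₂ : ℤ} (hA : 0 ≤ A) (hAB : A ≤ B)
    (hy : y₀ ≤ y₁) (hy' : y₁ ≤ y₂)
    (h1 : ω ∈ VC c (-B) (-A) y₀ y₂) (h2 : ω ∈ HC c (-B) B y₁ y₂) (h3 : ω ∈ VC c A B y₀ y₂) :
    ∃ u v, u ≤ -A ∧ A ≤ v ∧ Conn ({v | ω v = c} ∩
      {v | -B ≤ v.1 ∧ v.1 ≤ B ∧ y₀ ≤ v.2 ∧ v.2 ≤ y₂ ∧ (v.1 ≤ -A ∨ A ≤ v.1 ∨ y₁ ≤ v.2)}) (u, y₀) (v, y₀) := by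
  obtain ⟨⟨a1, a2⟩, ha, b, hb, hab⟩ := h1
  obtain ⟨d, hd, e, he, hde⟩ := h2
  obtain ⟨⟨a1', a2'⟩, ha', b', hb', hab'⟩ := h3
  obtain rfl : a2 = y₀ := ha
  obtain rfl : a2' = a2 := ha'
  have hb : b.2 = y₂ := hb
  have hb' : b'.2 = y₂ := hb'
  have hd : d.1 = -B := hd
  have he : e.1 = B := he
  obtain ⟨p, hp1, hp2⟩ := hab.meet (x₀ := -B) (x₁ := -A) (y₀ := y₁) (y₁ := y₂) (by omega) hy'
    (fun v hv => by have := hv.2; rw [mem_rect] at this; omega) hy hb.ge hde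
    (fun v hv => by have := hv.2; rw [mem_rect] at this; omega) (by omega) (by omega)
  obtain ⟨q, hq1, hq2⟩ := hab'.meet (x₀ := A) (x₁ := B) (y₀ := y₁) (y₁ := y₂) (by omega) hy'
    (fun v hv => by have := hv.2; rw [mem_rect] at this; omega) hy hb'.ge hde
    (fun v hv => by have := hv.2; rw [mem_rect] at this; omega) (by omega) (by omega)
  have m1 := hp1.left_mem.2
  have m2 := hq1.left_mem.2
  rw [mem_rect] at m1 m2
  refine ⟨a1, a1', by omega, by omega, (hp1.mono ?_).trans ((hp2.symm.trans hq2).mono ?_ |>.trans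
    (hq1.symm.mono ?_))⟩ <;>
  · rintro v ⟨hv1, hv2⟩
    rw [mem_rect] at hv2
    refine ⟨hv1, ?_⟩
    simp only [Set.mem_ofPred_eq]
    omega

/-- The open arch sheltering the core. -/
def ArchEv (c : Bool) (A B y₀ y₁ y₂ : ℤ) : Set Config :=
  (VC c (-B) (-A) y₀ y₂ ∩ HC c (-B) B y₁ y₂) ∩ VC c A B y₀ y₂

theorem sheltered_of_arch {r R s : ℤ} (hr : 1 ≤ r) (hs : s = 1 ∨ s = -1) {ω ω' : Config}
    (h : ∀ v, v ∈ closedHull r R s ω ∨ v ∈ leg r s → ω v = ω' v)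
    (hf : ∀ v ∈ closedHull r R s ω, v ∉ foot r R (-s))
    (hY : ω' ∈ ArchEv true (4 * r) (5 * r) (-8 * r) (7 * r) (8 * r)) : Sheltered r R s ω := by
  obtain ⟨u₁, u₂, hu₁, hu₂, hL⟩ := exists_arch (by omega) (by omega) (by omega) (by omega)
    hY.1.1 hY.1.2 hY.2
  -- the set reached before entering the forbidden sites
  set N := region r R \ (core r ∪ leg r (-s)) with hN
  suffices H : ∀ v ∈ sideHull r R s ω, Reach (side r R s) N {v | ω v = false} v ∧
      v ∉ core r ∪ leg r (-s) from fun v hv => (H v hv).2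
  intro v hv
  have hv' : Reach (side r R s) (region r R) {v | ω v = false} v := hv
  clear hv
  induction hv' with
  | base h1 => exact ⟨.base h1, side_disjoint hr hs h1⟩
  | @step u v hu hc ha hv ih =>
    suffices H : v ∉ core r ∪ leg r (-s) from ⟨Reach.step ih.1 hc ha ⟨hv, H⟩, H⟩
    have hu1 := reach_side_subset hr hs ih.1
    rintro (hvc | hvl)
    · -- the walk from the side to the core would cross the arch
      have hcol : ∀ w, Reach (side r R s) N {v | ω v = false} w → ω w = false → ω' w = false := by
        intro w hw hw'
        rw [← h w ((reach_side_subset hr hs hw).symm.imp_left And.right), hw']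
      obtain ⟨z, hz, hzu⟩ : ∃ z ∈ side r R s, Conn ({w | ω' w = false} ∩ {w | -8 * r ≤ w.2}) z u := by
        have hge : ∀ w, Reach (side r R s) N {v | ω v = false} w → -8 * r ≤ w.2 := by
          intro w hw
          rcases reach_side_subset hr hs hw with h1 | h1
          · rw [mem_leg] at h1; omega
          · omega
        rcases ih.1.exists_conn with h1 | ⟨z, h1, h2, w, h3, h4, h5⟩
        · exact ⟨u, h1, Conn.refl ⟨hcol u ih.1 hc, hge u ih.1⟩⟩
        · have h6 := h3.mono (T := {w | ω' w = false} ∩ {w | -8 * r ≤ w.2})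
            fun w hw => ⟨hcol w hw.1.1 hw.1.2, hge w hw.1.1⟩
          exact ⟨z, h1, h6.tail h4 ⟨hcol u ih.1 hc, hge u ih.1⟩⟩
      obtain ⟨v1, v2⟩ := v
      rw [mem_core] at hvc
      simp only at hvc
      have hQ : Conn (core r ∪ ({w | ω' w = false} ∩ {w | -8 * r ≤ w.2})) (v1, -8 * r) z :=
        ((Conn.vert v1 (-8 * r) v2 fun z h1 h2 => .inl
          (by rw [mem_core]; simp only; omega)).tail ha.symm (.inr hzu.right_mem)).trans
          (hzu.symm.mono Set.subset_union_right)
      rw [mem_side] at hz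
      have := no_cross hL (fun p hp => hp.2.2.2.1) hQ ?_ ?_ ?_
      · omega
      · rintro p (hp | hp)
        · exact hp.2.2.1
        · exact hp.2
      · rintro p ⟨hp1, hp2⟩ (hp3 | hp3)
        · rw [mem_core] at hp3; simp only [Set.mem_ofPred_eq] at hp2; omega
        · have h1 : ω' p = true := hp1
          have h2 : ω' p = false := hp3.1
          rw [h1] at h2; cases h2
      · intro p hp hpz
        have := hp.2
        simp only [Set.mem_ofPred_eq] at this
        rcases hs with rfl | rfl <;> omega
    · rw [mem_leg] at hvl
      rw [adj_iff] at ha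
      rcases hu1 with h1 | ⟨h1, h2⟩
      · rw [mem_leg] at h1
        rcases hs with rfl | rfl <;> omega
      · have h3 := closedHull_subset (by omega) hs ω h2
        rw [mem_horseshoe] at h3
        refine hf u h2 ?_
        rw [mem_foot]
        rcases hs with rfl | rfl <;> omega

theorem ArchEv.finDep (c : Bool) (A B y₀ y₁ y₂ : ℤ) : FinDep (ArchEv c A B y₀ y₁ y₂) :=
  ((VC.finDep ..).inter (HC.finDep ..)).inter (VC.finDep ..)

theorem ArchEv.isUpperSet (A B y₀ y₁ y₂ : ℤ) : IsUpperSet (ArchEv true A B y₀ y₁ y₂) :=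
  ((VC.isUpperSet ..).inter (HC.isUpperSet ..)).inter (VC.isUpperSet ..)

theorem ArchEv.isLowerSet (A B y₀ y₁ y₂ : ℤ) : IsLowerSet (ArchEv false A B y₀ y₁ y₂) :=
  ((VC.isLowerSet ..).inter (HC.isLowerSet ..)).inter (VC.isLowerSet ..)

theorem IsBernoulliHalf.fkg_color {μ : Measure Config} (hμ : IsBernoulliHalf μ) {E F : Set Config}
    (hE : FinDep E) (hF : FinDep F) (h : (IsUpperSet E ∧ IsUpperSet F) ∨ (IsLowerSet E ∧ IsLowerSet F)) :
    μ.real E * μ.real F ≤ μ.real (E ∩ F) := by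
  rcases h with h | h
  · exact hμ.fkg hE hF h.1 h.2
  · exact hμ.fkg_lower hE hF h.1 h.2

theorem ArchEv.ge {μ : Measure Config} (hμ : IsBernoulliHalf μ) (c : Bool) {A B y₀ y₁ y₂ : ℤ}
    (hA : A < B) (hB : 0 ≤ B) (hy : y₀ ≤ y₂) (hy' : y₁ < y₂) (h1 : y₂ - y₀ ≤ 16 * (B - A))
    (h2 : 2 * B ≤ 16 * (y₂ - y₁)) : rsw ^ 3 ≤ μ.real (ArchEv c A B y₀ y₁ y₂) := by
  have h1 := VC.ge hμ c (x₀ := -B) (x₁ := -A) (y₀ := y₀) (y₁ := y₂) hy (by omega) (by omega)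
  have h2 := HC.ge hμ c (x₀ := -B) (x₁ := B) (y₀ := y₁) (y₁ := y₂) (by omega) hy' (by omega)
  have h3 := VC.ge hμ c (x₀ := A) (x₁ := B) (y₀ := y₀) (y₁ := y₂) hy (by omega) (by omega)
  have hp := rsw_pos
  have h12 := hμ.fkg_color (VC.finDep c (-B) (-A) y₀ y₂) (HC.finDep c (-B) B y₁ y₂) (by
    cases c
    · exact .inr ⟨VC.isLowerSet .., HC.isLowerSet ..⟩
    · exact .inl ⟨VC.isUpperSet .., HC.isUpperSet ..⟩)
  have h123 := hμ.fkg_color ((VC.finDep c (-B) (-A) y₀ y₂).inter (HC.finDep c (-B) B y₁ y₂))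
    (VC.finDep c A B y₀ y₂) (by
    cases c
    · exact .inr ⟨(VC.isLowerSet ..).inter (HC.isLowerSet ..), VC.isLowerSet ..⟩
    · exact .inl ⟨(VC.isUpperSet ..).inter (HC.isUpperSet ..), VC.isUpperSet ..⟩)
  calc rsw ^ 3 = (rsw * rsw) * rsw := by ring
    _ ≤ _ := ?_
  refine le_trans ?_ h123
  gcongr
  exact le_trans (by gcongr) h12

/-! ### Stopping sets around the inner box -/

theorem Stopping.reach' {B : Config → Set Site} (hB : Stopping B) (D : Set Site) (c : Bool) :
    Stopping fun ω => {v | Reach (B ω) D {v | ω v = c} v} := by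
  have := hB.reach D Set.univ c
  simpa only [Set.inter_univ] using this

theorem closedHull_stopping (r R s : ℤ) : Stopping (closedHull r R s) :=
  (Stopping.const (foot r R s)).reach' (horseshoe r R) false

theorem openHull_stopping (r R s : ℤ) : Stopping (openHull r R s) :=
  (closedHull_stopping r R s).reach' (horseshoe r R) true

theorem sideHull_stopping (r R s : ℤ) : Stopping (sideHull r R s) :=
  (Stopping.const (side r R s)).reach' (region r R) false

theorem Stopping.congr {A : Config → Set Site} (hA : Stopping A) {D : Set Site} (hD : ∀ ω, A ω ⊆ D)
    {ω ω' : Config} (h : ∀ v ∈ D, ω v = ω' v) : A ω' = A ω :=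
  hA ω ω' fun v hv => h v (hD ω hv)

theorem closed_anti {ω ω' : Config} (h : ω ≤ ω') : {v | ω' v = false} ⊆ {v | ω v = false} := by
  intro v hv
  have h1 := h v
  have h2 : ω' v = false := hv
  rw [h2] at h1
  exact le_antisymm h1 bot_le

theorem closedHull_anti {r R s : ℤ} {ω ω' : Config} (h : ω ≤ ω') :
    closedHull r R s ω' ⊆ closedHull r R s ω := fun _ hv =>
  Reach.mono (le_refl _) (le_refl _) (closed_anti h) hv

theorem Separated.iff_symm {r R : ℤ} (hr : 0 ≤ r) {ω : Config} :
    Separated r R ω ↔ ∀ v ∈ openHull r R (-1) ω, v ∉ closedHull r R 1 ω :=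
  ⟨Separated.symm hr, fun h _ hv => Reach.separation_symm (foot_subset hr (.inl rfl)) h hv⟩

theorem horseshoe_finite (r R : ℤ) : (horseshoe r R).Finite :=
  (hBox_finite 0 0 R).subset fun _ hv => hv.1

theorem region_finite (r R : ℤ) : (region r R).Finite := by
  refine ((hBox_finite 0 0 R).union (rect_finite (-6 * r) (6 * r) (-8 * r) (-1))).subset ?_
  exact fun v hv => hv

theorem Separated.depOn {r R : ℤ} (hr : 0 ≤ r) : DepOn (horseshoe r R) {ω | Separated r R ω} := by
  intro ω ω' h hω
  simp only [Set.mem_ofPred_eq, Separated] at hω ⊢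
  rwa [(closedHull_stopping r R (-1)).congr (closedHull_subset hr (.inr rfl)) h,
    (openHull_stopping r R 1).congr (openHull_subset hr (.inl rfl)) h]

theorem sideHull_subset {r R s : ℤ} (hr : 1 ≤ r) (hs : s = 1 ∨ s = -1) (ω : Config) :
    sideHull r R s ω ⊆ region r R := fun _ hv =>
  (Reach.mem hv).elim (fun h => side_subset_region hr hs h) id

theorem Sheltered.depOn {r R s : ℤ} (hr : 1 ≤ r) (hs : s = 1 ∨ s = -1) :
    DepOn (region r R) {ω | Sheltered r R s ω} := by
  intro ω ω' h hω
  simp only [Set.mem_ofPred_eq, Sheltered] at hω ⊢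
  rwa [(sideHull_stopping r R s).congr (sideHull_subset hr hs) h]

theorem Separated.finDep {r R : ℤ} (hr : 0 ≤ r) : FinDep {ω | Separated r R ω} :=
  ⟨_, horseshoe_finite r R, Separated.depOn hr⟩

theorem Sheltered.finDep {r R s : ℤ} (hr : 1 ≤ r) (hs : s = 1 ∨ s = -1) :
    FinDep {ω | Sheltered r R s ω} :=
  ⟨_, region_finite r R, Sheltered.depOn hr hs⟩

/-- An open crossing of the lower part of the slab. -/
def SlabEv (r : ℤ) : Set Config := HC true (-6 * r) (6 * r) (-8 * r) (-7 * r)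

theorem sheltered_left_ge {μ : Measure Config} (hμ : IsBernoulliHalf μ) {r R : ℤ} (hr : 1 ≤ r) :
    rsw ^ 4 * μ.real {ω | Separated r R ω} ≤
      μ.real (({ω | Separated r R ω} ∩ {ω | Sheltered r R (-1) ω}) ∩ SlabEv r) := by
  set Y := ArchEv true (4 * r) (5 * r) (-8 * r) (7 * r) (8 * r) with hYdef
  have hYf : FinDep (Y ∩ SlabEv r) := (ArchEv.finDep ..).inter (HC.finDep ..)
  have hYu : IsUpperSet (Y ∩ SlabEv r) := (ArchEv.isUpperSet ..).inter (HC.isUpperSet ..)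
  have hp : rsw ^ 4 ≤ μ.real (Y ∩ SlabEv r) := by
    have h1 := ArchEv.ge hμ true (A := 4 * r) (B := 5 * r) (y₀ := -8 * r) (y₁ := 7 * r) (y₂ := 8 * r)
      (by omega) (by omega) (by omega) (by omega) (by omega) (by omega)
    have h2 := HC.ge hμ true (x₀ := -6 * r) (x₁ := 6 * r) (y₀ := -8 * r) (y₁ := -7 * r)
      (by omega) (by omega) (by omega)
    have h3 := hμ.fkg (ArchEv.finDep true (4 * r) (5 * r) (-8 * r) (7 * r) (8 * r))
      (HC.finDep true (-6 * r) (6 * r) (-8 * r) (-7 * r)) (ArchEv.isUpperSet ..) (HC.isUpperSet ..)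
    have hp := rsw_pos
    calc rsw ^ 4 = rsw ^ 3 * rsw := by ring
      _ ≤ _ := by gcongr
      _ ≤ _ := h3
  refine (mul_le_mul_of_nonneg_right hp measureReal_nonneg).trans ?_
  have hS : FinDep {ω | Separated r R ω} := Separated.finDep (by omega)
  refine hμ.mix_le hS ((hS.inter (Sheltered.finDep hr (.inr rfl))).inter (HC.finDep ..))
    (openHull_stopping r R 1) fun ω => ?_
  refine (hμ.fkg hYf (hS.mix _ ω) hYu ?_).trans (hμ.real_mono ?_)
  · intro ω₁ ω₂ h12 h1 v hv hv'
    rw [(openHull_stopping r R 1).mix] at hv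
    refine h1 v ?_ (closedHull_anti (mix_mono _ ω h12) hv')
    rwa [(openHull_stopping r R 1).mix]
  · rintro ω' ⟨⟨h1, h2⟩, h3 : Separated r R _⟩
    have hA := (openHull_stopping r R 1).mix ω ω'
    have hsub := openHull_subset (R := R) (by omega : 0 ≤ r) (.inl rfl : (1 : ℤ) = 1 ∨ (1 : ℤ) = -1) ω
    refine ⟨⟨h3, sheltered_of_arch hr (.inr rfl) (ω' := ω') ?_ ?_ h1⟩, ?_⟩
    · intro v hv
      refine mix_of_notMem fun hv' => ?_
      rcases hv with hv | hv
      · exact h3 v (by rw [hA]; exact hv') hv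
      · have := hsub hv'
        rw [mem_horseshoe] at this
        rw [mem_leg] at hv
        omega
    · intro v hv hv'
      exact h3 v (Reach.base (Reach.base (by simpa using hv'))) hv
    · refine HC.depOn true _ _ _ _ _ _ (fun v hv => ?_) h2
      refine (mix_of_notMem fun hv' => ?_).symm
      have := hsub hv'
      rw [mem_horseshoe] at this
      rw [mem_rect] at hv
      omega

theorem sheltered_right_ge {μ : Measure Config} (hμ : IsBernoulliHalf μ) {r R : ℤ} (hr : 1 ≤ r) :
    rsw ^ 3 * μ.real (({ω | Separated r R ω} ∩ {ω | Sheltered r R (-1) ω}) ∩ SlabEv r) ≤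
      μ.real ((({ω | Separated r R ω} ∩ {ω | Sheltered r R (-1) ω}) ∩ SlabEv r) ∩
        {ω | Sheltered r R 1 ω}) := by
  set Y := ArchEv true (4 * r) (5 * r) (-8 * r) (7 * r) (8 * r) with hYdef
  have hYf : FinDep Y := ArchEv.finDep ..
  have hp : rsw ^ 3 ≤ μ.real Y := ArchEv.ge hμ true (A := 4 * r) (B := 5 * r) (y₀ := -8 * r)
    (y₁ := 7 * r) (y₂ := 8 * r) (by omega) (by omega) (by omega) (by omega) (by omega) (by omega)
  refine (mul_le_mul_of_nonneg_right hp measureReal_nonneg).trans ?_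
  have hS : FinDep {ω | Separated r R ω} := Separated.finDep (by omega)
  have hF : FinDep (({ω | Separated r R ω} ∩ {ω | Sheltered r R (-1) ω}) ∩ SlabEv r) :=
    (hS.inter (Sheltered.finDep hr (.inr rfl))).inter (HC.finDep ..)
  have hAs := (openHull_stopping r R (-1)).union (sideHull_stopping r R (-1))
  have hr0 : 0 ≤ r := by omega
  refine hμ.mix_le hF (hF.inter (Sheltered.finDep hr (.inl rfl))) hAs fun ω => ?_
  set A := openHull r R (-1) ω ∪ sideHull r R (-1) ω with hAdef
  have e1 : ∀ ω', openHull r R (-1) (mix A ω ω') = openHull r R (-1) ω := fun ω' =>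
    openHull_stopping r R (-1) _ _ fun v hv => (mix_of_mem (.inl hv)).symm
  have e2 : ∀ ω', sideHull r R (-1) (mix A ω ω') = sideHull r R (-1) ω := fun ω' =>
    sideHull_stopping r R (-1) _ _ fun v hv => (mix_of_mem (.inr hv)).symm
  refine (hμ.fkg hYf (hF.mix _ ω) (ArchEv.isUpperSet ..) ?_).trans (hμ.real_mono ?_)
  · rintro ω₁ ω₂ h12 ⟨⟨h1, h2⟩, h3⟩
    refine ⟨⟨?_, ?_⟩, HC.isUpperSet _ _ _ _ (mix_mono A ω h12) h3⟩
    · refine (Separated.iff_symm hr0).2 fun v hv hv' => ?_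
      have h1 := (Separated.iff_symm hr0).1 h1
      rw [e1] at hv h1
      exact h1 v hv (closedHull_anti (mix_mono _ ω h12) hv')
    · intro v hv
      rw [e2] at hv
      refine h2 v ?_
      rwa [e2]
  · rintro ω' ⟨h1, h2⟩
    refine ⟨h2, ?_⟩
    obtain ⟨⟨h3 : Separated r R _, h4 : Sheltered r R (-1) _⟩, -⟩ := h2
    have h5 := (Separated.iff_symm hr0).1 h3
    refine sheltered_of_arch hr (.inl rfl) (ω' := ω') ?_ ?_ h1
    · intro v hv
      refine mix_of_notMem fun hv' => ?_
      rw [hAdef, ← e1 ω', ← e2 ω'] at hv'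
      rcases hv with hv | hv
      · rcases hv' with hv' | hv'
        · exact h5 v hv' hv
        · rcases h4.subset hr (.inr rfl) hv' with h6 | h6
          · have := closedHull_subset hr0 (.inl rfl) _ hv
            rw [mem_horseshoe] at this
            rw [mem_leg] at h6
            omega
          · exact h5 v (Reach.base h6.2) hv
      · rcases hv' with hv' | hv'
        · have := openHull_subset hr0 (.inr rfl) _ hv'
          rw [mem_horseshoe] at this
          rw [mem_leg] at hv
          omega
        · exact h4 v hv' (.inr (by simpa using hv))
    · intro v hv hv'
      exact h5 v (Reach.base (Reach.base hv')) hv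

/-- The closed sites of the horseshoe which are not reached from its feet. -/
def midClosed (r R : ℤ) (ω : Config) : Set Site :=
  {v | v ∈ horseshoe r R ∧ ω v = false ∧ v ∉ closedHull r R 1 ω ∧ v ∉ closedHull r R (-1) ω}

/-- Separated feet are separated by a closed arm not connected to them. -/
theorem Separated.exists_arm {r R : ℤ} (hr : 1 ≤ r) (hrR : r < R) {ω : Config}
    (h : Separated r R ω) : ∃ a z t, a ∈ hBox 0 0 r ∧ Adj a z ∧ t ∈ hBoxPlus 0 0 R ∧
      Conn (midClosed r R ω) z t := by
  have hs := (Separated.iff_symm (by omega)).1 h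
  have hr0 : 0 ≤ r := by omega
  set M : Set Site := {v | v.2 = -1 ∧ -r ≤ v.1 ∧ v.1 ≤ r} ∪ hBox 0 0 r with hM
  set ring : Set Site := {v | 0 ≤ v.2 ∧ (v.1 = -R - 1 ∨ v.1 = R + 1 ∨ v.2 = 2 * R + 1)} with hring
  set N : Set Site := (M ∪ midClosed r R ω) ∪ ring with hN
  have hcl : ∀ {s : ℤ}, s = 1 ∨ s = -1 → ∀ v ∈ closedHull r R s ω, v ∈ horseshoe r R :=
    fun hs v hv => closedHull_subset hr0 hs ω hv
  rcases hex Nᶜ (x₀ := -R - 1) (x₁ := R + 1) (y₀ := -1) (y₁ := 2 * R + 1) (by omega) (by omega) with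
    ⟨a, b, ha, hb, hab⟩ | ⟨c, d, hc, hd, hcd⟩
  · exfalso
    -- the sites of the horseshoe outside `N`
    have hX : ∀ v, v ∈ Nᶜ ∩ rect (-R - 1) (R + 1) (-1) (2 * R + 1) →
        (v.2 = -1 ∧ (v.1 < -r ∨ r < v.1)) ∨ (v ∈ horseshoe r R ∧ v.1 ≤ R ∧ -R ≤ v.1 ∧ 0 ≤ v.2 ∧
          (ω v = true ∨ v ∈ closedHull r R 1 ω ∨ v ∈ closedHull r R (-1) ω)) := by
      rintro v ⟨h1, h2⟩
      rw [mem_rect] at h2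
      simp only [hN, hM, hring, Set.mem_compl_iff, Set.mem_union, Set.mem_ofPred_eq, mem_hBox_zero,
        midClosed, not_or] at h1
      obtain ⟨⟨⟨h3, h4⟩, h5⟩, h6⟩ := h1
      by_cases h0 : v.2 = -1
      · left; omega
      · right
        have h7 : v ∈ horseshoe r R := by rw [mem_horseshoe]; omega
        refine ⟨h7, by omega, by omega, by omega, ?_⟩
        by_contra hcon
        simp only [not_or, Bool.not_eq_true] at hcon
        exact h5 ⟨h7, hcon.1, hcon.2.1, hcon.2.2⟩
    have hfin : (b.2 = -1 ∧ b.1 < -r) ∨ b ∈ closedHull r R (-1) ω ∨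
        (b ∈ openHull r R (-1) ω ∧ ω b = true) := by
      refine hab.induction' (fun v => (v.2 = -1 ∧ v.1 < -r) ∨ v ∈ closedHull r R (-1) ω ∨
        (v ∈ openHull r R (-1) ω ∧ ω v = true)) ?_ ?_
      · rcases hX a hab.left_mem with h1 | h1
        · left; omega
        · omega
      · intro u v hu ih huv hv
        have huv' := huv
        rw [adj_iff] at huv'
        rcases hX v hv with ⟨h1, h2 | h2⟩ | ⟨h1, h2, h3, h4, h5⟩
        · exact .inl ⟨h1, h2⟩
        · exfalso
          have hfoot : u ∈ horseshoe r R → u ∈ closedHull r R 1 ω := by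
            intro hu
            rw [mem_horseshoe] at hu
            refine Reach.base ?_
            rw [mem_foot]; omega
          rcases ih with ih | ih | ih
          · omega
          · exact hs u (Reach.base ih) (hfoot (hcl (.inr rfl) u ih))
          · exact hs u ih.1 (hfoot (openHull_subset hr0 (.inr rfl) ω ih.1))
        · have hopen : v ∈ openHull r R (-1) ω → v ∈ closedHull r R (-1) ω ∨
              (v ∈ openHull r R (-1) ω ∧ ω v = true) := by
            intro hv'
            rcases h5 with h5 | h5 | h5
            · exact .inr ⟨hv', h5⟩
            · exact absurd h5 (hs v hv')
            · exact .inl h5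
          right
          rcases ih with ih | ih | ih
          · left
            refine Reach.base ?_
            rw [mem_foot]
            rw [mem_horseshoe] at h1
            omega
          · rcases hcu : ω u with _ | _
            · exact .inl (Reach.step ih hcu huv h1)
            · exact hopen (Reach.step (Reach.base ih) hcu huv h1)
          · exact hopen (Reach.step ih.1 ih.2 huv h1)
    rcases hfin with h1 | h1 | h1
    · omega
    · have := hcl (.inr rfl) b h1
      rw [mem_horseshoe] at this; omega
    · have := openHull_subset hr0 (.inr rfl) ω h1.1
      rw [mem_horseshoe] at this; omega
  · rw [Set.sdiff_compl] at hcd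
    have hcM : c ∈ M := by
      have := hcd.left_mem.2
      simp only [hN, hring, Set.mem_union, Set.mem_ofPred_eq, midClosed, mem_horseshoe] at this
      rcases this with (h1 | h1) | h1
      · exact h1
      · omega
      · omega
    have hdM : d ∉ M := by
      simp only [hM, Set.mem_union, Set.mem_ofPred_eq, mem_hBox_zero]; omega
    obtain ⟨a, b, -, haM, hab, hbd⟩ := hcd.last_exit hcM hdM
    have hb := hbd.left_mem
    have hab' := hab
    rw [adj_iff] at hab'
    have hfoot : b ∈ midClosed r R ω → ¬ (b.2 = 0 ∧ b.1 < -r) := by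
      rintro ⟨h1, -, -, h2⟩ h3
      refine h2 (Reach.base ?_)
      rw [mem_horseshoe] at h1
      rw [mem_foot]; omega
    have hbm : b ∈ midClosed r R ω := by
      rcases hb.1.2 with (h1 | h1) | h1
      · exact absurd h1 hb.2
      · exact h1
      · simp only [hring, hM, Set.mem_union, Set.mem_ofPred_eq, mem_hBox_zero] at h1 haM
        omega
    have hab2 : a ∈ hBox 0 0 r := by
      rcases haM with h1 | h1
      · exfalso
        have h2 := hfoot hbm
        have h3 := hbm.1
        rw [mem_horseshoe] at h3
        simp only [Set.mem_ofPred_eq] at h1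
        omega
      · exact h1
    have hdh : d ∉ horseshoe r R := by rw [mem_horseshoe]; omega
    obtain ⟨e, f, hbe, hef, hf, hfh⟩ := hbd.first_exit hbm.1 hdh
    have heh := hbe.right_mem.2
    refine ⟨a, b, e, hab2, hab, ?_, hbe.mono ?_⟩
    · rw [adj_iff] at hef
      have hfr : f ∈ ring := by
        rcases hf.1.2 with (h1 | h1) | h1
        · exact absurd h1 hf.2
        · exact absurd h1.1 hfh
        · exact h1
      simp only [hring, Set.mem_ofPred_eq] at hfr
      rw [mem_horseshoe] at heh
      refine ⟨?_, ?_⟩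
      · rw [mem_hBox_zero]; omega
      · omega
    · rintro v ⟨⟨⟨-, h1⟩, h2⟩, h3⟩
      rcases h1 with (h1 | h1) | h1
      · exact absurd h1 h2
      · exact h1
      · simp only [hring, Set.mem_ofPred_eq] at h1
        rw [mem_horseshoe] at h3
        omega

/-- The sites of the bottom side of the slab. -/
def slabBottom (r : ℤ) : Set Site := {v | v.2 = -8 * r ∧ -6 * r ≤ v.1 ∧ v.1 ≤ 6 * r}

/-- The lower boundary of `region`. -/
def lowerSide (r R : ℤ) : Set Site := (side r R 1 ∪ side r R (-1)) ∪ slabBottom r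

/-- A closed arm of `region` which is not connected to the lower boundary. -/
def IsolatedArm (r R : ℤ) (ω : Config) : Prop :=
  ∃ z t : Site, -r ≤ z.1 ∧ z.1 ≤ r ∧ z.2 = -3 * r ∧ t ∈ hBoxPlus 0 0 R ∧
    Conn ({v | ω v = false} ∩ region r R) z t ∧
    ∀ s ∈ lowerSide r R, ¬ Conn ({v | ω v = false} ∩ region r R) s z

/-- A closed arm of the horseshoe avoiding the sites reached from the sides. -/
def ShelteredArm (r R : ℤ) (ω : Config) : Prop :=
  ∃ a z t, a ∈ hBox 0 0 r ∧ Adj a z ∧ t ∈ hBoxPlus 0 0 R ∧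
    Conn ({v | ω v = false} ∩ (horseshoe r R \ (sideHull r R 1 ω ∪ sideHull r R (-1) ω))) z t

theorem Separated.shelteredArm {r R : ℤ} (hr : 1 ≤ r) (hrR : r < R) {ω : Config}
    (h : Separated r R ω) (h1 : Sheltered r R 1 ω) (h2 : Sheltered r R (-1) ω) :
    ShelteredArm r R ω := by
  obtain ⟨a, z, t, ha, haz, ht, hzt⟩ := h.exists_arm hr hrR
  refine ⟨a, z, t, ha, haz, ht, hzt.mono ?_⟩
  rintro v ⟨h3, h4, h5, h6⟩
  refine ⟨h4, h3, ?_⟩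
  rw [mem_horseshoe] at h3
  rintro (h7 | h7)
  · rcases h1.subset hr (.inl rfl) h7 with h8 | h8
    · rw [mem_leg] at h8; omega
    · exact h5 h8.2
  · rcases h2.subset hr (.inr rfl) h7 with h8 | h8
    · rw [mem_leg] at h8; omega
    · exact h6 h8.2

/-- A closed arch with a closed stem. -/
def StemEv (r : ℤ) : Set Config :=
  ArchEv false (2 * r) (3 * r) 0 (4 * r) (5 * r) ∩ VC false 0 r (-3 * r) (5 * r)

theorem isolatedArm_of {r R : ℤ} (hr : 1 ≤ r) (hrR : 6 * r ≤ R) {ω ω' : Config}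
    (hq : ShelteredArm r R ω) (h1 : Sheltered r R 1 ω) (h2 : Sheltered r R (-1) ω)
    (h3 : ω ∈ SlabEv r) (hY : ω' ∈ StemEv r)
    (h : ∀ v ∈ core r, -7 * r < v.2 → ω v = ω' v) : IsolatedArm r R ω := by
  obtain ⟨⟨a1, a2⟩, z, t, ha, haz, ht, hzt⟩ := hq
  obtain ⟨u₁, u₂, hu₁, hu₂, hL⟩ := exists_arch (by omega) (by omega) (by omega) (by omega)
    hY.1.1.1 hY.1.1.2 hY.1.2
  obtain ⟨c, hc, d, hd, hcd⟩ := hY.2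
  have hc : c.2 = -3 * r := hc
  have hd : d.2 = 5 * r := hd
  have hcr := hcd.left_mem.2
  rw [mem_rect] at hcr
  rw [mem_hBox_zero] at ha
  simp only at ha
  obtain ⟨ht1, ht2⟩ := ht
  rw [mem_hBox_zero] at ht1
  -- the arch meets the arm and the stem
  set L : Set Site := {w | Conn ({v | ω' v = false} ∩ {v | -(3 * r) ≤ v.1 ∧ v.1 ≤ 3 * r ∧ 0 ≤ v.2 ∧
    v.2 ≤ 5 * r ∧ (v.1 ≤ -(2 * r) ∨ 2 * r ≤ v.1 ∨ 4 * r ≤ v.2)}) (u₁, 0) w} with hLdef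
  have hL' : Conn L (u₁, 0) (u₂, 0) := hL.within_cluster
  have hLm : ∀ p ∈ L, -(3 * r) ≤ p.1 ∧ p.1 ≤ 3 * r ∧ 0 ≤ p.2 ∧
    p.2 ≤ 5 * r ∧ (p.1 ≤ -(2 * r) ∨ 2 * r ≤ p.1 ∨ 4 * r ≤ p.2) := fun p hp => hp.right_mem.2
  obtain ⟨p, hp, hzp⟩ : ∃ p ∈ L, Conn ({v | ω v = false} ∩
      (horseshoe r R \ (sideHull r R 1 ω ∪ sideHull r R (-1) ω))) z p := by
    by_contra hcon
    push Not at hcon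
    have hQ : Conn (hBox 0 0 r ∪ {p | Conn ({v | ω v = false} ∩
        (horseshoe r R \ (sideHull r R 1 ω ∪ sideHull r R (-1) ω))) z p}) (a1, 0) t :=
      ((Conn.vert a1 0 a2 fun y h1 h2 => .inl
        (by rw [mem_hBox_zero]; simp only; omega)).tail haz (.inr (Conn.refl hzt.left_mem))).trans
        (hzt.within_cluster.mono Set.subset_union_right)
    have := no_cross hL' (fun p hp => (hLm p hp).2.2.1) hQ ?_ ?_ ?_
    · omega
    · rintro p (hp | hp)
      · rw [mem_hBox_zero] at hp; omega
      · have := hp.right_mem.2.1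
        rw [mem_horseshoe] at this; omega
    · rintro p hp (hp' | hp')
      · have := hLm p hp
        rw [mem_hBox_zero] at hp'; omega
      · exact hcon p hp hp'
    · intro p hp hpt
      have := hLm p hp
      omega
  obtain ⟨q, hq, hcq⟩ : ∃ q ∈ L, Conn ({v | ω' v = false} ∩ rect 0 r (-3 * r) (5 * r)) c q := by
    by_contra hcon
    push Not at hcon
    obtain ⟨⟨c1, c2⟩, ⟨d1, d2⟩, hc', hd', hcd'⟩ :=
      hcd.within_cluster.sub_vert (y₀ := 0) (y₁ := 5 * r) (by omega) (by omega) (by omega)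
    simp only at hc' hd'
    subst hc' hd'
    have hQ : Conn (({w | Conn ({v | ω' v = false} ∩ rect 0 r (-3 * r) (5 * r)) c w} ∩
        {v | 0 ≤ v.2 ∧ v.2 ≤ 5 * r}) ∪ {(d1, 5 * r + 1)}) (c1, 0) (d1, 5 * r + 1) :=
      (hcd'.mono Set.subset_union_left).tail (by rw [adj_iff]; simp) (.inr rfl)
    have hcm := hcd'.left_mem.1.right_mem.2
    rw [mem_rect] at hcm
    simp only at hcm
    have := no_cross hL' (fun p hp => (hLm p hp).2.2.1) hQ ?_ ?_ ?_
    · omega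
    · rintro p (hp | rfl)
      · exact hp.2.1
      · simp only; omega
    · rintro p hp (hp' | rfl)
      · exact hcon p hp hp'.1
      · have := hLm _ hp
        simp only at this; omega
    · intro p hp hpt
      have := hLm p hp
      simp only; omega
  -- the connection
  have hclosed : ∀ {v : Site}, -3 * r ≤ v.1 → v.1 ≤ 3 * r → -3 * r ≤ v.2 → v.2 ≤ 5 * r →
      ω' v = false → v ∈ {v | ω v = false} ∩ region r R := by
    intro v h1 h2 h3 h4 h5
    refine ⟨?_, ?_⟩
    · show ω v = false
      rw [h v ?_ (by omega), h5]
      rw [mem_core]; omega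
    · rw [mem_region]; omega
  have hzreg : ∀ {z p}, Conn ({v | ω v = false} ∩
      (horseshoe r R \ (sideHull r R 1 ω ∪ sideHull r R (-1) ω))) z p →
      Conn ({v | ω v = false} ∩ region r R) z p := by
    intro z p hzp
    refine hzp.mono fun v hv => ⟨hv.1, ?_⟩
    have := hv.2.1
    rw [mem_horseshoe] at this
    rw [mem_region]; omega
  have hqp : Conn ({v | ω v = false} ∩ region r R) q p := by
    refine (hq.symm.trans hp).mono fun v hv => ?_
    have := hv.2
    simp only [Set.mem_ofPred_eq] at this
    exact hclosed (by omega) (by omega) (by omega) (by omega) hv.1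
  refine ⟨c, t, by omega, by omega, hc, ⟨by rwa [mem_hBox_zero], ht2⟩, ?_, ?_⟩
  · refine ((hcq.mono fun v hv => ?_).trans hqp).trans ((hzreg hzp).symm.trans (hzreg hzt))
    have := hv.2
    rw [mem_rect] at this
    exact hclosed (by omega) (by omega) (by omega) (by omega) hv.1
  · have hcc : c ∈ core r := by rw [mem_core]; omega
    rintro s ((hs | hs) | hs) hsc
    · exact h1 c (Reach.conn (Reach.base hs) hsc) (.inl hcc)
    · exact h2 c (Reach.conn (Reach.base hs) hsc) (.inl hcc)
    · obtain ⟨hs1, hs2, hs3⟩ := hs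
      obtain ⟨a, ha, b, hb, hab⟩ := h3
      obtain ⟨s', c', hs', hc', hsc'⟩ := hsc.sub_vert (y₀ := -8 * r) (y₁ := -7 * r) (by omega)
        (by omega) (by omega)
      have hq : ∀ v ∈ (({v | ω v = false} ∩ region r R) ∩ {v : Site | -8 * r ≤ v.2 ∧ v.2 ≤ -7 * r} : Set Site),
          v ∈ rect (-6 * r) (6 * r) (-8 * r) (-7 * r) := by
        rintro v ⟨⟨-, h4⟩, h5⟩
        rw [mem_region] at h4
        simp only [Set.mem_ofPred_eq] at h5
        rw [mem_rect]; omega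
      obtain ⟨p, hp1, hp2⟩ := rect_cross hab (fun v hv => hv.2) ha hb hsc' hq hs' hc'
      have h4 : ω p = true := hp1.1
      have h5 : ω p = false := hp2.1.1
      rw [h4] at h5; cases h5

theorem horseshoe_subset_region {r : ℤ} (R : ℤ) : horseshoe r R ⊆ region r R := by
  intro v hv
  rw [mem_horseshoe] at hv
  rw [mem_region]
  omega

theorem IsolatedArm.finDep (r R : ℤ) : FinDep {ω | IsolatedArm r R ω} := by
  refine ⟨_, region_finite r R, fun ω ω' h hω => ?_⟩
  simp only [Set.mem_ofPred_eq, IsolatedArm] at hω ⊢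
  rwa [color_inter_congr false h] at hω

theorem ShelteredArm.finDep {r : ℤ} (hr : 1 ≤ r) (R : ℤ) : FinDep {ω | ShelteredArm r R ω} := by
  refine ⟨_, region_finite r R, fun ω ω' h hω => ?_⟩
  simp only [Set.mem_ofPred_eq, ShelteredArm] at hω ⊢
  rw [(sideHull_stopping r R 1).congr (sideHull_subset hr (.inl rfl)) h,
    (sideHull_stopping r R (-1)).congr (sideHull_subset hr (.inr rfl)) h]
  have e : ∀ S : Set Site, {v | ω' v = false} ∩ (horseshoe r R \ S) =
      {v | ω v = false} ∩ (horseshoe r R \ S) := fun S =>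
    (color_inter_congr false fun v hv => h v (horseshoe_subset_region R hv.1)).symm
  rwa [e]

theorem StemEv.finDep (r : ℤ) : FinDep (StemEv r) := (ArchEv.finDep ..).inter (VC.finDep ..)

theorem StemEv.isLowerSet (r : ℤ) : IsLowerSet (StemEv r) :=
  (ArchEv.isLowerSet ..).inter (VC.isLowerSet ..)

theorem StemEv.ge {μ : Measure Config} (hμ : IsBernoulliHalf μ) {r : ℤ} (hr : 1 ≤ r) :
    rsw ^ 4 ≤ μ.real (StemEv r) := by
  have h1 := ArchEv.ge hμ false (A := 2 * r) (B := 3 * r) (y₀ := 0) (y₁ := 4 * r) (y₂ := 5 * r)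
    (by omega) (by omega) (by omega) (by omega) (by omega) (by omega)
  have h2 := VC.ge hμ false (x₀ := 0) (x₁ := r) (y₀ := -3 * r) (y₁ := 5 * r) (by omega) (by omega)
    (by omega)
  have h3 := hμ.fkg_lower (ArchEv.finDep false (2 * r) (3 * r) 0 (4 * r) (5 * r))
    (VC.finDep false 0 r (-3 * r) (5 * r)) (ArchEv.isLowerSet ..) (VC.isLowerSet ..)
  refine le_trans ?_ h3
  rw [pow_succ]
  exact mul_le_mul h1 h2 rsw_pos.le measureReal_nonneg

theorem isolatedArm_ge_shelteredArm {μ : Measure Config} (hμ : IsBernoulliHalf μ) {r R : ℤ}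
    (hr : 1 ≤ r) (hrR : 6 * r ≤ R) :
    rsw ^ 4 * μ.real ((({ω | Sheltered r R 1 ω} ∩ {ω | Sheltered r R (-1) ω}) ∩ SlabEv r) ∩
      {ω | ShelteredArm r R ω}) ≤ μ.real {ω | IsolatedArm r R ω} := by
  refine (mul_le_mul_of_nonneg_right (StemEv.ge hμ hr) measureReal_nonneg).trans ?_
  set F := (({ω | Sheltered r R 1 ω} ∩ {ω | Sheltered r R (-1) ω}) ∩ SlabEv r) ∩
    {ω | ShelteredArm r R ω} with hFdef
  have hF : FinDep F := (((Sheltered.finDep hr (.inl rfl)).inter (Sheltered.finDep hr (.inr rfl))).inter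
    (HC.finDep ..)).inter (ShelteredArm.finDep hr R)
  have hAs := ((sideHull_stopping r R 1).union (sideHull_stopping r R (-1))).union
    (Stopping.const (rect (-6 * r) (6 * r) (-8 * r) (-7 * r)))
  refine hμ.mix_le hF (IsolatedArm.finDep r R) hAs fun ω => ?_
  set A := (sideHull r R 1 ω ∪ sideHull r R (-1) ω) ∪ rect (-6 * r) (6 * r) (-8 * r) (-7 * r)
    with hAdef
  have e1 : ∀ ω', sideHull r R 1 (mix A ω ω') = sideHull r R 1 ω := fun ω' =>
    sideHull_stopping r R 1 _ _ fun v hv => (mix_of_mem (.inl (.inl hv))).symm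
  have e2 : ∀ ω', sideHull r R (-1) (mix A ω ω') = sideHull r R (-1) ω := fun ω' =>
    sideHull_stopping r R (-1) _ _ fun v hv => (mix_of_mem (.inl (.inr hv))).symm
  refine (hμ.fkg_lower (StemEv.finDep r) (hF.mix A ω) (StemEv.isLowerSet r) ?_).trans
    (hμ.real_mono ?_)
  · rintro ω₁ ω₂ h12 ⟨⟨⟨h1, h2⟩, h3⟩, h4⟩
    refine ⟨⟨⟨?_, ?_⟩, ?_⟩, ?_⟩
    · intro v hv
      rw [e1] at hv
      exact h1 v (by rwa [e1])
    · intro v hv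
      rw [e2] at hv
      exact h2 v (by rwa [e2])
    · refine HC.depOn _ _ _ _ _ _ _ (fun v hv => ?_) h3
      rw [mix_of_mem (.inr hv), mix_of_mem (.inr hv)]
    · obtain ⟨a, z, t, ha, haz, ht, hzt⟩ := h4
      refine ⟨a, z, t, ha, haz, ht, ?_⟩
      rw [e1, e2] at hzt ⊢
      exact hzt.mono (Set.inter_subset_inter_left _ (closed_anti (mix_mono A ω h12)))
  · rintro ω' ⟨h1, ⟨⟨h2, h3⟩, h4⟩, h5⟩
    refine isolatedArm_of hr hrR h5 h2 h3 h4 h1 fun v hv hv2 => mix_of_notMem ?_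
    rintro ((h6 | h6) | h6)
    · exact h2 v (by rwa [e1]) (.inl hv)
    · exact h3 v (by rwa [e2]) (.inl hv)
    · rw [mem_rect] at h6; omega

theorem isolatedArm_ge {μ : Measure Config} (hμ : IsBernoulliHalf μ) {r R : ℤ}
    (hr : 1 ≤ r) (hrR : 6 * r ≤ R) :
    rsw ^ 11 * μ.real {ω | J3 0 0 r R ω} ≤ μ.real {ω | IsolatedArm r R ω} := by
  have hp := rsw_pos
  have h1 : μ.real {ω | J3 0 0 r R ω} ≤ μ.real {ω | Separated r R ω} :=
    hμ.real_mono fun ω h => J3.separated (by omega) (by omega) h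
  have h2 := sheltered_left_ge hμ (R := R) hr
  have h3 := sheltered_right_ge hμ (R := R) hr
  have h4 := isolatedArm_ge_shelteredArm hμ hr hrR
  have h5 : μ.real ((({ω | Separated r R ω} ∩ {ω | Sheltered r R (-1) ω}) ∩ SlabEv r) ∩
        {ω | Sheltered r R 1 ω}) ≤
      μ.real ((({ω | Sheltered r R 1 ω} ∩ {ω | Sheltered r R (-1) ω}) ∩ SlabEv r) ∩
        {ω | ShelteredArm r R ω}) := by
    refine hμ.real_mono ?_
    rintro ω ⟨⟨⟨h6, h7⟩, h8⟩, h9⟩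
    exact ⟨⟨⟨h9, h7⟩, h8⟩, Separated.shelteredArm hr (by omega) h6 h9 h7⟩
  calc rsw ^ 11 * μ.real {ω | J3 0 0 r R ω} ≤ rsw ^ 11 * μ.real {ω | Separated r R ω} := by gcongr
    _ = rsw ^ 4 * (rsw ^ 3 * (rsw ^ 4 * μ.real {ω | Separated r R ω})) := by ring
    _ ≤ _ := le_trans (by gcongr; exact (mul_le_mul_of_nonneg_left h2 (by positivity)).trans (h3.trans h5)) h4

/-- There are `k` disjoint closed connections from `A` to `B` in `D`; they are told apart by a
labelling of the sites. -/
def Crossings (k : ℕ) (D A B : Set Site) : Set Config :=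
  {ω | ∃ g : Site → ℕ, ∀ i < k, ∃ a ∈ A, ∃ b ∈ B, Conn ({v | ω v = false} ∩ (D ∩ {v | g v = i})) a b}

theorem Crossings.depOn (k : ℕ) (D A B : Set Site) : DepOn D (Crossings k D A B) := by
  rintro ω ω' h ⟨g, hg⟩
  refine ⟨g, fun i hi => ?_⟩
  have := hg i hi
  rwa [color_inter_congr false fun v hv => h v hv.1] at this

theorem Crossings.finDep {D : Set Site} (hD : D.Finite) (k : ℕ) (A B : Set Site) :
    FinDep (Crossings k D A B) := ⟨D, hD, Crossings.depOn k D A B⟩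

theorem Crossings.anti {k l : ℕ} (h : k ≤ l) (D A B : Set Site) :
    Crossings l D A B ⊆ Crossings k D A B := by
  rintro ω ⟨g, hg⟩
  exact ⟨g, fun i hi => hg i (hi.trans_le h)⟩

/-- A crossing connected to the bottom lies below any disjoint crossing which does not meet the
connection. -/
theorem le_of_conn_bottom {C₁ C₂ U : Set Site} {x₀ x₁ y₀ y₁ : ℤ} {a₁ b₁ a₂ p s : Site}
    (h1 : Conn C₁ a₁ b₁) (h2 : Conn C₂ a₂ p) (hU : Conn U s p)
    (hC₁ : C₁ ⊆ rect x₀ x₁ y₀ y₁) (hC₂ : C₂ ⊆ rect x₀ x₁ y₀ y₁) (hUr : U ⊆ rect x₀ x₁ y₀ y₁)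
    (hd : ∀ v ∈ C₁, v ∉ C₂) (hd' : ∀ v ∈ C₁, v ∉ U) (ha₁ : a₁.1 = x₀) (hb₁ : b₁.1 = x₁)
    (ha₂ : a₂.1 = x₀) (hs : s.2 = y₀) : a₂.2 ≤ a₁.2 := by
  by_contra hlt
  push Not at hlt
  obtain ⟨a, k₁⟩ := a₁
  obtain ⟨a', k₂⟩ := a₂
  simp only at ha₁ ha₂ hlt
  subst ha₁ ha₂
  have r1 := hC₁ h1.left_mem
  have r2 := hC₂ h2.left_mem
  rw [mem_rect] at r1 r2
  simp only at r1 r2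
  set P : Set Site := C₁ ∪ {(a' - 1, k₁)} with hP
  set col : Set Site := {v | v.1 = a' - 1 ∧ k₂ ≤ v.2 ∧ v.2 ≤ y₁} with hcol
  set Q : Set Site := (C₂ ∪ U) ∪ col with hQ
  have hPc : Conn P (a' - 1, k₁) b₁ :=
    (Conn.of_adj (.inr rfl) (by rw [adj_iff]; simp) (.inl h1.left_mem)).trans
      (h1.mono Set.subset_union_left)
  have hQc : Conn Q s (a' - 1, y₁) := by
    refine (hU.mono fun v hv => .inl (.inr hv)).trans
      ((h2.symm.mono fun v hv => .inl (.inl hv)).trans ?_)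
    have h3 : (a' - 1, k₂) ∈ Q := .inr ⟨rfl, le_rfl, r2.2.2.2⟩
    have h4 : Conn Q (a' - 1, k₂) (a' - 1, y₁) := Conn.vert _ _ _ fun y h3 h4 => .inr (by
      rw [min_eq_left (by omega)] at h3
      rw [max_eq_right (by omega)] at h4
      exact ⟨rfl, h3, h4⟩)
    exact (Conn.of_adj (.inl (.inl h2.left_mem)) (by rw [adj_iff]; simp) h3).trans h4
  have hPr : P ⊆ rect (a' - 1) x₁ y₀ y₁ := by
    rintro v (hv | rfl)
    · have := hC₁ hv
      rw [mem_rect] at this ⊢; omega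
    · rw [mem_rect]; simp only; omega
  have hQr : Q ⊆ rect (a' - 1) x₁ y₀ y₁ := by
    rintro v ((hv | hv) | hv)
    · have := hC₂ hv
      rw [mem_rect] at this ⊢; omega
    · have := hUr hv
      rw [mem_rect] at this ⊢; omega
    · simp only [hcol, Set.mem_ofPred_eq] at hv
      rw [mem_rect]; omega
  obtain ⟨v, hv, hv'⟩ := rect_cross hPc hPr rfl hb₁ hQc hQr hs rfl
  rcases hv with hv | rfl
  · rcases hv' with (h | h) | h
    · exact hd v hv h
    · exact hd' v hv h
    · have := hC₁ hv
      rw [mem_rect] at this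
      simp only [hcol, Set.mem_ofPred_eq] at h
      omega
  · rcases hv' with (h | h) | h
    · have := hC₂ h
      rw [mem_rect] at this
      simp only at this; omega
    · have := hUr h
      rw [mem_rect] at this
      simp only at this; omega
    · simp only [hcol, Set.mem_ofPred_eq] at h
      omega

/-- The sites reached from the bottom side of a rectangle by open sites. -/
def bottomHull (x₀ x₁ y₀ y₁ : ℤ) (ω : Config) : Set Site :=
  {v | Reach (rectBot x₀ x₁ y₀ y₁) (rect x₀ x₁ y₀ y₁) {v | ω v = true} v}

theorem bottomHull_stopping (x₀ x₁ y₀ y₁ : ℤ) : Stopping (bottomHull x₀ x₁ y₀ y₁) :=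
  (Stopping.const _).reach' _ true

theorem bottomHull_conn {x₀ x₁ y₀ y₁ : ℤ} {ω : Config} {v : Site}
    (hv : v ∈ bottomHull x₀ x₁ y₀ y₁ ω) :
    ∃ s : Site, s.2 = y₀ ∧ Conn (({v | ω v = true} ∪ {v}) ∩ rect x₀ x₁ y₀ y₁) s v := by
  rcases Reach.exists_conn hv with h | ⟨s, hs, -, u, hsu, huv, hv'⟩
  · exact ⟨v, h.2, Conn.refl ⟨.inr rfl, h.1⟩⟩
  · refine ⟨s, hs.2, (hsu.mono ?_).tail huv ⟨.inr rfl, hv'⟩⟩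
    rintro w ⟨⟨-, h1⟩, h2⟩
    exact ⟨.inl h1, h2.elim (fun h => h.1) id⟩

/-- The sites of the hull of the bottom side on the top side are closed. -/
def bottomBlocked (x₀ x₁ y₀ y₁ : ℤ) : Set Config :=
  {ω | ∀ v ∈ bottomHull x₀ x₁ y₀ y₁ ω, v.2 = y₁ → ω v = false}

theorem bottomHull_subset (x₀ x₁ y₀ y₁ : ℤ) (ω : Config) :
    bottomHull x₀ x₁ y₀ y₁ ω ⊆ rect x₀ x₁ y₀ y₁ := fun _ hv =>
  (Reach.mem hv).elim (fun h => h.1) id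

theorem bottomBlocked.finDep (x₀ x₁ y₀ y₁ : ℤ) : FinDep (bottomBlocked x₀ x₁ y₀ y₁) := by
  refine ⟨_, rect_finite x₀ x₁ y₀ y₁, fun ω ω' h hω v hv hv1 => ?_⟩
  rw [(bottomHull_stopping x₀ x₁ y₀ y₁).congr (bottomHull_subset x₀ x₁ y₀ y₁) h] at hv
  rw [← h v (bottomHull_subset _ _ _ _ _ hv)]
  exact hω v hv hv1

theorem bottomBlocked.real_le {μ : Measure Config} (hμ : IsBernoulliHalf μ) {x₀ x₁ y₀ y₁ : ℤ}
    (hx : x₀ < x₁) (hy : y₀ ≤ y₁) (h : y₁ - y₀ ≤ 16 * (x₁ - x₀)) :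
    μ.real (bottomBlocked x₀ x₁ y₀ y₁) ≤ 1 - rsw := by
  have h1 := VC.ge hμ true hy hx h
  have h2 : μ.real (bottomBlocked x₀ x₁ y₀ y₁) ≤ μ.real (VC true x₀ x₁ y₀ y₁)ᶜ := by
    refine hμ.real_mono ?_
    rintro ω hω ⟨a, ha, b, hb, hab⟩
    have h3 := hω b (Reach.conn (Reach.base ⟨hab.left_mem.2, ha⟩) hab) hb
    have h4 : ω b = true := hab.right_mem.1
    rw [h3] at h4; cases h4
  rw [hμ.real_compl (VC.finDep ..)] at h2
  linarith

theorem Crossings.blocked {k : ℕ} (hk : 0 < k) {x₀ x₁ y₀ y₁ : ℤ} {ω : Config}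
    (h : ω ∈ Crossings k (rect x₀ x₁ y₀ y₁) {v | v.1 = x₀} {v | v.1 = x₁}) :
    ω ∈ bottomBlocked x₀ x₁ y₀ y₁ := by
  obtain ⟨g, hg⟩ := h
  obtain ⟨a, ha, b, hb, hab⟩ := hg 0 hk
  intro v hv hv1
  by_contra hcon
  simp only [Bool.not_eq_false] at hcon
  obtain ⟨s, hs, hsv⟩ := bottomHull_conn hv
  obtain ⟨p, hp1, hp2⟩ := rect_cross hab (fun v hv => hv.2.1) ha hb hsv (fun v hv => hv.2) hs hv1
  have h4 : ω p = false := hp1.1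
  rcases hp2.1 with h5 | rfl
  · have h5 : ω p = true := h5
    rw [h4] at h5; cases h5
  · rw [h4] at hcon; cases hcon

/-- All but one of the crossings avoid the hull of the bottom side. -/
theorem Crossings.avoid {k : ℕ} {x₀ x₁ y₀ y₁ : ℤ} {ω : Config}
    (h : ω ∈ Crossings (k + 1) (rect x₀ x₁ y₀ y₁) {v | v.1 = x₀} {v | v.1 = x₁}) :
    ω ∈ Crossings k (rect x₀ x₁ y₀ y₁) {v | v.1 = x₀} {v | v.1 = x₁} ∧
    ∃ g : Site → ℕ, ∀ i < k, ∃ a ∈ {v : Site | v.1 = x₀}, ∃ b ∈ {v : Site | v.1 = x₁},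
      Conn (({v | ω v = false} \ bottomHull x₀ x₁ y₀ y₁ ω) ∩
        (rect x₀ x₁ y₀ y₁ ∩ {v | g v = i})) a b := by
  refine ⟨Crossings.anti (Nat.le_succ k) _ _ _ h, ?_⟩
  obtain ⟨g, hg⟩ := h
  set S : ℕ → Set Site := fun i => {v | ω v = false} ∩ (rect x₀ x₁ y₀ y₁ ∩ {v | g v = i}) with hS
  choose! a ha b hb hab using hg
  set T := bottomHull x₀ x₁ y₀ y₁ ω with hT
  set bad : ℕ → Prop := fun i => ∃ p ∈ T, Conn (S i) (a i) p with hbad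
  have key : ∀ i < k + 1, ∀ j < k + 1, bad j → i ≠ j → (a j).2 ≤ (a i).2 := by
    rintro i hi j hj ⟨p, hp, hjp⟩ hij
    obtain ⟨s, hs, hsp⟩ := bottomHull_conn hp
    have hdj : ∀ v ∈ S i, v ∉ S j := by
      rintro v ⟨-, -, h1⟩ ⟨-, -, h2⟩
      have h1 : g v = i := h1
      exact hij (h1.symm.trans h2)
    refine le_of_conn_bottom (hab i hi) hjp hsp (fun v hv => hv.2.1) (fun v hv => hv.2.1)
      (fun v hv => hv.2) hdj ?_ (ha i hi) (hb i hi) (ha j hj) hs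
    rintro v hv ⟨h1 | h1, -⟩
    · have h2 : ω v = false := hv.1
      have h1 : ω v = true := h1
      rw [h1] at h2; cases h2
    · have h1 : v = p := h1
      exact hdj v hv (h1 ▸ hjp.right_mem)
  have huniq : ∀ i < k + 1, ∀ j < k + 1, bad i → bad j → i = j := by
    intro i hi j hj hbi hbj
    by_contra hij
    have h1 := key i hi j hj hbj hij
    have h2 := key j hj i hi hbi (Ne.symm hij)
    have h3 : a i = a j := Prod.ext ((ha i hi).trans (ha j hj).symm) (by omega)
    have h4 := (hab i hi).left_mem.2.2
    have h5 := (hab j hj).left_mem.2.2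
    simp only [Set.mem_ofPred_eq] at h4 h5
    rw [h3] at h4
    exact hij (h4.symm.trans h5)
  obtain ⟨m, hm, hgood⟩ : ∃ m < k + 1, ∀ i < k + 1, i ≠ m → ¬ bad i := by
    by_cases hex : ∃ m < k + 1, bad m
    · obtain ⟨m, hm, hmb⟩ := hex
      exact ⟨m, hm, fun i hi him hib => him (huniq i hi m hm hib hmb)⟩
    · push Not at hex
      exact ⟨k, Nat.lt_succ_self k, fun i hi _ => hex i hi⟩
  refine ⟨fun v => Equiv.swap m k (g v), fun i hi => ?_⟩
  set j := Equiv.swap m k i with hj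
  have hjm : j ≠ m := by
    rw [hj]
    intro h
    have : i = k := by
      have := congrArg (Equiv.swap m k) h
      simpa using this
    omega
  have hjk : j < k + 1 := by
    rw [hj, Equiv.swap_apply_def]
    split_ifs <;> omega
  refine ⟨a j, ha j hjk, b j, hb j hjk, (hab j hjk).within_cluster.mono fun v hv => ?_⟩
  have hv' := hv.right_mem
  refine ⟨⟨hv'.1, fun h => hgood j hjk hjm ⟨v, h, hv⟩⟩, hv'.2.1, ?_⟩
  have h1 : g v = j := hv'.2.2
  simp only [Set.mem_ofPred_eq]
  rw [h1, hj, Equiv.swap_apply_self]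

theorem Crossings.real_succ_le {μ : Measure Config} (hμ : IsBernoulliHalf μ) {x₀ x₁ y₀ y₁ : ℤ}
    (hx : x₀ < x₁) (hy : y₀ ≤ y₁) (h : y₁ - y₀ ≤ 16 * (x₁ - x₀)) (k : ℕ) :
    μ.real (Crossings (k + 1) (rect x₀ x₁ y₀ y₁) {v | v.1 = x₀} {v | v.1 = x₁}) ≤
      (1 - rsw) * μ.real (Crossings k (rect x₀ x₁ y₀ y₁) {v | v.1 = x₀} {v | v.1 = x₁}) := by
  set F := Crossings (k + 1) (rect x₀ x₁ y₀ y₁) {v | v.1 = x₀} {v | v.1 = x₁} with hF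
  set G := Crossings k (rect x₀ x₁ y₀ y₁) {v | v.1 = x₀} {v | v.1 = x₁} with hG
  have hFG : μ.real F ≤ μ.real G := hμ.real_mono (Crossings.anti (Nat.le_succ k) _ _ _)
  rcases (measureReal_nonneg (μ := μ) (s := G)).eq_or_lt with h0 | h0
  · rw [← h0] at hFG ⊢
    simpa using hFG
  have hfin : ∀ k, FinDep (Crossings k (rect x₀ x₁ y₀ y₁) {v | v.1 = x₀} {v | v.1 = x₁}) :=
    fun k => Crossings.finDep (rect_finite ..) k _ _
  have hle : (μ.real G)⁻¹ * μ.real F ≤ μ.real (bottomBlocked x₀ x₁ y₀ y₁) := by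
    refine hμ.mix_le (hfin _) (bottomBlocked.finDep ..) (bottomHull_stopping x₀ x₁ y₀ y₁)
      fun ω => ?_
    have hA := (bottomHull_stopping x₀ x₁ y₀ y₁).mix ω
    set A := bottomHull x₀ x₁ y₀ y₁ ω with hAdef
    by_cases hω : ω ∈ bottomBlocked x₀ x₁ y₀ y₁
    · have h1 : {ω' | mix A ω ω' ∈ bottomBlocked x₀ x₁ y₀ y₁} = Set.univ := by
        refine Set.eq_univ_of_forall fun ω' v hv hv1 => ?_
        rw [hA] at hv
        rw [mix_of_mem hv]
        exact hω v hv hv1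
      have := hμ.1
      rw [h1, probReal_univ, inv_mul_le_iff₀ h0, mul_one]
      refine hμ.real_mono fun ω' hω' => ?_
      obtain ⟨-, g, hg⟩ := Crossings.avoid hω'
      refine ⟨g, fun i hi => ?_⟩
      obtain ⟨a, ha, b, hb, hab⟩ := hg i hi
      refine ⟨a, ha, b, hb, hab.mono ?_⟩
      rintro v ⟨⟨h2, h3⟩, h4⟩
      rw [hA] at h3
      refine ⟨?_, h4⟩
      simp only [Set.mem_ofPred_eq] at h2
      rwa [mix_of_notMem h3] at h2
    · have h1 : {ω' | mix A ω ω' ∈ F} = ∅ := by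
        refine Set.eq_empty_of_forall_notMem fun ω' hω' => hω fun v hv hv1 => ?_
        have := Crossings.blocked (Nat.succ_pos k) hω' v (by rwa [hA]) hv1
        rwa [mix_of_mem hv] at this
      rw [h1]
      simp
  have h2 := hle.trans (bottomBlocked.real_le hμ hx hy h)
  rwa [inv_mul_le_iff₀ h0, mul_comm] at h2

theorem Crossings.real_le {μ : Measure Config} (hμ : IsBernoulliHalf μ) {x₀ x₁ y₀ y₁ : ℤ}
    (hx : x₀ < x₁) (hy : y₀ ≤ y₁) (h : y₁ - y₀ ≤ 16 * (x₁ - x₀)) (k : ℕ) :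
    μ.real (Crossings k (rect x₀ x₁ y₀ y₁) {v | v.1 = x₀} {v | v.1 = x₁}) ≤ (1 - rsw) ^ k := by
  induction k with
  | zero => simpa using hμ.real_le_one _
  | succ k ih =>
    refine (Crossings.real_succ_le hμ hx hy h k).trans ?_
    rw [pow_succ']
    exact mul_le_mul_of_nonneg_left ih (by linarith [rsw_le_one])

theorem Crossings.real_le_vert {μ : Measure Config} (hμ : IsBernoulliHalf μ) {x₀ x₁ y₀ y₁ : ℤ}
    (hx : x₀ ≤ x₁) (hy : y₀ < y₁) (h : x₁ - x₀ ≤ 16 * (y₁ - y₀)) (k : ℕ) :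
    μ.real (Crossings k (rect x₀ x₁ y₀ y₁) {v | v.2 = y₀} {v | v.2 = y₁}) ≤ (1 - rsw) ^ k := by
  refine le_trans ?_ (Crossings.real_le hμ hy hx h k)
  rw [← hμ.comp_equiv swapSite (Crossings.finDep (rect_finite x₀ x₁ y₀ y₁) k _ _)]
  refine hμ.real_mono ?_
  rintro ω ⟨g, hg⟩
  refine ⟨fun v => g (swapSite v), fun i hi => ?_⟩
  obtain ⟨a, ha, b, hb, hab⟩ := hg i hi
  refine ⟨swapSite a, ha, swapSite b, hb, hab.map swapSite_adj ?_⟩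
  rintro v ⟨h1, h2, h3⟩
  refine ⟨h1, ?_, h3⟩
  rw [mem_rect] at h2 ⊢
  exact ⟨h2.2.2.1, h2.2.2.2, h2.1, h2.2.1⟩

/-- The translate of `region` by `p`. -/
def regionAt (r R : ℤ) (p : Site) : Set Site := {v | (v.1 - p.1, v.2 - p.2) ∈ region r R}

theorem mem_regionAt {r R : ℤ} {p v : Site} : v ∈ regionAt r R p ↔
    (-R ≤ v.1 - p.1 ∧ v.1 - p.1 ≤ R ∧ 0 ≤ v.2 - p.2 ∧ v.2 - p.2 ≤ 2 * R) ∨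
    (-6 * r ≤ v.1 - p.1 ∧ v.1 - p.1 ≤ 6 * r ∧ -8 * r ≤ v.2 - p.2 ∧ v.2 - p.2 ≤ -1) := by
  simp only [regionAt, Set.mem_ofPred_eq, mem_region]

/-- The root of an isolated arm in the translate of `region` by `p`. -/
def IsolatedRoot (r R : ℤ) (p : Site) (ω : Config) (z : Site) : Prop :=
  -r ≤ z.1 - p.1 ∧ z.1 - p.1 ≤ r ∧ z.2 - p.2 = -3 * r ∧
    ∀ s, (s.1 - p.1, s.2 - p.2) ∈ lowerSide r R →
      ¬ Conn ({v | ω v = false} ∩ regionAt r R p) s z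

/-- The event that there is an isolated arm in the translate of `region` by `p`. -/
def IsolatedArmAt (r R : ℤ) (p : Site) : Set Config :=
  {ω | ∃ z t : Site, IsolatedRoot r R p ω z ∧ (t.1 - p.1, t.2 - p.2) ∈ hBoxPlus 0 0 R ∧
    Conn ({v | ω v = false} ∩ regionAt r R p) z t}

theorem isolatedArm_real_le {μ : Measure Config} (hμ : IsBernoulliHalf μ) (r R : ℤ) (p : Site) :
    μ.real {ω | IsolatedArm r R ω} ≤ μ.real (IsolatedArmAt r R p) := by
  rw [← hμ.comp_equiv (shiftSite p) (IsolatedArm.finDep r R)]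
  refine hμ.real_mono ?_
  rintro ω ⟨z, t, h1, h2, h3, h4, h5, h6⟩
  have e : ∀ v : Site, (((shiftSite p) v).1 - p.1, ((shiftSite p) v).2 - p.2) = v := fun v => by
    simp [shiftSite_apply]
  refine ⟨shiftSite p z, shiftSite p t, ⟨?_, ?_, ?_, fun s hs hc => ?_⟩, ?_, ?_⟩
  · simp only [shiftSite_apply]; omega
  · simp only [shiftSite_apply]; omega
  · simp only [shiftSite_apply]; omega
  · refine h6 _ hs ?_
    have := hc.map (f := fun v => (v.1 - p.1, v.2 - p.2)) (T := {v | ω (shiftSite p v) = false} ∩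
      region r R) (fun a b h => by rw [adj_iff] at *; simp only; omega) ?_
    · simpa only [e] using this
    · rintro v ⟨hv1, hv2⟩
      refine ⟨?_, hv2⟩
      simpa [shiftSite_apply] using hv1
  · rwa [e]
  · refine h5.map (shiftSite_adj p) ?_
    rintro v ⟨hv1, hv2⟩
    refine ⟨hv1, ?_⟩
    simp only [regionAt, Set.mem_ofPred_eq]
    rwa [e]

/-- The square in which the isolated arms are compared. -/
abbrev square (h : ℤ) : Set Site := rect (-2 * h) (2 * h) (-2 * h) (2 * h)

/-- Isolated roots of separated boxes are not connected. -/
theorem IsolatedRoot.not_conn {r h : ℤ} (hr : 1 ≤ r) {p p' : Site}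
    (hp : 0 ≤ p.1 ∧ p.1 ≤ h ∧ 0 ≤ p.2 ∧ p.2 ≤ h)
    (hpp : p'.2 + 16 * r ≤ p.2 ∨ (p'.2 = p.2 ∧ (p'.1 + 16 * r ≤ p.1 ∨ p.1 + 16 * r ≤ p'.1)))
    {ω : Config} {z z' : Site} (hz : IsolatedRoot r (4 * h) p ω z)
    (hz' : IsolatedRoot r (4 * h) p' ω z') : ¬ Conn ({v | ω v = false} ∩ square h) z z' := by
  intro hc
  obtain ⟨h1, h2, h3, h4⟩ := hz
  obtain ⟨h1', h2', h3', -⟩ := hz'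
  obtain ⟨u, w, hzu, huw, hw, hw'⟩ := hc.first_exit (M := regionAt r (4 * h) p)
    (by rw [mem_regionAt]; omega) (by rw [mem_regionAt]; omega)
  have hu := hzu.right_mem.2
  have hu2 := hzu.right_mem.1.2
  have hw2 := hw.2
  rw [mem_rect] at hu2 hw2
  refine h4 u ?_ (hzu.symm.mono fun v hv => ⟨hv.1.1, hv.2⟩)
  rw [adj_iff] at huw
  rw [mem_regionAt] at hu hw'
  simp only [lowerSide, slabBottom, Set.mem_union, mem_side, Set.mem_ofPred_eq]
  omega

/-- An isolated root which is connected to a closed connection of `A` and `B` in `D`. -/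
def TaggedRoot (r h : ℤ) (D A B : Set Site) (p : Site) : Set Config :=
  {ω | ∃ z, IsolatedRoot r (4 * h) p ω z ∧ ∃ a ∈ A, ∃ b ∈ B,
    Conn ({v | ω v = false} ∩ square h) z a ∧ Conn ({v | ω v = false} ∩ D) a b}

theorem TaggedRoot.finDep (r h : ℤ) {D : Set Site} (hD : D.Finite) (A B : Set Site) (p : Site) :
    FinDep (TaggedRoot r h D A B p) := by
  have hfin : (regionAt r (4 * h) p).Finite :=
    (region_finite r (4 * h)).preimage (f := fun v : Site => (v.1 - p.1, v.2 - p.2)) fun v _ w _ h => by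
      simp only [Prod.mk.injEq] at h
      exact Prod.ext (by omega) (by omega)
  refine ⟨(regionAt r (4 * h) p ∪ square h) ∪ D, (hfin.union (rect_finite ..)).union hD,
    fun ω ω' hω => ?_⟩
  simp only [TaggedRoot, IsolatedRoot, Set.mem_ofPred_eq]
  rw [color_inter_congr false fun v hv => hω v (.inl (.inl hv)),
    color_inter_congr false fun v hv => hω v (.inl (.inr hv)),
    color_inter_congr false fun v hv => hω v (.inr hv)]
  exact id

/-- The isolated arms leave the square through the right, the left or the top side. -/
theorem isolatedArmAt_subset {r h : ℤ} (hr : 1 ≤ r) (hh : 32 * r ≤ h) {p : Site}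
    (hp : 0 ≤ p.1 ∧ p.1 + r ≤ h ∧ 0 ≤ p.2 ∧ p.2 ≤ h) :
    IsolatedArmAt r (4 * h) p ⊆
      (TaggedRoot r h (rect h (2 * h) (-2 * h) (2 * h)) {v | v.1 = h} {v | v.1 = 2 * h} p ∪
      TaggedRoot r h (rect (-2 * h) (-h) (-2 * h) (2 * h)) {v | v.1 = -2 * h} {v | v.1 = -h} p) ∪
      TaggedRoot r h (rect (-2 * h) (2 * h) h (2 * h)) {v | v.2 = h} {v | v.2 = 2 * h} p := by
  rintro ω ⟨z, t, hz, ht, hzt⟩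
  have hz' := hz
  obtain ⟨h1, h2, h3, -⟩ := hz'
  obtain ⟨ht1, ht2⟩ := ht
  rw [mem_hBox_zero] at ht1
  simp only at ht1 ht2
  obtain ⟨u, w, hzu, huw, hw, hw'⟩ := hzt.first_exit (M := square h)
    (by rw [mem_rect]; omega) (by rw [mem_rect]; omega)
  have hu := hzu.right_mem
  have hu1 := hu.1.2
  have hu2 := hu.2
  rw [mem_regionAt] at hu1
  have hw2 := hw.2
  rw [mem_regionAt] at hw2
  rw [mem_rect] at hu2 hw'
  rw [adj_iff] at huw
  have hzu' : Conn ({v | ω v = false} ∩ square h) z u := hzu.mono fun v hv => ⟨hv.1.1, hv.2⟩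
  have hcl := hzu'.within_cluster
  have hcases : u.1 = 2 * h ∨ u.1 = -2 * h ∨ u.2 = 2 * h := by omega
  rcases hcases with h4 | h4 | h4
  · obtain ⟨a, b, ha, hb, hab⟩ := hcl.sub_horiz (x₀ := h) (x₁ := 2 * h) (by omega) (by omega)
      (by omega)
    refine .inl (.inl ⟨z, hz, a, ha, b, hb, hab.left_mem.1, hab.mono ?_⟩)
    rintro v ⟨hv, hv2⟩
    have h5 := hv.right_mem
    refine ⟨h5.1, ?_⟩
    have h6 := h5.2
    rw [mem_rect] at h6 ⊢
    simp only [Set.mem_ofPred_eq] at hv2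
    omega
  · obtain ⟨a, b, ha, hb, hab⟩ := hcl.symm.sub_horiz (x₀ := -2 * h) (x₁ := -h) (by omega) (by omega)
      (by omega)
    refine .inl (.inr ⟨z, hz, a, ha, b, hb, hab.left_mem.1, hab.mono ?_⟩)
    rintro v ⟨hv, hv2⟩
    have h5 := hv.right_mem
    refine ⟨h5.1, ?_⟩
    have h6 := h5.2
    rw [mem_rect] at h6 ⊢
    simp only [Set.mem_ofPred_eq] at hv2
    omega
  · obtain ⟨a, b, ha, hb, hab⟩ := hcl.sub_vert (y₀ := h) (y₁ := 2 * h) (by omega) (by omega)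
      (by omega)
    refine .inr ⟨z, hz, a, ha, b, hb, hab.left_mem.1, hab.mono ?_⟩
    rintro v ⟨hv, hv2⟩
    have h5 := hv.right_mem
    refine ⟨h5.1, ?_⟩
    have h6 := h5.2
    rw [mem_rect] at h6 ⊢
    simp only [Set.mem_ofPred_eq] at hv2
    omega

/-- The tagged roots of separated boxes give disjoint crossings. -/
theorem mem_crossings_of_tagged {r h : ℤ} {D A B : Set Site} (hD : D ⊆ square h) {t : Finset Site}
    {ω : Config} (ht : ∀ p ∈ t, ω ∈ TaggedRoot r h D A B p)
    (hsep : ∀ p ∈ t, ∀ p' ∈ t, p ≠ p' → ∀ z z', IsolatedRoot r (4 * h) p ω z →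
      IsolatedRoot r (4 * h) p' ω z' → ¬ Conn ({v | ω v = false} ∩ square h) z z') :
    ω ∈ Crossings t.card D A B := by
  classical
  choose! z hz a ha b hb hza hab using ht
  set e := t.equivFin with he
  set g : Site → ℕ := fun v => if hv : ∃ p : t, Conn ({v | ω v = false} ∩ square h) (z p) v
    then (e hv.choose : ℕ) else 0 with hg
  refine ⟨g, fun i hi => ?_⟩
  set p := e.symm ⟨i, hi⟩ with hp
  refine ⟨a p, ha p p.2, b p, hb p p.2, (hab p p.2).within_cluster.mono fun v hv => ?_⟩
  have hv' : Conn ({v | ω v = false} ∩ D) (a p) v := hv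
  refine ⟨hv'.right_mem.1, hv'.right_mem.2, ?_⟩
  have h1 : Conn ({v | ω v = false} ∩ square h) (z p) v :=
    (hza p p.2).trans (hv'.mono (Set.inter_subset_inter_right _ hD))
  have hex : ∃ p : t, Conn ({v | ω v = false} ∩ square h) (z p) v := ⟨p, h1⟩
  have h2 : hex.choose = p := by
    by_contra hne
    exact hsep _ hex.choose.2 _ p.2 (fun h => hne (Subtype.ext h)) _ _ (hz _ hex.choose.2)
      (hz p p.2) (hex.choose_spec.trans h1.symm)
  simp only [Set.mem_ofPred_eq, hg]
  rw [dif_pos hex, h2, hp]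
  simp

/-- If simultaneous occurrence of `k` of the events forces an event of probability at most `q ^ k`,
then the expected number of occurring events is at most `1 / (1 - q)`. -/
theorem IsBernoulliHalf.sum_real_le {μ : Measure Config} (hμ : IsBernoulliHalf μ) {ι : Type*}
    (s : Finset ι) {E : ι → Set Config} (hE : ∀ i ∈ s, FinDep (E i)) {F : ℕ → Set Config}
    (hF : ∀ k, FinDep (F k)) (hEF : ∀ t ⊆ s, ∀ ω, (∀ i ∈ t, ω ∈ E i) → ω ∈ F t.card)
    {q : ℝ} (hq0 : 0 ≤ q) (hq1 : q < 1) (hq : ∀ k, μ.real (F k) ≤ q ^ k) :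
    ∑ i ∈ s, μ.real (E i) ≤ (1 - q)⁻¹ := by
  classical
  have := hμ.1
  have hind : ∀ {G : Set Config}, FinDep G → Integrable (G.indicator (1 : Config → ℝ)) μ :=
    fun hG => (integrable_const (1 : ℝ)).indicator hG.measurableSet
  have hInt : ∀ {G : Set Config}, FinDep G → ∫ ω, G.indicator (1 : Config → ℝ) ω ∂μ = μ.real G :=
    fun hG => integral_indicator_one hG.measurableSet
  have h1 : ∑ i ∈ s, μ.real (E i) = ∫ ω, ∑ i ∈ s, (E i).indicator (1 : Config → ℝ) ω ∂μ := by
    rw [integral_finsetSum _ fun i hi => hind (hE i hi)]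
    exact Finset.sum_congr rfl fun i hi => (hInt (hE i hi)).symm
  have h2 : ∑ j ∈ Finset.range s.card, μ.real (F (j + 1)) =
      ∫ ω, ∑ j ∈ Finset.range s.card, (F (j + 1)).indicator (1 : Config → ℝ) ω ∂μ := by
    rw [integral_finsetSum _ fun j _ => hind (hF (j + 1))]
    exact Finset.sum_congr rfl fun j _ => (hInt (hF (j + 1))).symm
  have h3 : ∑ i ∈ s, μ.real (E i) ≤ ∑ j ∈ Finset.range s.card, μ.real (F (j + 1)) := by
    rw [h1, h2]
    refine integral_mono (integrable_finsetSum _ fun i hi => hind (hE i hi))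
      (integrable_finsetSum _ fun j _ => hind (hF (j + 1))) fun ω => ?_
    simp only [Set.indicator_apply, Pi.one_apply]
    rw [Finset.sum_boole, Finset.sum_boole]
    norm_cast
    have hsub : Finset.range {i ∈ s | ω ∈ E i}.card ⊆
        {j ∈ Finset.range s.card | ω ∈ F (j + 1)} := by
      intro j hj
      rw [Finset.mem_range] at hj
      rw [Finset.mem_filter, Finset.mem_range]
      refine ⟨hj.trans_le (Finset.card_filter_le _ _), ?_⟩
      obtain ⟨t, ht, htc⟩ := Finset.exists_subset_card_eq (Nat.succ_le_of_lt hj)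
      have := hEF t (ht.trans (Finset.filter_subset _ _)) ω fun i hi => (Finset.mem_filter.1 (ht hi)).2
      rwa [htc] at this
    simpa using Finset.card_le_card hsub
  refine h3.trans ?_
  calc ∑ j ∈ Finset.range s.card, μ.real (F (j + 1)) ≤ ∑ j ∈ Finset.range s.card, q ^ j :=
        Finset.sum_le_sum fun j _ => (hq _).trans (pow_le_pow_of_le_one hq0 hq1.le (Nat.le_succ j))
    _ ≤ ∑' j, q ^ j := (summable_geometric_of_lt_one hq0 hq1).sum_le_tsum _ fun j _ => by positivity
    _ = (1 - q)⁻¹ := tsum_geometric_of_lt_one hq0 hq1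

/-- A square grid of sites with mesh `16 * r`. -/
def grid (r : ℤ) (M : ℕ) : Finset Site :=
  (Finset.range M ×ˢ Finset.range M).image fun i => (16 * (r * i.1), 16 * (r * i.2))

theorem grid_card {r : ℤ} (hr : 1 ≤ r) (M : ℕ) : (grid r M).card = M ^ 2 := by
  rw [grid, Finset.card_image_of_injective, Finset.card_product, Finset.card_range, sq]
  rintro ⟨i, j⟩ ⟨i', j'⟩ h
  have hr0 : r ≠ 0 := by omega
  simpa [hr0] using h

theorem grid_bounds {r : ℤ} (hr : 1 ≤ r) {M : ℕ} {p : Site} (hp : p ∈ grid r M) :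
    0 ≤ p.1 ∧ p.1 + r ≤ 32 * (r * M) ∧ 0 ≤ p.2 ∧ p.2 + r ≤ 32 * (r * M) := by
  simp only [grid, Finset.mem_image, Finset.mem_product, Finset.mem_range] at hp
  obtain ⟨⟨i, j⟩, ⟨hi, hj⟩, rfl⟩ := hp
  have hi' : (i : ℤ) + 1 ≤ M := by exact_mod_cast hi
  have hj' : (j : ℤ) + 1 ≤ M := by exact_mod_cast hj
  have h1 := mul_le_mul_of_nonneg_left hi' (by omega : 0 ≤ r)
  have h2 := mul_le_mul_of_nonneg_left hj' (by omega : 0 ≤ r)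
  have h3 : 0 ≤ r * (i : ℤ) := by positivity
  have h4 : 0 ≤ r * (j : ℤ) := by positivity
  rw [mul_add, mul_one] at h1 h2
  simp only
  omega

theorem grid_sep {r : ℤ} (hr : 1 ≤ r) {M : ℕ} {p p' : Site} (hp : p ∈ grid r M)
    (hp' : p' ∈ grid r M) (hne : p ≠ p') :
    (p'.2 + 16 * r ≤ p.2 ∨ (p'.2 = p.2 ∧ (p'.1 + 16 * r ≤ p.1 ∨ p.1 + 16 * r ≤ p'.1))) ∨
      p.2 + 16 * r ≤ p'.2 := by
  simp only [grid, Finset.mem_image, Finset.mem_product, Finset.mem_range] at hp hp'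
  obtain ⟨⟨i, j⟩, -, rfl⟩ := hp
  obtain ⟨⟨i', j'⟩, -, rfl⟩ := hp'
  have key : ∀ a b : ℕ, a < b → 16 * (r * (a : ℤ)) + 16 * r ≤ 16 * (r * b) := fun a b hab => by
    have : (a : ℤ) + 1 ≤ b := by exact_mod_cast hab
    have := mul_le_mul_of_nonneg_left this (by omega : 0 ≤ r)
    rw [mul_add, mul_one] at this
    omega
  simp only
  rcases lt_trichotomy j j' with h | rfl | h
  · exact .inr (key _ _ h)
  · rcases lt_trichotomy i i' with h | rfl | h
    · exact .inl (.inr ⟨rfl, .inr (key _ _ h)⟩)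
    · exact absurd rfl hne
    · exact .inl (.inr ⟨rfl, .inl (key _ _ h)⟩)
  · exact .inl (.inl (key _ _ h))

theorem sum_tagged_le {μ : Measure Config} (hμ : IsBernoulliHalf μ) {r : ℤ} (hr : 1 ≤ r) (M : ℕ)
    {D A B : Set Site} (hD : D ⊆ square (32 * (r * M)))
    (hle : ∀ k, μ.real (Crossings k D A B) ≤ (1 - rsw) ^ k) :
    ∑ p ∈ grid r M, μ.real (TaggedRoot r (32 * (r * M)) D A B p) ≤ rsw⁻¹ := by
  have hDf : D.Finite := (rect_finite ..).subset hD
  have := hμ.sum_real_le (grid r M) (fun p _ => TaggedRoot.finDep r (32 * (r * M)) hDf A B p)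
    (fun k => Crossings.finDep hDf k A B) (fun t ht ω hω => ?_) (q := 1 - rsw)
    (by linarith [rsw_le_one]) (by linarith [rsw_pos]) hle
  · simpa using this
  · refine mem_crossings_of_tagged hD hω fun p hp p' hp' hne z z' hz hz' hc => ?_
    have b1 := grid_bounds hr (ht hp)
    have b2 := grid_bounds hr (ht hp')
    rcases grid_sep hr (ht hp) (ht hp') hne with h | h
    · exact IsolatedRoot.not_conn hr (by omega) h hz hz' hc
    · exact IsolatedRoot.not_conn hr (by omega) (.inl h) hz' hz hc.symm

theorem J3.le {μ : Measure Config} (hμ : IsBernoulliHalf μ) (a b : ℤ) {r : ℤ} (hr : 1 ≤ r) {M : ℕ}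
    (hM : 1 ≤ M) :
    rsw ^ 12 * (M : ℝ) ^ 2 * μ.real {ω | J3 a b r (r * (128 * M)) ω} ≤ 3 := by
  rw [J3.real_eq hμ]
  have hMr : r ≤ r * M := le_mul_of_one_le_right (by omega) (by exact_mod_cast hM)
  set h : ℤ := 32 * (r * M) with hh
  have e : r * (128 * (M : ℤ)) = 4 * h := by rw [hh]; ring
  rw [e]
  have h1 := isolatedArm_ge hμ (R := 4 * h) hr (by omega)
  have t1 := sum_tagged_le hμ hr M (D := rect h (2 * h) (-2 * h) (2 * h)) (A := {v | v.1 = h})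
    (B := {v | v.1 = 2 * h}) (fun v hv => by rw [mem_rect] at hv ⊢; omega)
    (Crossings.real_le hμ (by omega) (by omega) (by omega))
  have t2 := sum_tagged_le hμ hr M (D := rect (-2 * h) (-h) (-2 * h) (2 * h))
    (A := {v | v.1 = -2 * h}) (B := {v | v.1 = -h}) (fun v hv => by rw [mem_rect] at hv ⊢; omega)
    (Crossings.real_le hμ (by omega) (by omega) (by omega))
  have t3 := sum_tagged_le hμ hr M (D := rect (-2 * h) (2 * h) h (2 * h)) (A := {v | v.2 = h})
    (B := {v | v.2 = 2 * h}) (fun v hv => by rw [mem_rect] at hv ⊢; omega)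
    (Crossings.real_le_vert hμ (by omega) (by omega) (by omega))
  have h2 : ∑ p ∈ grid r M, μ.real {ω | IsolatedArm r (4 * h) ω} ≤ 3 * rsw⁻¹ := by
    have := hμ.1
    calc _ ≤ ∑ p ∈ grid r M, ((μ.real (TaggedRoot r h (rect h (2 * h) (-2 * h) (2 * h))
            {v | v.1 = h} {v | v.1 = 2 * h} p) +
          μ.real (TaggedRoot r h (rect (-2 * h) (-h) (-2 * h) (2 * h)) {v | v.1 = -2 * h}
            {v | v.1 = -h} p)) +
          μ.real (TaggedRoot r h (rect (-2 * h) (2 * h) h (2 * h)) {v | v.2 = h}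
            {v | v.2 = 2 * h} p)) := by
          refine Finset.sum_le_sum fun p hp => ?_
          have hb := grid_bounds hr hp
          refine (isolatedArm_real_le hμ r (4 * h) p).trans
            ((hμ.real_mono (isolatedArmAt_subset hr (by omega) (by omega))).trans ?_)
          exact (measureReal_union_le _ _).trans (add_le_add_left (measureReal_union_le _ _) _)
      _ ≤ _ := by
          rw [Finset.sum_add_distrib, Finset.sum_add_distrib]
          linarith
  rw [Finset.sum_const, grid_card hr, nsmul_eq_mul] at h2
  push_cast at h2
  have hp := rsw_pos
  calc rsw ^ 12 * (M : ℝ) ^ 2 * μ.real {ω | J3 0 0 r (4 * h) ω}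
      = rsw * ((M : ℝ) ^ 2 * (rsw ^ 11 * μ.real {ω | J3 0 0 r (4 * h) ω})) := by ring
    _ ≤ rsw * ((M : ℝ) ^ 2 * μ.real {ω | IsolatedArm r (4 * h) ω}) := by gcongr
    _ ≤ rsw * (3 * rsw⁻¹) := by gcongr
    _ = 3 := by field_simp

theorem J3.real_bounds {μ : Measure Config} (hμ : IsBernoulliHalf μ) (a b : ℤ) {ρ ν : ℕ}
    (h : ρ ≤ ν) :
    rsw ^ 4 / 14 * ((2 : ℝ) ^ ρ / 2 ^ ν) ^ 2 ≤ μ.real {ω | J3 a b (2 ^ ρ) (2 ^ ν) ω} ∧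
      μ.real {ω | J3 a b (2 ^ ρ) (2 ^ ν) ω} ≤
        3 * 2 ^ 14 / rsw ^ 12 * ((2 : ℝ) ^ ρ / 2 ^ ν) ^ 2 := by
  have hp := rsw_pos
  have hr : (1 : ℤ) ≤ 2 ^ ρ := one_le_pow₀ (by norm_num)
  obtain ⟨n, rfl⟩ := Nat.exists_eq_add_of_le h
  have hratio : ((2 : ℝ) ^ ρ / 2 ^ (ρ + n)) ^ 2 = (((2 : ℝ) ^ n) ^ 2)⁻¹ := by
    rw [pow_add]; field_simp
  rw [hratio]
  constructor
  · have h1 := J3.ge hμ a b hr (n := 2 ^ n) (one_le_pow₀ (by norm_num))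
    rw [← pow_add] at h1
    push_cast at h1
    rw [← div_eq_mul_inv, div_div, div_le_iff₀ (by positivity)]
    linarith
  · rcases lt_or_ge n 7 with hn | hn
    · refine (hμ.real_le_one _).trans ?_
      have h2 : ((2 : ℝ) ^ n) ^ 2 ≤ 2 ^ 14 := by
        rw [← pow_mul]
        exact pow_le_pow_right₀ (by norm_num) (by omega)
      have h3 : rsw ^ 12 ≤ 1 := pow_le_one₀ hp.le rsw_le_one
      rw [← div_eq_mul_inv, div_div, one_le_div (by positivity)]
      calc rsw ^ 12 * ((2 : ℝ) ^ n) ^ 2 ≤ 1 * 2 ^ 14 := by gcongr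
        _ ≤ 3 * 2 ^ 14 := by norm_num
    · obtain ⟨m, rfl⟩ := Nat.exists_eq_add_of_le hn
      have h1 := J3.le hμ a b hr (M := 2 ^ m) Nat.one_le_two_pow
      have e : (2 : ℤ) ^ ρ * (128 * ((2 ^ m : ℕ) : ℤ)) = 2 ^ (ρ + (7 + m)) := by
        push_cast; ring
      rw [e] at h1
      push_cast at h1
      have e2 : ((2 : ℝ) ^ (7 + m)) ^ 2 = 2 ^ 14 * ((2 : ℝ) ^ m) ^ 2 := by ring
      rw [← div_eq_mul_inv, div_div, le_div_iff₀ (by positivity), e2]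
      nlinarith

/-- There exist constants `0 < c ≤ C < ∞` such that for all integers
`0 ≤ ρ ≤ ν` (and every position of the horseshoe pair),
`c·(2^ρ/2^ν)² ≤ P(J₃(ρ,ν)) ≤ C·(2^ρ/2^ν)²`. -/
theorem statement3 :
    ∃ c C : ℝ≥0∞, 0 < c ∧ c ≤ C ∧ C < ⊤ ∧
      ∀ μ : Measure Config, IsBernoulliHalf μ →
        ∀ a b : ℤ, ∀ ρ ν : ℕ, ρ ≤ ν →
          c * ((2 : ℝ≥0∞) ^ ρ / (2 : ℝ≥0∞) ^ ν) ^ 2 ≤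
              μ {ω | J3 a b ((2 : ℤ) ^ ρ) ((2 : ℤ) ^ ν) ω} ∧
            μ {ω | J3 a b ((2 : ℤ) ^ ρ) ((2 : ℤ) ^ ν) ω} ≤
              C * ((2 : ℝ≥0∞) ^ ρ / (2 : ℝ≥0∞) ^ ν) ^ 2 := by
  have hp := rsw_pos
  have hp1 := rsw_le_one
  have h3 : rsw ^ 12 ≤ 1 := pow_le_one₀ hp.le hp1
  have h4 : rsw ^ 4 ≤ 1 := pow_le_one₀ hp.le hp1
  refine ⟨ENNReal.ofReal (rsw ^ 4 / 14), ENNReal.ofReal (3 * 2 ^ 14 / rsw ^ 12),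
    ENNReal.ofReal_pos.2 (by positivity), ENNReal.ofReal_le_ofReal ?_, ENNReal.ofReal_lt_top,
    fun μ hμ a b ρ ν h => ?_⟩
  · calc rsw ^ 4 / 14 ≤ 1 := by linarith
      _ ≤ 3 * 2 ^ 14 / rsw ^ 12 := by
        rw [one_le_div (by positivity)]
        exact h3.trans (by norm_num)
  · have := hμ.1
    have e : (2 : ℝ≥0∞) ^ ρ / (2 : ℝ≥0∞) ^ ν = ENNReal.ofReal ((2 : ℝ) ^ ρ / 2 ^ ν) := by
      rw [ENNReal.ofReal_div_of_pos (by positivity), ENNReal.ofReal_pow (by norm_num),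
        ENNReal.ofReal_pow (by norm_num), ENNReal.ofReal_ofNat]
    rw [e, ← ENNReal.ofReal_pow (by positivity), ← ENNReal.ofReal_mul (by positivity),
      ← ENNReal.ofReal_mul (by positivity), ← ofReal_measureReal]
    obtain ⟨h5, h6⟩ := J3.real_bounds hμ a b h
    exact ⟨ENNReal.ofReal_le_ofReal h5, ENNReal.ofReal_le_ofReal h6⟩
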